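/- arXiv:math/0304218 — 4 statements merged into one kernel-verified Lean document; each statement's English description precedes it below -/
import Mathlib

section
/- Let k be any field, let n ≥ 4, and let I_{2,n} be the Plücker ideal in k[p_{ij} : 1 ≤ i < j ≤ n]. For w ∈ ℝ^{C(n,2)} with coordinates w_{ij}, the initial ideal in_w(I_{2,n}) contains no monomial if and only if w satisfies the four-point condition: for every 1 ≤ i < j < k < l ≤ n, the minimum of the three numbers w_{ij} + w_{kl}, w_{ik} + w_{jl}, w_{il} + w_{jk} is attained at least twice. In particular, this characterization holds over every field, so the tropical Grassmannian G_{2,n} = {w : in_w(I_{2,n}) is monomial-free} is independent of the characteristic of k. -/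
open scoped Classical

open MvPolynomial

/-- The `w`-weight of an exponent vector `a`, namely `∑ aᵢ wᵢ`. -/
noncomputable def expWeight {σ : Type*} (w : σ → ℝ) (a : σ →₀ ℕ) : ℝ :=
  a.sum fun i e => (e : ℝ) * w i

/-- The initial form of `f` with respect to the weight vector `w`: the sum of the terms of `f`
of minimal `w`-weight. -/
noncomputable def initForm {σ : Type*} {k : Type*} [CommRing k] (w : σ → ℝ)
    (f : MvPolynomial σ k) : MvPolynomial σ k :=
  ∑ a ∈ f.support.filter (fun a => ∀ b ∈ f.support, expWeight w a ≤ expWeight w b),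
    monomial a (f.coeff a)

/-- The initial ideal `in_w(I) = ⟨in_w(f) : f ∈ I⟩`. -/
noncomputable def initIdeal {σ : Type*} {k : Type*} [CommRing k] (w : σ → ℝ)
    (I : Ideal (MvPolynomial σ k)) : Ideal (MvPolynomial σ k) :=
  Ideal.span { g | ∃ f ∈ I, g = initForm w f }

/-- A monomial: a nonzero scalar multiple of a product of variables. -/
def IsMonomial {σ : Type*} {k : Type*} [CommRing k] (g : MvPolynomial σ k) : Prop :=
  ∃ (a : σ →₀ ℕ) (c : k), c ≠ 0 ∧ g = monomial a c

/-- An ideal is monomial-free if it contains no monomial. -/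
def MonomialFree {σ : Type*} {k : Type*} [CommRing k] (I : Ideal (MvPolynomial σ k)) : Prop :=
  ∀ g ∈ I, ¬ IsMonomial g

/-- The Plücker (algebra) map, sending the variable `p_S` (for a `d`-subset `S` of `{0,…,n-1}`)
to the `d × d` minor on the columns indexed by `S` of a `d × n` matrix of indeterminates. -/
noncomputable def pluckerMap (k : Type*) [CommRing k] (d n : ℕ) :
    MvPolynomial {s : Finset (Fin n) // s.card = d} k →ₐ[k] MvPolynomial (Fin d × Fin n) k :=
  aeval fun S =>
    (Matrix.of fun r c : Fin d => (X (r, ((S.1.orderIsoOfFin S.2 c : S.1) : Fin n)) :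
       MvPolynomial (Fin d × Fin n) k)).det

/-- The Plücker ideal `I_{d,n}`: the ideal of algebraic relations among the maximal
minors of a generic `d × n` matrix. -/
noncomputable def pluckerIdeal (k : Type*) [CommRing k] (d n : ℕ) :
    Ideal (MvPolynomial {s : Finset (Fin n) // s.card = d} k) :=
  RingHom.ker (pluckerMap k d n)

/-- The variable index `p_{ij}` for `i ≠ j`. -/
def pr {n : ℕ} (i j : Fin n) (h : i ≠ j) : {s : Finset (Fin n) // s.card = 2} :=
  ⟨{i, j}, Finset.card_pair h⟩

/-- The minimum of three reals is attained at least twice. -/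
def minTwice (a b c : ℝ) : Prop :=
  (a = b ∧ a ≤ c) ∨ (a = c ∧ a ≤ b) ∨ (b = c ∧ b ≤ a)

/-- The four-point condition for `w ∈ ℝ^{C(n,2)}`: for all `i < j < k < l`, the minimum of
`w_{ij}+w_{kl}`, `w_{ik}+w_{jl}`, `w_{il}+w_{jk}` is attained at least twice. -/
def FourPoint {n : ℕ} (w : {s : Finset (Fin n) // s.card = 2} → ℝ) : Prop :=
  ∀ i j k l : Fin n, ∀ hij : i < j, ∀ hjk : j < k, ∀ hkl : k < l,
    minTwice (w (pr i j hij.ne) + w (pr k l hkl.ne))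
      (w (pr i k (hij.trans hjk).ne) + w (pr j l (hjk.trans hkl).ne))
      (w (pr i l (hij.trans (hjk.trans hkl)).ne) + w (pr j k hjk.ne))

/-! ### Helpers -/

lemma tg_expWeight_add {σ : Type*} (w : σ → ℝ) (a b : σ →₀ ℕ) :
    expWeight w (a + b) = expWeight w a + expWeight w b := by
  unfold expWeight
  apply Finsupp.sum_add_index'
  · intro i; simp
  · intro i x y; push_cast; ring

lemma tg_expWeight_single {σ : Type*} (w : σ → ℝ) (i : σ) (e : ℕ) :
    expWeight w (Finsupp.single i e) = e * w i := by
  unfold expWeight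
  simp

lemma tg_initForm_three {σ : Type*} {k : Type*} [CommRing k] (w : σ → ℝ)
    (e₁ e₂ e₃ : σ →₀ ℕ) (c₁ c₂ c₃ : k) (h₁ : c₁ ≠ 0)
    (h₂ : expWeight w e₁ < expWeight w e₂) (h₃ : expWeight w e₁ < expWeight w e₃) :
    initForm w (monomial e₁ c₁ + monomial e₂ c₂ + monomial e₃ c₃) = monomial e₁ c₁ := by
  set f := monomial e₁ c₁ + monomial e₂ c₂ + monomial e₃ c₃ with hf
  have n₂ : e₂ ≠ e₁ := by rintro rfl; exact lt_irrefl _ h₂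
  have n₃ : e₃ ≠ e₁ := by rintro rfl; exact lt_irrefl _ h₃
  have hc : f.coeff e₁ = c₁ := by
    simp [hf, coeff_monomial, n₂, n₃]
  have hs : ∀ b ∈ f.support, b ≠ e₁ → expWeight w e₁ < expWeight w b := by
    intro b hb hne
    by_cases hb2 : b = e₂
    · rw [hb2]; exact h₂
    by_cases hb3 : b = e₃
    · rw [hb3]; exact h₃
    exfalso
    rw [mem_support_iff] at hb
    apply hb
    simp [hf, coeff_monomial, Ne.symm hne, Ne.symm hb2, Ne.symm hb3]
  have he : e₁ ∈ f.support := by rw [mem_support_iff, hc]; exact h₁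
  have : f.support.filter (fun a => ∀ b ∈ f.support, expWeight w a ≤ expWeight w b) = {e₁} := by
    ext a
    simp only [Finset.mem_filter, Finset.mem_singleton]
    constructor
    · rintro ⟨ha, hb⟩
      by_contra hne
      exact absurd (hs a ha hne) (not_lt.2 (hb e₁ he))
    · rintro rfl
      refine ⟨he, fun b hb => ?_⟩
      by_cases hne : b = a
      · rw [hne]
      · exact (hs b hb hne).le
  unfold initForm
  rw [this, Finset.sum_singleton, hc]

/-- `z` has order `w` and leading coefficient `c`. -/
def TgLead {K : Type*} [CommRing K] (z : HahnSeries ℝ K) (w : ℝ) (c : K) : Prop :=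
  c ≠ 0 ∧ z.coeff w = c ∧ ∀ s < w, z.coeff s = 0

lemma TgLead.ne_zero {K : Type*} [CommRing K] {z : HahnSeries ℝ K} {w : ℝ} {c : K}
    (h : TgLead z w c) : z ≠ 0 := by
  rintro rfl
  exact h.1 (by rw [← h.2.1]; simp)

lemma TgLead.order {K : Type*} [CommRing K] {z : HahnSeries ℝ K} {w : ℝ} {c : K}
    (h : TgLead z w c) : z.order = w := by
  apply le_antisymm
  · apply HahnSeries.order_le_of_coeff_ne_zero
    rw [h.2.1]; exact h.1
  · rw [HahnSeries.le_order_iff_forall h.ne_zero]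
    exact h.2.2

lemma TgLead.mul {K : Type*} [CommRing K] [IsDomain K] {z z' : HahnSeries ℝ K} {w w' : ℝ} {c c' : K}
    (h : TgLead z w c) (h' : TgLead z' w' c') : TgLead (z * z') (w + w') (c * c') := by
  have e := h.order
  have e' := h'.order
  have em := HahnSeries.order_mul h.ne_zero h'.ne_zero
  refine ⟨mul_ne_zero h.1 h'.1, ?_, ?_⟩
  · have := HahnSeries.coeff_mul_order_add_order z z'
    rw [e, e', HahnSeries.leadingCoeff_eq, HahnSeries.leadingCoeff_eq, e, e', h.2.1, h'.2.1] at this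
    exact this
  · intro s hs
    apply HahnSeries.coeff_eq_zero_of_lt_order
    rw [em, e, e']; exact hs

lemma tg_lead_single {K : Type*} [CommRing K] (w : ℝ) (c : K) (hc : c ≠ 0) :
    TgLead (HahnSeries.single w c) w c := by
  refine ⟨hc, by simp, fun s hs => ?_⟩
  rw [HahnSeries.coeff_single_of_ne hs.ne]

lemma tg_lead_pow {K : Type*} [CommRing K] [IsDomain K] {z : HahnSeries ℝ K} {w : ℝ} {c : K}
    (h : TgLead z w c) (m : ℕ) : TgLead (z ^ m) (m * w) (c ^ m) := by
  induction m with
  | zero =>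
    have := tg_lead_single (0 : ℝ) (1 : K) one_ne_zero
    simpa using this
  | succ m ih =>
    have := ih.mul h
    rw [pow_succ, pow_succ]
    convert this using 1
    push_cast; ring

lemma tg_lead_prod {σ : Type*} {K : Type*} [CommRing K] [IsDomain K]
    (z : σ → HahnSeries ℝ K) (w : σ → ℝ) (c : σ → K) (h : ∀ i, TgLead (z i) (w i) (c i))
    (a : σ →₀ ℕ) :
    TgLead (a.prod fun i e => z i ^ e) (expWeight w a) (a.prod fun i e => c i ^ e) := by
  unfold expWeight Finsupp.prod Finsupp.sum
  induction a.support using Finset.induction_on with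
  | empty =>
    have := tg_lead_single (0 : ℝ) (1 : K) one_ne_zero
    simpa using this
  | insert i s hi ih =>
    rw [Finset.prod_insert hi, Finset.prod_insert hi, Finset.sum_insert hi]
    exact (tg_lead_pow (h i) _).mul ih

lemma tg_aeval_initForm {σ : Type*} {k K : Type*} [Field k] [CommRing K] [IsDomain K] [Algebra k K]
    (z : σ → HahnSeries ℝ K) (w : σ → ℝ) (c : σ → K) (h : ∀ i, TgLead (z i) (w i) (c i))
    (f : MvPolynomial σ k) (hf : aeval z f = 0) : aeval c (initForm w f) = 0 := by
  by_cases h0 : f = 0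
  · subst h0; simp [initForm]
  obtain ⟨a₀, ha₀, hmin⟩ := Finset.exists_min_image f.support (expWeight w)
    (Finset.nonempty_iff_ne_empty.2 (by simpa using h0))
  have h1 : (aeval z f).coeff (expWeight w a₀) = 0 := by rw [hf]; simp
  rw [f.as_sum, map_sum, HahnSeries.coeff_sum] at h1
  unfold initForm
  rw [map_sum, Finset.sum_filter]
  refine Eq.trans ?_ h1
  apply Finset.sum_congr rfl
  intro a ha
  have hl := tg_lead_prod z w c h a
  have hC : algebraMap k (HahnSeries ℝ K) (f.coeff a) =
    HahnSeries.single 0 (algebraMap k K (f.coeff a)) := by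
    rw [HahnSeries.algebraMap_apply', ← HahnSeries.C_apply, ← HahnSeries.ofPowerSeries_C,
      PowerSeries.algebraMap_apply]
  rw [aeval_monomial, aeval_monomial, hC, HahnSeries.coeff_single_zero_mul]
  split_ifs with hc
  · have : expWeight w a = expWeight w a₀ := le_antisymm (hc _ ha₀) (hmin _ ha)
    rw [← this, hl.2.1]
  · have : expWeight w a₀ < expWeight w a := by
      by_contra hlt
      exact hc fun b hb => (not_lt.1 hlt).trans (hmin b hb)
    rw [hl.2.2 _ this, mul_zero]

lemma tg_monomialFree {σ : Type*} {k K : Type*} [Field k] [CommRing K] [IsDomain K] [Algebra k K]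
    (z : σ → HahnSeries ℝ K) (w : σ → ℝ) (c : σ → K) (h : ∀ i, TgLead (z i) (w i) (c i))
    (I : Ideal (MvPolynomial σ k)) (hI : ∀ f ∈ I, aeval z f = 0) :
    MonomialFree (initIdeal w I) := by
  have hle : initIdeal w I ≤ RingHom.ker (aeval c : MvPolynomial σ k →ₐ[k] K) := by
    unfold initIdeal
    rw [Ideal.span_le]
    rintro g ⟨f, hf, rfl⟩
    exact tg_aeval_initForm z w c h f (hI f hf)
  rintro g hg ⟨a, d, hd, rfl⟩
  have h1 : aeval c (monomial a d) = 0 := hle hg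
  rw [aeval_monomial] at h1
  rcases mul_eq_zero.1 h1 with h2 | h2
  · exact hd ((FaithfulSMul.algebraMap_injective k K) (by rw [h2, map_zero]))
  · exact (tg_lead_prod z w c h a).1 h2

lemma tg_orderIso {n : ℕ} (i j : Fin n) (h : i < j) (c : Fin 2) :
    (((pr i j h.ne).1.orderIsoOfFin (pr i j h.ne).2 c : (pr i j h.ne).1) : Fin n) = ![i, j] c := by
  rw [Finset.coe_orderIsoOfFin_apply, ← Finset.orderEmbOfFin_unique (f := ![i, j])]
  · intro x; fin_cases x <;> simp [pr]
  · intro x y hxy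
    fin_cases x <;> fin_cases y <;> simp_all

lemma tg_pluckerMap_X (k : Type*) [CommRing k] {n : ℕ} (i j : Fin n) (h : i < j) :
    pluckerMap k 2 n (X (pr i j h.ne)) =
      X (0, i) * X (1, j) - X (0, j) * X (1, i) := by
  unfold pluckerMap
  rw [aeval_X, Matrix.det_fin_two]
  simp only [Matrix.of_apply, tg_orderIso i j h]
  simp

lemma tg_exists_pr {n : ℕ} (S : {s : Finset (Fin n) // s.card = 2}) :
    ∃ (i j : Fin n) (h : i < j), S = pr i j h.ne := by
  obtain ⟨s, hs⟩ := S
  obtain ⟨x, y, hxy, rfl⟩ := Finset.card_eq_two.1 hs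
  rcases lt_or_gt_of_ne hxy with h | h
  · exact ⟨x, y, h, rfl⟩
  · exact ⟨y, x, h, Subtype.ext (Finset.pair_comm x y)⟩

lemma tg_not_monomialFree (k : Type*) [Field k] (n : ℕ)
    (w : {s : Finset (Fin n) // s.card = 2} → ℝ)
    (H : MonomialFree (initIdeal w (pluckerIdeal k 2 n))) : FourPoint w := by
  intro i j l m hij hjl hlm
  have key : ∀ (e₁ e₂ e₃ : {s : Finset (Fin n) // s.card = 2} →₀ ℕ) (c₁ c₂ c₃ : k), c₁ ≠ 0 →
      (monomial e₁ c₁ + monomial e₂ c₂ + monomial e₃ c₃) ∈ pluckerIdeal k 2 n →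
      ¬ (expWeight w e₁ < expWeight w e₂ ∧ expWeight w e₁ < expWeight w e₃) := by
    rintro e₁ e₂ e₃ c₁ c₂ c₃ h₁ hm ⟨h₂, h₃⟩
    refine H _ (Ideal.subset_span ⟨_, hm, rfl⟩) ⟨e₁, c₁, h₁, ?_⟩
    exact tg_initForm_three w e₁ e₂ e₃ c₁ c₂ c₃ h₁ h₂ h₃
  let E (p q : {s : Finset (Fin n) // s.card = 2}) : {s : Finset (Fin n) // s.card = 2} →₀ ℕ :=
    Finsupp.single p 1 + Finsupp.single q 1
  have hE : ∀ p q, expWeight w (E p q) = w p + w q := by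
    intro p q
    simp [E, tg_expWeight_add, tg_expWeight_single]
  have hM : ∀ p q, (monomial (E p q) (1 : k)) = X p * X q := by
    intro p q
    simp [E, X, monomial_mul]
  have hM' : ∀ p q, (monomial (E p q) (-1 : k)) = - (X p * X q) := by
    intro p q
    rw [← hM, map_neg]
  have hmem : (monomial (E (pr i j hij.ne) (pr l m hlm.ne)) (1 : k) +
      monomial (E (pr i l (hij.trans hjl).ne) (pr j m (hjl.trans hlm).ne)) (-1 : k) +
      monomial (E (pr i m (hij.trans (hjl.trans hlm)).ne) (pr j l hjl.ne)) (1 : k)) ∈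
      pluckerIdeal k 2 n := by
    rw [hM, hM, hM']
    unfold pluckerIdeal
    rw [RingHom.mem_ker]
    simp only [map_add, map_mul, map_neg]
    rw [tg_pluckerMap_X k i j hij, tg_pluckerMap_X k l m hlm, tg_pluckerMap_X k i l (hij.trans hjl),
      tg_pluckerMap_X k j m (hjl.trans hlm), tg_pluckerMap_X k i m (hij.trans (hjl.trans hlm)),
      tg_pluckerMap_X k j l hjl]
    ring
  have k1 := key _ _ _ _ _ _ one_ne_zero hmem
  have k2 := key _ _ _ _ _ _ (neg_ne_zero.2 one_ne_zero)
    (by rw [add_comm (monomial _ _) (monomial _ _)] at hmem; exact hmem)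
  have k3 := key _ _ _ _ _ _ one_ne_zero
    (by rw [add_comm _ (monomial (E (pr i m _) _) _), ← add_assoc] at hmem; exact hmem)
  simp only [hE] at k1 k2 k3
  unfold minTwice
  grind

/-- Symmetrised weights. -/
noncomputable def tgW {n : ℕ} (w : {s : Finset (Fin n) // s.card = 2} → ℝ) (i j : Fin n) : ℝ :=
  if h : i ≠ j then w (pr i j h) else 0

lemma tgW_symm {n : ℕ} (w : {s : Finset (Fin n) // s.card = 2} → ℝ) (i j : Fin n) :
    tgW w i j = tgW w j i := by
  unfold tgW
  by_cases h : i = j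
  · subst h; rfl
  · rw [dif_pos h, dif_pos (Ne.symm h)]
    congr 1
    exact Subtype.ext (Finset.pair_comm i j)

lemma tgW_lt {n : ℕ} (w : {s : Finset (Fin n) // s.card = 2} → ℝ) {i j : Fin n} (h : i < j) :
    tgW w i j = w (pr i j h.ne) := dif_pos h.ne

/-- The ultrametric attached to the base point `o`. -/
noncomputable def tgU {n : ℕ} (w : {s : Finset (Fin n) // s.card = 2} → ℝ) (o i j : Fin n) : ℝ :=
  tgW w i j - tgW w o i - tgW w o j

lemma tgU_symm {n : ℕ} (w : {s : Finset (Fin n) // s.card = 2} → ℝ) (o i j : Fin n) :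
    tgU w o i j = tgU w o j i := by
  unfold tgU; rw [tgW_symm w i j]; ring

lemma tgU_three {n : ℕ} (w : {s : Finset (Fin n) // s.card = 2} → ℝ) (hw : FourPoint w)
    (o i j l : Fin n) (hi : o < i) (hij : i < j) (hjl : j < l) :
    minTwice (tgU w o i j) (tgU w o i l) (tgU w o j l) := by
  have := hw o i j l hi hij hjl
  rw [← tgW_lt w hi, ← tgW_lt w hjl, ← tgW_lt w (hi.trans hij), ← tgW_lt w (hij.trans hjl),
    ← tgW_lt w (hi.trans (hij.trans hjl)), ← tgW_lt w hij] at this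
  unfold minTwice at *
  unfold tgU
  rcases this with ⟨h1, h2⟩ | ⟨h1, h2⟩ | ⟨h1, h2⟩
  · right; right; constructor <;> linarith
  · right; left; constructor <;> linarith
  · left; constructor <;> linarith

lemma tgU_ultra {n : ℕ} (w : {s : Finset (Fin n) // s.card = 2} → ℝ) (hw : FourPoint w)
    (o i j l : Fin n) (hi : o < i) (hj : o < j) (hl : o < l) (hij : i ≠ j) (hjl : j ≠ l)
    (hil : i ≠ l) (r : ℝ) (h1 : r < tgU w o i j) (h2 : r < tgU w o j l) : r < tgU w o i l := by
  have key := tgU_three w hw o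
  have s1 := tgU_symm w o i j
  have s2 := tgU_symm w o i l
  have s3 := tgU_symm w o j l
  unfold minTwice at key
  rcases lt_or_gt_of_ne hij with a | a <;> rcases lt_or_gt_of_ne hjl with b | b <;>
    rcases lt_or_gt_of_ne hil with c | c
  · have := key i j l hi a b; grind
  · exact absurd (a.trans b) (not_lt.2 c.le)
  · have := key i l j hi c b; grind
  · have := key l i j hl c a; grind
  · have := key j i l hj a c; grind
  · have := key j l i hj b c; grind
  · exact absurd (c.trans b) (not_lt.2 a.le)
  · have := key l j i hl b a; grind

/-- Classes of the ultrametric. -/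
noncomputable def tgCls {n : ℕ} (w : {s : Finset (Fin n) // s.card = 2} → ℝ) (o : Fin n) (r : ℝ)
    (i : Fin n) : Finset (Fin n) :=
  Finset.univ.filter fun j => o < j ∧ (i = j ∨ r < tgU w o i j)

lemma tgCls_eq {n : ℕ} (w : {s : Finset (Fin n) // s.card = 2} → ℝ) (hw : FourPoint w)
    (o : Fin n) (r : ℝ) (i j : Fin n) (hi : o < i) (hj : o < j) (hij : i ≠ j)
    (h : r < tgU w o i j) : tgCls w o r i = tgCls w o r j := by
  ext l
  simp only [tgCls, Finset.mem_filter, Finset.mem_univ, true_and]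
  have s1 := tgU_symm w o i j
  by_cases hl : o < l
  · have a := tgU_ultra w hw o i j l hi hj hl
    have b := tgU_ultra w hw o j i l hj hi hl
    by_cases e1 : i = l
    · subst e1; grind
    by_cases e2 : j = l
    · subst e2; grind
    have a' := a hij e2 e1 r h
    have b' := b hij.symm e1 e2 r (s1 ▸ h)
    grind
  · simp [hl]

lemma tgCls_ne {n : ℕ} (w : {s : Finset (Fin n) // s.card = 2} → ℝ)
    (o i j : Fin n) (hj : o < j) (hij : i ≠ j) :
    tgCls w o (tgU w o i j) j ≠ tgCls w o (tgU w o i j) i := by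
  intro h
  have : j ∈ tgCls w o (tgU w o i j) j := by simp [tgCls, hj]
  rw [h] at this
  simp [tgCls, hij] at this

/-- Points realising the ultrametric. -/
noncomputable def tgA (k : Type*) [Field k] {n : ℕ} (w : {s : Finset (Fin n) // s.card = 2} → ℝ)
    (o i : Fin n) : HahnSeries ℝ (MvPolynomial (Finset (Fin n)) k) :=
  ∑ r ∈ Finset.univ.image (fun p : Fin n × Fin n => tgU w o p.1 p.2),
    HahnSeries.single r (X (tgCls w o r i))

lemma tgA_coeff (k : Type*) [Field k] {n : ℕ} (w : {s : Finset (Fin n) // s.card = 2} → ℝ)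
    (o i : Fin n) (s : ℝ) : (tgA k w o i).coeff s =
      if s ∈ Finset.univ.image (fun p : Fin n × Fin n => tgU w o p.1 p.2)
        then X (tgCls w o s i) else 0 := by
  unfold tgA
  rw [HahnSeries.coeff_sum]
  simp only [HahnSeries.coeff_single]
  rw [Finset.sum_ite_eq]

lemma tgA_lead (k : Type*) [Field k] {n : ℕ} (w : {s : Finset (Fin n) // s.card = 2} → ℝ)
    (hw : FourPoint w) (o i j : Fin n) (hi : o < i) (hj : o < j) (hij : i ≠ j) :
    TgLead (tgA k w o j - tgA k w o i) (tgU w o i j)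
      (X (tgCls w o (tgU w o i j) j) - X (tgCls w o (tgU w o i j) i)) := by
  refine ⟨?_, ?_, ?_⟩
  · intro h
    exact tgCls_ne w o i j hj hij (X_injective (sub_eq_zero.1 h))
  · have : tgU w o i j ∈ Finset.univ.image (fun p : Fin n × Fin n => tgU w o p.1 p.2) :=
      Finset.mem_image.2 ⟨(i, j), Finset.mem_univ _, rfl⟩
    rw [HahnSeries.coeff_sub, tgA_coeff, tgA_coeff, if_pos this, if_pos this]
  · intro s hs
    rw [HahnSeries.coeff_sub, tgA_coeff, tgA_coeff, tgCls_eq w hw o s i j hi hj hij hs, sub_self]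

/-- The matrix realising `w`. -/
noncomputable def tgMat (k : Type*) [Field k] {n : ℕ} (w : {s : Finset (Fin n) // s.card = 2} → ℝ)
    (o : Fin n) (p : Fin 2 × Fin n) : HahnSeries ℝ (MvPolynomial (Finset (Fin n)) k) :=
  if p.2 = o then (if p.1 = 0 then 0 else 1)
  else HahnSeries.single (tgW w o p.2) 1 * (if p.1 = 0 then 1 else tgA k w o p.2)

lemma tg_minor_lead (k : Type*) [Field k] {n : ℕ} (w : {s : Finset (Fin n) // s.card = 2} → ℝ)
    (hw : FourPoint w) (o : Fin n) (ho : ∀ i, o ≤ i) (S : {s : Finset (Fin n) // s.card = 2}) :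
    ∃ c, TgLead (aeval (tgMat k w o) (pluckerMap k 2 n (X S))) (w S) c := by
  obtain ⟨i, j, hij, rfl⟩ := tg_exists_pr S
  rw [tg_pluckerMap_X k i j hij]
  simp only [map_sub, map_mul, aeval_X]
  have hj : o < j := lt_of_le_of_lt (ho i) hij
  rcases eq_or_lt_of_le (ho i) with hi | hi
  · subst hi
    refine ⟨-1, ?_⟩
    have := tg_lead_single (K := MvPolynomial (Finset (Fin n)) k) (w (pr o j hij.ne)) (-1) (by simp)
    convert this using 1
    simp [tgMat, hij.ne', tgW_lt w hij]
  · have h1 := tg_lead_single (K := MvPolynomial (Finset (Fin n)) k) (tgW w o i) 1 one_ne_zero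
    have h2 := tg_lead_single (K := MvPolynomial (Finset (Fin n)) k) (tgW w o j) 1 one_ne_zero
    have h3 := (h1.mul h2).mul (tgA_lead k w hw o i j hi hj hij.ne)
    refine ⟨1 * 1 * (X (tgCls w o (tgU w o i j) j) - X (tgCls w o (tgU w o i j) i)), ?_⟩
    convert h3 using 1
    · simp only [tgMat, hi.ne', hj.ne', if_false, if_true, one_ne_zero]
      ring
    · rw [← tgW_lt w hij, tgU]; ring

/-- over any field `k` and for `n ≥ 4`, the initial ideal `in_w(I_{2,n})` of the
Plücker ideal contains no monomial if and only if `w` satisfies the four-point condition.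
In particular the tropical Grassmannian `G_{2,n}` is independent of the characteristic. -/
theorem tropical_grassmannian_two_fourPoint (k : Type) [Field k] (n : ℕ) (hn : 4 ≤ n)
    (w : {s : Finset (Fin n) // s.card = 2} → ℝ) :
    MonomialFree (initIdeal w (pluckerIdeal k 2 n)) ↔ FourPoint w := by
  constructor
  · exact tg_not_monomialFree k n w
  · intro hw
    have ho : ∀ i : Fin n, (⟨0, by omega⟩ : Fin n) ≤ i := fun i => Fin.mk_le_of_le_val (Nat.zero_le _)
    choose c hc using tg_minor_lead k w hw _ ho
    refine tg_monomialFree _ w c hc _ ?_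
    intro f hf
    have h1 : pluckerMap k 2 n f = 0 := hf
    have h2 : (aeval (fun S => aeval (tgMat k w ⟨0, by omega⟩) (pluckerMap k 2 n (X S))) :
        MvPolynomial {s : Finset (Fin n) // s.card = 2} k →ₐ[k] _) =
        (aeval (tgMat k w ⟨0, by omega⟩)).comp (pluckerMap k 2 n) := by
      ext S : 1
      simp
    rw [h2, AlgHom.comp_apply, h1, map_zero]
end

section
/- Let k be any field, let n ≥ 4, and let w ∈ ℝ^{C(n,2)} be such that for every 1 ≤ i < j < k < l ≤ n the minimum of the three numbers w_{ij} + w_{kl}, w_{ik} + w_{jl}, w_{il} + w_{jk} is attained exactly twice. Then for each quadruple i < j < k < l the initial form in_w(p_{ij}p_{kl} − p_{ik}p_{jl} + p_{il}p_{jk}) is a binomial, and the initial ideal in_w(I_{2,n}) is generated by these C(n,4) binomials: in_w(I_{2,n}) = ⟨ in_w(p_{ij}p_{kl} − p_{ik}p_{jl} + p_{il}p_{jk}) : 1 ≤ i < j < k < l ≤ n ⟩. -/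
open scoped Classical

open MvPolynomial

/-- The minimum of three reals is attained exactly twice. -/
def minExactlyTwice (a b c : ℝ) : Prop :=
  (a = b ∧ a < c) ∨ (a = c ∧ a < b) ∨ (b = c ∧ b < a)

/-- The strict four-point condition: for all `i < j < k < l`, the minimum of
`w_{ij}+w_{kl}`, `w_{ik}+w_{jl}`, `w_{il}+w_{jk}` is attained exactly twice. -/
def StrictFourPoint {n : ℕ} (w : {s : Finset (Fin n) // s.card = 2} → ℝ) : Prop :=
  ∀ i j k l : Fin n, ∀ hij : i < j, ∀ hjk : j < k, ∀ hkl : k < l,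
    minExactlyTwice (w (pr i j hij.ne) + w (pr k l hkl.ne))
      (w (pr i k (hij.trans hjk).ne) + w (pr j l (hjk.trans hkl).ne))
      (w (pr i l (hij.trans (hjk.trans hkl)).ne) + w (pr j k hjk.ne))

/-- The quadratic Plücker relation `p_{ij}p_{kl} − p_{ik}p_{jl} + p_{il}p_{jk}`
for `i < j < k < l`. -/
noncomputable def pluckerQuadric (k : Type*) [CommRing k] {n : ℕ} (i j l m : Fin n)
    (hij : i < j) (hjl : j < l) (hlm : l < m) :
    MvPolynomial {s : Finset (Fin n) // s.card = 2} k :=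
  X (pr i j hij.ne) * X (pr l m hlm.ne)
    - X (pr i l (hij.trans hjl).ne) * X (pr j m (hjl.trans hlm).ne)
    + X (pr i m (hij.trans (hjl.trans hlm)).ne) * X (pr j l hjl.ne)

/-- A binomial: the sum of two monomials with distinct exponents and nonzero coefficients. -/
def IsBinomial {σ : Type*} {k : Type*} [CommRing k] (g : MvPolynomial σ k) : Prop :=
  ∃ (a b : σ →₀ ℕ) (c d : k), a ≠ b ∧ c ≠ 0 ∧ d ≠ 0 ∧ g = monomial a c + monomial b d


lemma exists_rank {V : Type} [Fintype V] [LinearOrder V] (U : V → V → ℝ)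
    (hs : ∀ i j, U i j = U j i)
    (hU : ∀ i j k, i ≠ j → i ≠ k → j ≠ k → minExactlyTwice (U i j) (U i k) (U j k)) :
    ∃ ρ : V → ℕ, Function.Injective ρ ∧ (∀ i, ρ i ≤ Fintype.card V) ∧
      ∀ a b c, ρ a < ρ b → ρ b < ρ c →
        (U a c = U a b ∧ U a b < U b c) ∨ (U a c = U b c ∧ U b c < U a b) := by
  let A : V → V → Finset V := fun i j => Finset.univ.filter (fun z => z = i ∨ U i j < U i z)
  have hA : ∀ i j, (A i j).Nonempty := fun i j => ⟨i, by simp [A]⟩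
  let mn : V → V → V := fun i j => (A i j).min' (hA i j)
  have hmem : ∀ i j z, z ∈ A i j ↔ z = i ∨ U i j < U i z := by intro i j z; simp [A]
  have hne : ∀ i j, i ≠ j → mn i j ≠ mn j i := by
    intro i j hij h
    have h1 : mn i j ∈ A i j := Finset.min'_mem _ _
    have h2 : mn i j ∈ A j i := by rw [h]; exact Finset.min'_mem _ _
    rw [hmem] at h1 h2
    generalize mn i j = z at h1 h2
    have := hs i j
    rcases h1 with rfl | h1
    · rcases h2 with h2 | h2
      · exact hij h2
      · linarith
    · rcases h2 with rfl | h2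
      · linarith
      · by_cases hzi : z = i
        · subst hzi; linarith
        by_cases hzj : z = j
        · subst hzj; linarith
        have := hU i j z hij (Ne.symm hzi) (Ne.symm hzj)
        unfold minExactlyTwice at this
        rcases this with h | h | h <;> linarith [h.1, h.2]
  have hcl0 : ∀ i j k, i ≠ j → i ≠ k → j ≠ k → U i k < U i j → U i k = U j k →
      A i k ⊆ A j k := by
    intro i j k hij hik hjk h1 h2 z hz
    rw [hmem] at hz ⊢
    have := hs i j
    rcases hz with rfl | hz
    · right; linarith
    · by_cases hzj : z = j
      · left; exact hzj
      right
      by_cases hzi : z = i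
      · subst hzi; linarith
      have := hU i j z hij (Ne.symm hzi) (Ne.symm hzj)
      unfold minExactlyTwice at this
      rcases this with h | h | h <;> linarith [h.1, h.2]
  have hcl : ∀ i j k, i ≠ j → i ≠ k → j ≠ k → U i k < U i j → U i k = U j k →
      mn i k = mn j k ∧ mn k i = mn k j := by
    intro i j k hij hik hjk h1 h2
    have e1 : A i k = A j k := Finset.Subset.antisymm (hcl0 i j k hij hik hjk h1 h2)
      (hcl0 j i k hij.symm hjk hik (by rw [hs j i]; linarith) h2.symm)
    have e2 : A k i = A k j := by
      ext z; rw [hmem, hmem, hs k i, hs k j, h2]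
    constructor
    · simp only [mn, e1]
    · simp only [mn, e2]
  let lt : V → V → Prop := fun i j => i ≠ j ∧ mn i j < mn j i
  have hirr : ∀ i, ¬ lt i i := fun i h => h.1 rfl
  have htot : ∀ i j, i ≠ j → lt i j ∨ lt j i := by
    intro i j hij
    rcases lt_or_gt_of_ne (hne i j hij) with h | h
    · exact Or.inl ⟨hij, h⟩
    · exact Or.inr ⟨hij.symm, h⟩
  have hasym : ∀ i j, lt i j → ¬ lt j i := fun i j h h' => lt_asymm h.2 h'.2
  have hmain : ∀ a b c, lt a b → lt b c → lt a c ∧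
      ((U a c = U a b ∧ U a b < U b c) ∨ (U a c = U b c ∧ U b c < U a b)) := by
    intro a b c hab hbc
    have hac : a ≠ c := by rintro rfl; exact hasym _ _ hab hbc
    have := hU a b c hab.1 hac hbc.1
    unfold minExactlyTwice at this
    rcases this with h | h | h
    · obtain ⟨e1, e2⟩ := hcl b c a hbc.1 hab.1.symm hac.symm (by rw [hs b a]; linarith)
        (by rw [hs b a, hs c a]; linarith [h.1])
      refine ⟨⟨hac, ?_⟩, Or.inl ⟨h.1.symm, by linarith⟩⟩
      rw [← e1, ← e2]; exact hab.2
    · exfalso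
      obtain ⟨e1, e2⟩ := hcl a c b hac hab.1 hbc.1.symm (by linarith)
        (by rw [hs c b]; linarith [h.1])
      have h1 := hab.2
      have h2 := hbc.2
      rw [e1, e2] at h1
      exact lt_asymm h1 h2
    · obtain ⟨e1, e2⟩ := hcl a b c hab.1 hac hbc.1 (by linarith) (by linarith [h.1])
      refine ⟨⟨hac, ?_⟩, Or.inr ⟨h.1, by linarith⟩⟩
      rw [e1, e2]; exact hbc.2
  let ρ : V → ℕ := fun i => (Finset.univ.filter (fun j => lt j i)).card
  have hmono : ∀ i j, lt i j → ρ i < ρ j := by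
    intro i j h
    apply Finset.card_lt_card
    rw [Finset.ssubset_iff_of_subset]
    · exact ⟨i, by simpa using h, by simpa using hirr i⟩
    · intro z hz
      simp only [Finset.mem_filter, Finset.mem_univ, true_and] at hz ⊢
      exact (hmain z i j hz h).1
  have hconv : ∀ i j, ρ i < ρ j → lt i j := by
    intro i j h
    have hij : i ≠ j := by rintro rfl; exact lt_irrefl _ h
    rcases htot i j hij with h' | h'
    · exact h'
    · have := hmono _ _ h'; omega
  refine ⟨ρ, ?_, ?_, ?_⟩
  · intro i j h
    by_contra hij
    rcases htot i j hij with h' | h' <;> have := hmono _ _ h' <;> omega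
  · intro i; exact Finset.card_le_univ _
  · intro a b c h1 h2
    exact (hmain a b c (hconv _ _ h1) (hconv _ _ h2)).2

lemma exists_rank4 {V : Type} [Fintype V] [LinearOrder V] (r : V) (W : V → V → ℝ)
    (hs : ∀ i j, W i j = W j i)
    (hW : ∀ i j k l, i ≠ j → i ≠ k → i ≠ l → j ≠ k → j ≠ l → k ≠ l →
      minExactlyTwice (W i j + W k l) (W i k + W j l) (W i l + W j k)) :
    ∃ ρ : V → ℕ, Function.Injective ρ ∧
      ∀ a b c d, ρ a < ρ b → ρ b < ρ c → ρ c < ρ d →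
        W a c + W b d ≤ W a b + W c d ∧ W a c + W b d ≤ W a d + W b c := by
  let U : {i : V // i ≠ r} → {i : V // i ≠ r} → ℝ := fun i j => W i j - W i r - W j r
  obtain ⟨ρ, hinj, hle, hρ⟩ := exists_rank U (fun i j => by simp only [U]; rw [hs i j]; ring)
    (by
      intro i j k hij hik hjk
      have := hW i j k r (fun h => hij (Subtype.ext h)) (fun h => hik (Subtype.ext h)) i.2
        (fun h => hjk (Subtype.ext h)) j.2 k.2
      unfold minExactlyTwice at this ⊢
      simp only [U]
      rcases this with h | h | h
      · left; constructor <;> linarith [h.1, h.2]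
      · right; left; constructor <;> linarith [h.1, h.2]
      · right; right; constructor <;> linarith [h.1, h.2])
  refine ⟨fun i => if h : i ≠ r then ρ ⟨i, h⟩ else Fintype.card {i : V // i ≠ r} + 1, ?_, ?_⟩
  · intro i j h
    by_cases hi : i = r <;> by_cases hj : j = r
    · rw [hi, hj]
    · have := hle ⟨j, hj⟩
      simp [hi, hj] at h this; omega
    · have := hle ⟨i, hi⟩
      simp [hi, hj] at h this; omega
    · simp [hi, hj] at h
      simpa using hinj h
  · intro a b c d hab hbc hcd
    have key : ∀ x y, (if h : x ≠ r then ρ ⟨x, h⟩ else Fintype.card {i : V // i ≠ r} + 1) <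
      (if h : y ≠ r then ρ ⟨y, h⟩ else Fintype.card {i : V // i ≠ r} + 1) → x ≠ r := by
      intro x y h hx
      rw [dif_neg (by simpa using hx)] at h
      by_cases hy : y = r
      · rw [dif_neg (by simpa using hy)] at h; omega
      · rw [dif_pos hy] at h
        have := hle ⟨y, hy⟩
        omega
    have ha := key _ _ hab
    have hb := key _ _ hbc
    have hc := key _ _ hcd
    simp only [dif_pos ha, dif_pos hb, dif_pos hc] at hab hbc hcd
    have h1 := hρ _ _ _ hab hbc
    simp only [U] at h1
    by_cases hd : d = r
    · subst hd
      rcases h1 with h1 | h1 <;> constructor <;> linarith [h1.1, h1.2]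
    · rw [dif_pos hd] at hcd
      have h2 := hρ _ _ _ hbc hcd
      have h3 := hρ _ _ _ hab (hbc.trans hcd)
      have h4 := hρ _ _ _ (hab.trans hbc) hcd
      simp only [U] at h2 h3 h4
      rcases h1 with ⟨h1, h1'⟩ | ⟨h1, h1'⟩ <;> rcases h2 with ⟨h2, h2'⟩ | ⟨h2, h2'⟩ <;>
      rcases h3 with ⟨h3, h3'⟩ | ⟨h3, h3'⟩ <;> rcases h4 with ⟨h4, h4'⟩ | ⟨h4, h4'⟩ <;>
      constructor <;> linarith

lemma sym4 {V : Type} [LinearOrder V] (Q : V → V → V → V → Prop)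
    (h12 : ∀ a b c d, Q a b c d → Q b a c d)
    (h23 : ∀ a b c d, Q a b c d → Q a c b d)
    (h34 : ∀ a b c d, Q a b c d → Q a b d c)
    (hs : ∀ a b c d, a < b → b < c → c < d → Q a b c d) :
    ∀ a b c d, a ≠ b → a ≠ c → a ≠ d → b ≠ c → b ≠ d → c ≠ d → Q a b c d := by
  have s1 : ∀ a b c d, a < b → b < c → a ≠ d → b ≠ d → c ≠ d → Q a b c d := by
    intro a b c d hab hbc had hbd hcd
    rcases lt_or_gt_of_ne hcd with h | h
    · exact hs _ _ _ _ hab hbc h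
    apply h34
    rcases lt_or_gt_of_ne hbd with h' | h'
    · exact hs _ _ _ _ hab h' h
    apply h23
    rcases lt_or_gt_of_ne had with h'' | h''
    · exact hs _ _ _ _ h'' h' hbc
    apply h12
    exact hs _ _ _ _ h'' hab hbc
  have s2 : ∀ a b c d, a < b → a ≠ c → a ≠ d → b ≠ c → b ≠ d → c ≠ d → Q a b c d := by
    intro a b c d hab hac had hbc hbd hcd
    rcases lt_or_gt_of_ne hbc with h | h
    · exact s1 _ _ _ _ hab h had hbd hcd
    apply h23
    rcases lt_or_gt_of_ne hac with h' | h'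
    · exact s1 _ _ _ _ h' h had hcd hbd
    apply h12
    exact s1 _ _ _ _ h' hab hcd had hbd
  intro a b c d hab hac had hbc hbd hcd
  rcases lt_or_gt_of_ne hab with h | h
  · exact s2 _ _ _ _ h hac had hbc hbd hcd
  · exact h12 _ _ _ _ (s2 _ _ _ _ h hbc hbd hac had hcd)

/-- Leading exponent of a product of minors. -/
noncomputable def leadExp {σ : Type} {n : ℕ} (lo hi : σ → Fin n) :
    (σ →₀ ℕ) →+ (Fin 2 × Fin n →₀ ℕ) :=
  Finsupp.weight (fun S => Finsupp.single ((0 : Fin 2), lo S) 1 + Finsupp.single ((1 : Fin 2), hi S) 1)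

/-- Noncrossing exponents. -/
def NonCross {σ : Type} {n : ℕ} (lo hi : σ → Fin n) (ρ : Fin n → ℕ) (b : σ →₀ ℕ) : Prop :=
  ∀ S ∈ b.support, ∀ T ∈ b.support,
    ¬ (ρ (lo S) < ρ (lo T) ∧ ρ (lo T) < ρ (hi S) ∧ ρ (hi S) < ρ (hi T))

lemma split_single {σ : Type} (b : σ →₀ ℕ) (S : σ) (h : S ∈ b.support) :
    ∃ b', b = b' + Finsupp.single S 1 := by
  refine ⟨b - Finsupp.single S 1, ?_⟩
  rw [tsub_add_cancel_of_le]
  rw [Finsupp.single_le_iff]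
  exact Nat.one_le_iff_ne_zero.2 (Finsupp.mem_support_iff.1 h)

lemma leadExp_single {σ : Type} {n : ℕ} (lo hi : σ → Fin n) (S : σ) :
    leadExp lo hi (Finsupp.single S 1) =
      Finsupp.single ((0 : Fin 2), lo S) 1 + Finsupp.single ((1 : Fin 2), hi S) 1 := by
  simp [leadExp, Finsupp.weight_single]

lemma leadExp_pos0 {σ : Type} {n : ℕ} (lo hi : σ → Fin n) (b : σ →₀ ℕ) (u : Fin n) :
    leadExp lo hi b (0, u) ≠ 0 ↔ ∃ S ∈ b.support, lo S = u := by
  constructor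
  · intro h
    by_contra hc
    push Not at hc
    apply h
    rw [leadExp, Finsupp.weight_apply, Finsupp.sum, Finsupp.finsetSum_apply]
    apply Finset.sum_eq_zero
    intro S hS
    have := hc S hS
    simp [this]
  · rintro ⟨S, hS, rfl⟩
    obtain ⟨b', rfl⟩ := split_single b S hS
    rw [map_add, leadExp_single]
    simp

lemma leadExp_pos1 {σ : Type} {n : ℕ} (lo hi : σ → Fin n) (b : σ →₀ ℕ) (u : Fin n) :
    leadExp lo hi b (1, u) ≠ 0 ↔ ∃ S ∈ b.support, hi S = u := by
  constructor
  · intro h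
    by_contra hc
    push Not at hc
    apply h
    rw [leadExp, Finsupp.weight_apply, Finsupp.sum, Finsupp.finsetSum_apply]
    apply Finset.sum_eq_zero
    intro S hS
    have := hc S hS
    simp [this]
  · rintro ⟨S, hS, rfl⟩
    obtain ⟨b', rfl⟩ := split_single b S hS
    rw [map_add, leadExp_single]
    simp

lemma leadExp_inj {σ : Type} {n : ℕ} (lo hi : σ → Fin n) (ρ : Fin n → ℕ)
    (hρ : Function.Injective ρ) (hlt : ∀ S, ρ (lo S) < ρ (hi S))
    (hinj : ∀ S T, lo S = lo T → hi S = hi T → S = T) :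
    ∀ (d : ℕ) (b b' : σ →₀ ℕ), b.degree = d → NonCross lo hi ρ b → NonCross lo hi ρ b' →
      leadExp lo hi b = leadExp lo hi b' → b = b' := by
  intro d
  induction d with
  | zero =>
    intro b b' hd _ _ h
    rw [Finsupp.degree_eq_zero_iff] at hd
    subst hd
    by_contra hne
    obtain ⟨S, hS⟩ := Finsupp.support_nonempty_iff.2 (Ne.symm hne)
    have := (leadExp_pos0 lo hi b' (lo S)).2 ⟨S, hS, rfl⟩
    rw [← h] at this
    simp at this
  | succ d ih =>
    intro b b' hd hb hb' h
    have hb0 : b ≠ 0 := by rintro rfl; simp at hd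
    obtain ⟨S0, hS0⟩ := Finsupp.support_nonempty_iff.2 hb0
    -- minimal closing
    obtain ⟨v, hv, hvmin⟩ := Finset.exists_min_image
      (Finset.univ.filter (fun v => leadExp lo hi b (1, v) ≠ 0)) ρ
      ⟨hi S0, by simpa using (leadExp_pos1 lo hi b (hi S0)).2 ⟨S0, hS0, rfl⟩⟩
    simp only [Finset.mem_filter, Finset.mem_univ, true_and] at hv hvmin
    obtain ⟨S1, hS1, hS1v⟩ := (leadExp_pos1 lo hi b v).1 hv
    obtain ⟨u, hu, humax⟩ := Finset.exists_max_image
      (Finset.univ.filter (fun u => leadExp lo hi b (0, u) ≠ 0 ∧ ρ u < ρ v)) ρ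
      ⟨lo S1, by
        simp only [Finset.mem_filter, Finset.mem_univ, true_and]
        exact ⟨(leadExp_pos0 lo hi b (lo S1)).2 ⟨S1, hS1, rfl⟩, hS1v ▸ hlt S1⟩⟩
    simp only [Finset.mem_filter, Finset.mem_univ, true_and] at hu humax
    have key : ∀ c : σ →₀ ℕ, NonCross lo hi ρ c → leadExp lo hi c = leadExp lo hi b →
        ∃ S ∈ c.support, lo S = u ∧ hi S = v := by
      intro c hc hcb
      obtain ⟨A, hA, hAv⟩ := (leadExp_pos1 lo hi c v).1 (hcb ▸ hv)
      obtain ⟨B, hB, hBu⟩ := (leadExp_pos0 lo hi c u).1 (hcb ▸ hu.1)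
      have h1 := humax (lo A) ⟨hcb ▸ (leadExp_pos0 lo hi c (lo A)).2 ⟨A, hA, rfl⟩, hAv ▸ hlt A⟩
      have h2 := hvmin (hi B) (hcb ▸ (leadExp_pos1 lo hi c (hi B)).2 ⟨B, hB, rfl⟩)
      by_cases e1 : lo A = u
      · exact ⟨A, hA, e1, hAv⟩
      by_cases e2 : hi B = v
      · exact ⟨B, hB, hBu, e2⟩
      exfalso
      have e1' : ρ (lo A) ≠ ρ u := fun h => e1 (hρ h)
      have e2' : ρ (hi B) ≠ ρ v := fun h => e2 (hρ h)
      apply hc A hA B hB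
      rw [hBu, hAv]
      exact ⟨by omega, hu.2, by omega⟩
    obtain ⟨S, hS, hSu, hSv⟩ := key b hb rfl
    obtain ⟨S', hS', hSu', hSv'⟩ := key b' hb' h.symm
    have : S = S' := hinj _ _ (by rw [hSu, hSu']) (by rw [hSv, hSv'])
    subst this
    obtain ⟨c, rfl⟩ := split_single b S hS
    obtain ⟨c', rfl⟩ := split_single b' S hS'
    have hsub : ∀ c : σ →₀ ℕ, NonCross lo hi ρ (c + Finsupp.single S 1) → NonCross lo hi ρ c := by
      intro c hc A hA B hB
      refine hc A ?_ B ?_ <;> simp only [Finsupp.mem_support_iff, Finsupp.add_apply] at * <;> omega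
    rw [ih c c' (by simpa using hd) (hsub _ hb) (hsub _ hb') (by simpa using h)]

/-- weight on the target -/
noncomputable def tw {n : ℕ} (ρ : Fin n → ℕ) : (Fin 2 × Fin n →₀ ℕ) →+ ℕ :=
  Finsupp.weight (fun p => if p.1 = 0 then 0 else ρ p.2)

lemma mul_rs {k : Type} [Field k] {τ : Type} (t : (τ →₀ ℕ) →+ ℕ) (P Q : MvPolynomial τ k)
    (a b : τ →₀ ℕ) (c d : k)
    (hP : P - monomial a c ∈ restrictSupport k {x | t x < t a})
    (hQ : Q - monomial b d ∈ restrictSupport k {x | t x < t b}) :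
    P * Q - monomial (a + b) (c * d) ∈ restrictSupport k {x | t x < t (a + b)} := by
  have e : P * Q - monomial (a + b) (c * d) =
      (P - monomial a c) * (Q - monomial b d) + monomial a c * (Q - monomial b d)
        + (P - monomial a c) * monomial b d := by
    rw [← monomial_mul]; ring
  have ha : monomial a c ∈ restrictSupport k {x | t x = t a} := by
    rw [monomial_mem_restrictSupport]; left; rfl
  have hb : monomial b d ∈ restrictSupport k {x | t x = t b} := by
    rw [monomial_mem_restrictSupport]; left; rfl
  rw [e]
  refine add_mem (add_mem ?_ ?_) ?_
  · have := Submodule.mul_mem_mul hP hQ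
    rw [← restrictSupport_add] at this
    refine restrictSupport_mono k ?_ this
    rintro _ ⟨x, hx, y, hy, rfl⟩
    simp only [Set.mem_ofPred_eq, map_add] at *; omega
  · have := Submodule.mul_mem_mul ha hQ
    rw [← restrictSupport_add] at this
    refine restrictSupport_mono k ?_ this
    rintro _ ⟨x, hx, y, hy, rfl⟩
    simp only [Set.mem_ofPred_eq, map_add] at *; omega
  · have := Submodule.mul_mem_mul hP hb
    rw [← restrictSupport_add] at this
    refine restrictSupport_mono k ?_ this
    rintro _ ⟨x, hx, y, hy, rfl⟩
    simp only [Set.mem_ofPred_eq, map_add] at *; omega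

lemma lead_map {k : Type} [Field k] {σ : Type} {n : ℕ} (lo hi : σ → Fin n) (ρ : Fin n → ℕ)
    (hlt : ∀ S, ρ (lo S) < ρ (hi S))
    (φ : MvPolynomial σ k →ₐ[k] MvPolynomial (Fin 2 × Fin n) k)
    (hφ : ∀ S, ∃ c : k, c ≠ 0 ∧
      φ (X S) = C c * (X (0, lo S) * X (1, hi S) - X (0, hi S) * X (1, lo S))) :
    ∀ (d : ℕ) (b : σ →₀ ℕ), b.degree = d →
    ∃ c : k, c ≠ 0 ∧ φ (monomial b 1) - monomial (leadExp lo hi b) c ∈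
      restrictSupport k {a | tw ρ a < tw ρ (leadExp lo hi b)} := by
  intro d
  induction d with
  | zero =>
    intro b hb
    rw [Finsupp.degree_eq_zero_iff] at hb
    subst hb
    refine ⟨1, one_ne_zero, ?_⟩
    have : φ (monomial 0 1) - monomial (leadExp lo hi 0) 1 = 0 := by
      rw [map_zero, ← C_apply, C_1, map_one, ← C_apply, C_1, sub_self]
    rw [this]; exact zero_mem _
  | succ d ih =>
    intro b hb
    have hb0 : b ≠ 0 := by rintro rfl; simp at hb
    obtain ⟨S, hS⟩ := Finsupp.support_nonempty_iff.2 hb0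
    obtain ⟨c, rfl⟩ := split_single b S hS
    obtain ⟨e, he, hc⟩ := ih c (by simpa using hb)
    obtain ⟨e', he', hS'⟩ := hφ S
    refine ⟨e * e', mul_ne_zero he he', ?_⟩
    rw [monomial_add_single, pow_one, map_mul, map_add]
    apply mul_rs _ _ _ _ _ _ _ hc
    rw [hS', leadExp_single]
    have e2 : C e' * (X (0, lo S) * X (1, hi S) - X (0, hi S) * X (1, lo S)) -
      monomial (Finsupp.single ((0 : Fin 2), lo S) 1 + Finsupp.single ((1 : Fin 2), hi S) 1) e' =
      monomial (Finsupp.single ((0 : Fin 2), hi S) 1 + Finsupp.single ((1 : Fin 2), lo S) 1) (-e') := by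
      have h1 : ∀ (p q : Fin 2 × Fin n) (z : k), monomial (Finsupp.single p 1 + Finsupp.single q 1) z
        = C z * (X p * X q) := by
        intro p q z
        rw [X, X, monomial_mul, C_mul_monomial]; simp
      rw [h1, h1]; simp; ring
    rw [e2, monomial_mem_restrictSupport]
    left
    simpa [tw, Finsupp.weight_single] using hlt S

lemma indep {k : Type} [Field k] {σ : Type} {n : ℕ} (lo hi : σ → Fin n) (ρ : Fin n → ℕ)
    (hρ : Function.Injective ρ) (hlt : ∀ S, ρ (lo S) < ρ (hi S))
    (hinj : ∀ S T, lo S = lo T → hi S = hi T → S = T)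
    (φ : MvPolynomial σ k →ₐ[k] MvPolynomial (Fin 2 × Fin n) k)
    (hφ : ∀ S, ∃ c : k, c ≠ 0 ∧
      φ (X S) = C c * (X (0, lo S) * X (1, hi S) - X (0, hi S) * X (1, lo S)))
    (g : MvPolynomial σ k) (hg : g ∈ restrictSupport k {b | NonCross lo hi ρ b})
    (h0 : φ g = 0) : g = 0 := by
  rw [mem_restrictSupport_iff] at hg
  by_contra hne
  obtain ⟨b0, hb0, hmax⟩ := Finset.exists_max_image g.support
    (fun b => tw ρ (leadExp lo hi b)) (by simpa using hne)
  have hsum : φ g = ∑ b ∈ g.support, C (g.coeff b) * φ (monomial b 1) := by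
    conv_lhs => rw [g.as_sum, map_sum]
    apply Finset.sum_congr rfl
    intro b _
    rw [← mul_one (g.coeff b), ← C_mul_monomial, map_mul, mul_one]
    congr 1
    exact φ.commutes _
  have hc := congrArg (coeff (leadExp lo hi b0)) hsum
  rw [h0, coeff_zero, coeff_sum, Finset.sum_eq_single b0] at hc
  · obtain ⟨c, hc0, hc1⟩ := lead_map lo hi ρ hlt φ hφ _ b0 rfl
    rw [mem_restrictSupport_iff] at hc1
    have : coeff (leadExp lo hi b0) (φ (monomial b0 1) - monomial (leadExp lo hi b0) c) = 0 := by
      by_contra h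
      have := hc1 (Finset.mem_coe.2 (mem_support_iff.2 h))
      simp at this
    rw [coeff_sub, coeff_monomial, if_pos rfl, sub_eq_zero] at this
    rw [coeff_C_mul, this] at hc
    exact mul_ne_zero (mem_support_iff.1 hb0) hc0 hc.symm
  · intro b hb hbne
    obtain ⟨c, hc0, hc1⟩ := lead_map lo hi ρ hlt φ hφ _ b rfl
    rw [mem_restrictSupport_iff] at hc1
    have hle := hmax b hb
    have : coeff (leadExp lo hi b0) (φ (monomial b 1) - monomial (leadExp lo hi b) c) = 0 := by
      by_contra h
      have := hc1 (Finset.mem_coe.2 (mem_support_iff.2 h))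
      simp only [Set.mem_ofPred_eq] at this
      omega
    rw [coeff_sub, coeff_monomial, if_neg, sub_zero] at this
    · rw [coeff_C_mul, this, mul_zero]
    · intro h
      exact hbne (leadExp_inj lo hi ρ hρ hlt hinj _ _ _ rfl (hg hb) (hg hb0) h)
  · intro h; exact absurd hb0 h

lemma expWeight_add {σ : Type} (w : σ → ℝ) (a b : σ →₀ ℕ) :
    expWeight w (a + b) = expWeight w a + expWeight w b := by
  unfold expWeight
  rw [Finsupp.sum_add_index'] <;> intros <;> push_cast <;> ring

lemma expWeight_single {σ : Type} (w : σ → ℝ) (S : σ) :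
    expWeight w (Finsupp.single S 1) = w S := by
  unfold expWeight
  rw [Finsupp.sum_single_index] <;> simp

lemma coeff_initForm {σ k : Type} [Field k] (w : σ → ℝ) (f : MvPolynomial σ k) (a : σ →₀ ℕ) :
    coeff a (initForm w f) =
      if (∀ b ∈ f.support, expWeight w a ≤ expWeight w b) then coeff a f else 0 := by
  unfold initForm
  rw [coeff_sum]
  simp only [coeff_monomial, Finset.sum_ite_eq', Finset.mem_filter]
  by_cases h : a ∈ f.support
  · simp only [h, true_and]
  · rw [notMem_support_iff] at h
    simp [h]

lemma initForm_eq {σ k : Type} [Field k] (w : σ → ℝ) (f g h : MvPolynomial σ k) (ω : ℝ)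
    (hf : f = g + h) (hg0 : g ≠ 0) (hg : g ∈ restrictSupport k {a | expWeight w a = ω})
    (hh : h ∈ restrictSupport k {a | ω < expWeight w a}) : initForm w f = g := by
  rw [mem_restrictSupport_iff] at hg hh
  have hg' : ∀ a, expWeight w a ≠ ω → coeff a g = 0 := by
    intro a ha; by_contra hc
    exact ha (hg (Finset.mem_coe.2 (mem_support_iff.2 hc)))
  have hh' : ∀ a, expWeight w a ≤ ω → coeff a h = 0 := by
    intro a ha; by_contra hc
    exact absurd (hh (Finset.mem_coe.2 (mem_support_iff.2 hc))) (not_lt.2 ha)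
  obtain ⟨b0, hb0⟩ := support_nonempty.2 hg0
  have hb0w : expWeight w b0 = ω := hg (Finset.mem_coe.2 hb0)
  ext a
  rw [coeff_initForm]
  split_ifs with hc
  · have h1 : expWeight w a ≤ ω := by
      rw [← hb0w]
      apply hc
      rw [mem_support_iff, hf, coeff_add, hh' _ hb0w.le, add_zero]
      exact mem_support_iff.1 hb0
    rw [hf, coeff_add, hh' a h1, add_zero]
  · symm
    apply hg'
    intro ha
    apply hc
    intro b hb
    rw [ha]
    by_contra hlt
    push Not at hlt
    rw [mem_support_iff, hf, coeff_add, hg' b hlt.ne, hh' b hlt.le] at hb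
    simp at hb

lemma initForm_split {σ k : Type} [Field k] (w : σ → ℝ) (f : MvPolynomial σ k) (hf : f ≠ 0) :
    ∃ ω, initForm w f ∈ restrictSupport k {a | expWeight w a = ω} ∧
      f - initForm w f ∈ restrictSupport k {a | ω < expWeight w a} := by
  obtain ⟨b0, hb0, hmin⟩ := Finset.exists_min_image f.support (expWeight w) (support_nonempty.2 hf)
  refine ⟨expWeight w b0, ?_, ?_⟩
  · rw [mem_restrictSupport_iff]
    intro a ha
    have ha := mem_support_iff.1 (Finset.mem_coe.1 ha)
    rw [coeff_initForm] at ha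
    split_ifs at ha with hc
    · exact le_antisymm (hc _ hb0) (hmin a (mem_support_iff.2 ha))
    · exact absurd rfl ha
  · rw [mem_restrictSupport_iff]
    intro a ha
    have ha := mem_support_iff.1 (Finset.mem_coe.1 ha)
    rw [coeff_sub, coeff_initForm] at ha
    split_ifs at ha with hc
    · simp at ha
    · rw [sub_zero] at ha
      show expWeight w b0 < expWeight w a
      apply lt_of_le_of_ne (hmin a (mem_support_iff.2 ha))
      intro h
      exact hc (fun b hb => h ▸ hmin b hb)

lemma initForm_three {σ k : Type} [Field k] (w : σ → ℝ) (a b c : σ →₀ ℕ) (x y z : k)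
    (hab : a ≠ b) (hx : x ≠ 0) (h1 : expWeight w a = expWeight w b)
    (h2 : expWeight w a < expWeight w c) (f : MvPolynomial σ k)
    (hf : f = monomial a x + monomial b y + monomial c z) :
    initForm w f = monomial a x + monomial b y := by
  apply initForm_eq w f _ (monomial c z) (expWeight w a) hf
  · intro h
    have := congrArg (coeff a) h
    rw [coeff_add, coeff_monomial, coeff_monomial, if_pos rfl, if_neg hab.symm] at this
    simp at this
    exact hx this
  · apply add_mem <;> rw [monomial_mem_restrictSupport] <;> left
    · rfl
    · exact h1.symm
  · rw [monomial_mem_restrictSupport]; left; exact h2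

/-- Reduction to noncrossing exponents. -/
lemma reduction {σ k : Type} [Field k] {n : ℕ} (lo hi : σ → Fin n) (ρ : Fin n → ℕ) (w : σ → ℝ)
    (M : (σ →₀ ℕ) →+ ℕ) (I J : Ideal (MvPolynomial σ k))
    (hred : ∀ S T, ρ (lo S) < ρ (lo T) → ρ (lo T) < ρ (hi S) → ρ (hi S) < ρ (hi T) →
      ∃ (β γ : σ →₀ ℕ) (x y : k),
        M β < M (Finsupp.single S 1 + Finsupp.single T 1) ∧
        M γ < M (Finsupp.single S 1 + Finsupp.single T 1) ∧
        expWeight w β = expWeight w (Finsupp.single S 1 + Finsupp.single T 1) ∧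
        expWeight w (Finsupp.single S 1 + Finsupp.single T 1) < expWeight w γ ∧
        monomial (Finsupp.single S 1 + Finsupp.single T 1) 1 - monomial β x ∈ J ∧
        monomial (Finsupp.single S 1 + Finsupp.single T 1) 1 - monomial β x - monomial γ y ∈ I) :
    ∀ (m : ℕ) (a : σ →₀ ℕ), M a = m →
      ∃ s₀ ∈ restrictSupport k {b | NonCross lo hi ρ b ∧ expWeight w b = expWeight w a},
      ∃ s₁ ∈ restrictSupport k {b | NonCross lo hi ρ b ∧ expWeight w a < expWeight w b},
        monomial a 1 - s₀ ∈ J ∧ monomial a 1 - s₀ - s₁ ∈ I := by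
  intro m
  induction m using Nat.strong_induction_on with
  | _ m ih =>
  intro a ha
  by_cases hnc : NonCross lo hi ρ a
  · refine ⟨monomial a 1, ?_, 0, zero_mem _, by simp, by simp⟩
    rw [monomial_mem_restrictSupport]; left; exact ⟨hnc, rfl⟩
  unfold NonCross at hnc
  push Not at hnc
  obtain ⟨S, hS, T, hT, h1, h2, h3⟩ := hnc
  have hST : S ≠ T := by rintro rfl; exact lt_irrefl _ h1
  obtain ⟨a', rfl⟩ := split_single a S hS
  have hT' : T ∈ a'.support := by
    rw [Finsupp.mem_support_iff] at hT ⊢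
    rwa [Finsupp.add_apply, Finsupp.single_apply, if_neg hST, add_zero] at hT
  obtain ⟨c, rfl⟩ := split_single a' T hT'
  obtain ⟨β, γ, x, y, hβ, hγ, hwβ, hwγ, hJ, hI⟩ := hred S T h1 h2 h3
  have hrw : c + Finsupp.single T 1 + Finsupp.single S 1 =
      c + (Finsupp.single S 1 + Finsupp.single T 1) := by abel
  rw [hrw] at ha ⊢
  generalize Finsupp.single S 1 + Finsupp.single T 1 = α at *
  obtain ⟨s₀, hs₀, s₁, hs₁, hj, hi⟩ := ih (M (c + β)) (by rw [← ha]; simpa using hβ) _ rfl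
  obtain ⟨t₀, ht₀, t₁, ht₁, hj', hi'⟩ := ih (M (c + γ)) (by rw [← ha]; simpa using hγ) _ rfl
  have wβ : expWeight w (c + β) = expWeight w (c + α) := by
    rw [expWeight_add, expWeight_add, hwβ]
  have wγ : expWeight w (c + α) < expWeight w (c + γ) := by
    rw [expWeight_add, expWeight_add]; linarith
  rw [wβ] at hs₀ hs₁
  have e0 : monomial (c + α) (1 : k) = monomial c 1 * monomial α 1 := by
    rw [monomial_mul, one_mul]
  have e1 : monomial c 1 * monomial β x = x • monomial (c + β) (1 : k) := by
    rw [monomial_mul, one_mul, smul_monomial]; simp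
  have e2 : monomial c 1 * monomial γ y = y • monomial (c + γ) (1 : k) := by
    rw [monomial_mul, one_mul, smul_monomial]; simp
  refine ⟨x • s₀, Submodule.smul_mem _ _ hs₀, x • s₁ + y • (t₀ + t₁), ?_, ?_, ?_⟩
  · refine add_mem (Submodule.smul_mem _ _ hs₁) (Submodule.smul_mem _ _ (add_mem ?_ ?_))
    · refine restrictSupport_mono k ?_ ht₀
      rintro b ⟨hb, hb'⟩
      exact ⟨hb, by rw [hb']; exact wγ⟩
    · refine restrictSupport_mono k ?_ ht₁
      rintro b ⟨hb, hb'⟩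
      exact ⟨hb, wγ.trans hb'⟩
  · have : monomial (c + α) 1 - x • s₀ = monomial c 1 * (monomial α 1 - monomial β x)
        + C x * (monomial (c + β) 1 - s₀) := by
      rw [mul_sub, e0, e1, smul_eq_C_mul, smul_eq_C_mul]; ring
    rw [this]
    exact add_mem (Ideal.mul_mem_left _ _ hJ) (Ideal.mul_mem_left _ _ hj)
  · have : monomial (c + α) 1 - x • s₀ - (x • s₁ + y • (t₀ + t₁)) =
        monomial c 1 * (monomial α 1 - monomial β x - monomial γ y)
        + C x * (monomial (c + β) 1 - s₀ - s₁) + C y * (monomial (c + γ) 1 - t₀ - t₁) := by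
      rw [mul_sub, mul_sub, e0, e1, e2]; simp only [smul_eq_C_mul]; ring
    rw [this]
    exact add_mem (add_mem (Ideal.mul_mem_left _ _ hI) (Ideal.mul_mem_left _ _ hi))
      (Ideal.mul_mem_left _ _ hi')

lemma abstract_main {σ k : Type} [Field k] (NC : Set (σ →₀ ℕ)) (w : σ → ℝ)
    (I J : Ideal (MvPolynomial σ k))
    (hred : ∀ (a : σ →₀ ℕ),
      ∃ s₀ ∈ restrictSupport k {b | b ∈ NC ∧ expWeight w b = expWeight w a},
      ∃ s₁ ∈ restrictSupport k {b | b ∈ NC ∧ expWeight w a < expWeight w b},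
        monomial a 1 - s₀ ∈ J ∧ monomial a 1 - s₀ - s₁ ∈ I)
    (hind : ∀ g ∈ restrictSupport k NC, g ∈ I → g = 0)
    (f : MvPolynomial σ k) (hf : f ∈ I) : initForm w f ∈ J := by
  by_cases hf0 : f = 0
  · subst hf0; simp [initForm]
  obtain ⟨ω, h0, h1⟩ := initForm_split w f hf0
  choose s₀ hs₀ s₁ hs₁ hJ hI using hred
  have hlin : ∀ (g : MvPolynomial σ k) (s : (σ →₀ ℕ) → MvPolynomial σ k) (K : Ideal (MvPolynomial σ k)),
      (∀ a, monomial a 1 - s a ∈ K) →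
      g - ∑ a ∈ g.support, (coeff a g) • s a ∈ K := by
    intro g s K hs
    have : g - ∑ a ∈ g.support, (coeff a g) • s a =
        ∑ a ∈ g.support, C (coeff a g) * (monomial a 1 - s a) := by
      simp only [mul_sub, Finset.sum_sub_distrib, C_mul_monomial, mul_one, smul_eq_C_mul]
      congr 1
      exact g.as_sum
    rw [this]
    exact Ideal.sum_mem _ (fun a _ => Ideal.mul_mem_left _ _ (hs a))
  set g := initForm w f with hg
  set h := f - g with hh
  set S0 := ∑ a ∈ g.support, (coeff a g) • s₀ a with hS0
  set S1 := ∑ a ∈ g.support, (coeff a g) • s₁ a with hS1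
  set S2 := ∑ a ∈ h.support, (coeff a h) • (s₀ a + s₁ a) with hS2
  have m0 : S0 ∈ restrictSupport k {b | b ∈ NC ∧ expWeight w b = ω} := by
    refine Submodule.sum_mem _ (fun a ha => Submodule.smul_mem _ _ ?_)
    have : expWeight w a = ω := h0 ha
    rw [← this]; exact hs₀ a
  have m1 : S1 ∈ restrictSupport k {b | b ∈ NC ∧ ω < expWeight w b} := by
    refine Submodule.sum_mem _ (fun a ha => Submodule.smul_mem _ _ ?_)
    have : expWeight w a = ω := h0 ha
    rw [← this]; exact hs₁ a
  have m2 : S2 ∈ restrictSupport k {b | b ∈ NC ∧ ω < expWeight w b} := by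
    refine Submodule.sum_mem _ (fun a ha => Submodule.smul_mem _ _ (add_mem ?_ ?_))
    · have : ω < expWeight w a := h1 ha
      refine restrictSupport_mono k ?_ (hs₀ a)
      rintro b ⟨hb, hb'⟩; exact ⟨hb, by rw [hb']; exact this⟩
    · have : ω < expWeight w a := h1 ha
      refine restrictSupport_mono k ?_ (hs₁ a)
      rintro b ⟨hb, hb'⟩; exact ⟨hb, this.trans hb'⟩
  have j0 : g - S0 ∈ J := hlin g s₀ J hJ
  have i0 : g - (S0 + S1) ∈ I := by
    have := hlin g (fun a => s₀ a + s₁ a) I (fun a => by rw [← sub_sub]; exact hI a)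
    simpa only [smul_add, Finset.sum_add_distrib] using this
  have i1 : h - S2 ∈ I := hlin h (fun a => s₀ a + s₁ a) I (fun a => by rw [← sub_sub]; exact hI a)
  have z : S0 + (S1 + S2) = 0 := by
    apply hind
    · refine add_mem (restrictSupport_mono k ?_ m0) (restrictSupport_mono k ?_ (add_mem m1 m2))
      · exact fun b hb => hb.1
      · exact fun b hb => hb.1
    · have : S0 + (S1 + S2) = f - (g - (S0 + S1)) - (h - S2) := by rw [hh]; ring
      rw [this]; exact sub_mem (sub_mem hf i0) i1
  have z0 : S0 = 0 := by
    by_contra hne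
    obtain ⟨b, hb⟩ := support_nonempty.2 hne
    have hw0 : expWeight w b = ω := (m0 hb).2
    have hb2 : b ∉ (S1 + S2).support := by
      intro hc
      have : ω < expWeight w b := (add_mem m1 m2 hc).2
      linarith
    have := congrArg (coeff b) z
    rw [coeff_add, notMem_support_iff.1 hb2, add_zero, coeff_zero] at this
    exact mem_support_iff.1 hb this
  rw [z0, sub_zero] at j0
  exact j0

/-- Exponent of the variable with index `{i, j}`. -/
noncomputable def ee {n : ℕ} (i j : Fin n) : {s : Finset (Fin n) // s.card = 2} →₀ ℕ :=
  if h : i ≠ j then Finsupp.single (pr i j h) 1 else 0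

lemma ee_of_ne {n : ℕ} {i j : Fin n} (h : i ≠ j) : ee i j = Finsupp.single (pr i j h) 1 := by
  rw [ee, dif_pos h]

lemma pr_comm {n : ℕ} (i j : Fin n) (h : i ≠ j) : pr i j h = pr j i h.symm :=
  Subtype.ext (Finset.pair_comm i j)

lemma ee_comm {n : ℕ} (i j : Fin n) : ee i j = ee j i := by
  by_cases h : i = j
  · rw [h]
  · rw [ee_of_ne h, ee_of_ne (Ne.symm h), pr_comm]

lemma pr_eq_iff {n : ℕ} {i j a b : Fin n} (h : i ≠ j) (h' : a ≠ b) :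
    pr i j h = pr a b h' ↔ (i = a ∧ j = b) ∨ (i = b ∧ j = a) := by
  unfold pr
  rw [Subtype.mk.injEq]
  constructor
  · intro e
    have h1 : i ∈ ({a, b} : Finset (Fin n)) := e ▸ (by simp)
    have h2 : j ∈ ({a, b} : Finset (Fin n)) := e ▸ (by simp)
    simp only [Finset.mem_insert, Finset.mem_singleton] at h1 h2
    rcases h1 with rfl | rfl <;> rcases h2 with rfl | rfl
    · exact absurd rfl h
    · left; exact ⟨rfl, rfl⟩
    · right; exact ⟨rfl, rfl⟩
    · exact absurd rfl h
  · rintro (⟨rfl, rfl⟩ | ⟨rfl, rfl⟩)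
    · rfl
    · exact Finset.pair_comm _ _

lemma ee_ne {n : ℕ} {a b c d : Fin n} (hab : a ≠ b) (hac : a ≠ c) (had : a ≠ d) (hbc : b ≠ c)
    (hbd : b ≠ d) (hcd : c ≠ d) : ee a b + ee c d ≠ ee a c + ee b d := by
  rw [ee_of_ne hab, ee_of_ne hcd, ee_of_ne hac, ee_of_ne hbd]
  intro h
  have := DFunLike.congr_fun h (pr a b hab)
  simp only [Finsupp.add_apply, Finsupp.single_apply] at this
  have x1 : ¬ pr b d hbd = pr a b hab := by
    rw [pr_eq_iff]; rintro (⟨h, _⟩ | ⟨_, h⟩)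
    · exact hab h.symm
    · exact had h.symm
  have x2 : ¬ pr a c hac = pr a b hab := by
    rw [pr_eq_iff]; rintro (⟨_, h⟩ | ⟨h, _⟩)
    · exact hbc h.symm
    · exact hab h
  rw [if_pos trivial, if_neg x1, if_neg x2] at this
  omega

lemma expWeight_ee {n : ℕ} (w : {s : Finset (Fin n) // s.card = 2} → ℝ) {i j : Fin n} (h : i ≠ j) :
    expWeight w (ee i j) = w (pr i j h) := by
  rw [ee_of_ne h, expWeight_single]

lemma pluckerMap_pr (k : Type) [Field k] {n : ℕ} (i j : Fin n) (h : i < j) :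
    pluckerMap k 2 n (X (pr i j h.ne)) = X (0, i) * X (1, j) - X (0, j) * X (1, i) := by
  unfold pluckerMap
  rw [aeval_X, Matrix.det_fin_two]
  have h0 : (((pr i j h.ne).1.orderIsoOfFin (pr i j h.ne).2 0 : (pr i j h.ne).1) : Fin n) = i := by
    rw [Finset.coe_orderIsoOfFin_apply]
    have := Finset.orderEmbOfFin_zero (pr i j h.ne).2 (by norm_num)
    refine Eq.trans this ?_
    simp [pr, h.le]
  have h1 : (((pr i j h.ne).1.orderIsoOfFin (pr i j h.ne).2 1 : (pr i j h.ne).1) : Fin n) = j := by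
    rw [Finset.coe_orderIsoOfFin_apply]
    have := Finset.orderEmbOfFin_last (pr i j h.ne).2 (by norm_num)
    refine Eq.trans this ?_
    simp [pr, h.le]
  simp only [Matrix.of_apply, h0, h1]

lemma pluckerMap_pr' (k : Type) [Field k] {n : ℕ} (i j : Fin n) (h : i ≠ j) :
    ∃ c : k, c ≠ 0 ∧
      pluckerMap k 2 n (X (pr i j h)) = C c * (X (0, i) * X (1, j) - X (0, j) * X (1, i)) := by
  rcases lt_or_gt_of_ne h with h' | h'
  · exact ⟨1, one_ne_zero, by rw [pluckerMap_pr k i j h']; simp⟩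
  · refine ⟨-1, by simp, ?_⟩
    rw [pr_comm, pluckerMap_pr k j i h']; simp

lemma quadric_mem (k : Type) [Field k] {n : ℕ} (i j l m : Fin n)
    (hij : i < j) (hjl : j < l) (hlm : l < m) :
    pluckerQuadric k i j l m hij hjl hlm ∈ pluckerIdeal k 2 n := by
  unfold pluckerIdeal
  rw [RingHom.mem_ker]
  unfold pluckerQuadric
  rw [map_add, map_sub, map_mul, map_mul, map_mul, pluckerMap_pr k i j hij, pluckerMap_pr k l m hlm,
    pluckerMap_pr k i l (hij.trans hjl), pluckerMap_pr k j m (hjl.trans hlm),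
    pluckerMap_pr k i m (hij.trans (hjl.trans hlm)), pluckerMap_pr k j l hjl]
  ring

lemma quadric_eq (k : Type) [Field k] {n : ℕ} (i j l m : Fin n)
    (hij : i < j) (hjl : j < l) (hlm : l < m) :
    pluckerQuadric k i j l m hij hjl hlm = monomial (ee i j + ee l m) 1 +
      monomial (ee i l + ee j m) (-1) + monomial (ee i m + ee j l) 1 := by
  unfold pluckerQuadric
  rw [ee_of_ne hij.ne, ee_of_ne hlm.ne, ee_of_ne (hij.trans hjl).ne, ee_of_ne (hjl.trans hlm).ne,
    ee_of_ne (hij.trans (hjl.trans hlm)).ne, ee_of_ne hjl.ne, map_neg]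
  simp only [X, monomial_mul, mul_one]
  ring

/-- The symmetric version of the hypotheses at a quadruple. -/
def QQ (k : Type) [Field k] {n : ℕ} (w : {s : Finset (Fin n) // s.card = 2} → ℝ)
    (J : Ideal (MvPolynomial {s : Finset (Fin n) // s.card = 2} k)) (a b c d : Fin n) : Prop :=
  minExactlyTwice (expWeight w (ee a b + ee c d)) (expWeight w (ee a c + ee b d))
    (expWeight w (ee a d + ee b c)) ∧
  ∃ x y z : k, x ≠ 0 ∧ y ≠ 0 ∧ z ≠ 0 ∧
    monomial (ee a b + ee c d) x + monomial (ee a c + ee b d) y + monomial (ee a d + ee b c) z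
      ∈ pluckerIdeal k 2 n ∧
    initForm w (monomial (ee a b + ee c d) x + monomial (ee a c + ee b d) y +
      monomial (ee a d + ee b c) z) ∈ J

lemma met_132 {a b c : ℝ} (h : minExactlyTwice a b c) : minExactlyTwice a c b := by
  unfold minExactlyTwice at *
  rcases h with h | h | h
  · exact Or.inr (Or.inl h)
  · exact Or.inl h
  · exact Or.inr (Or.inr ⟨h.1.symm, h.1 ▸ h.2⟩)

lemma met_213 {a b c : ℝ} (h : minExactlyTwice a b c) : minExactlyTwice b a c := by
  unfold minExactlyTwice at *
  rcases h with h | h | h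
  · exact Or.inl ⟨h.1.symm, h.1 ▸ h.2⟩
  · exact Or.inr (Or.inr h)
  · exact Or.inr (Or.inl h)

lemma QQ_all (k : Type) [Field k] {n : ℕ} (w : {s : Finset (Fin n) // s.card = 2} → ℝ)
    (hw : StrictFourPoint w) (J : Ideal (MvPolynomial {s : Finset (Fin n) // s.card = 2} k))
    (hJ : ∀ (i j l m : Fin n) (hij : i < j) (hjl : j < l) (hlm : l < m),
      initForm w (pluckerQuadric k i j l m hij hjl hlm) ∈ J) :
    ∀ a b c d, a ≠ b → a ≠ c → a ≠ d → b ≠ c → b ≠ d → c ≠ d → QQ k w J a b c d := by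
  apply sym4
  · rintro a b c d ⟨h, x, y, z, hx, hy, hz, h1, h2⟩
    unfold QQ
    rw [ee_comm b a, add_comm (ee b c), add_comm (ee b d)]
    refine ⟨met_132 h, x, z, y, hx, hz, hy, ?_, ?_⟩ <;> rw [add_right_comm] <;> assumption
  · rintro a b c d ⟨h, x, y, z, hx, hy, hz, h1, h2⟩
    unfold QQ
    rw [ee_comm c b]
    refine ⟨met_213 h, y, x, z, hy, hx, hz, ?_, ?_⟩ <;>
      rw [add_comm (monomial (ee a c + ee b d) y)] <;> assumption
  · rintro a b c d ⟨h, x, y, z, hx, hy, hz, h1, h2⟩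
    unfold QQ
    rw [ee_comm d c]
    refine ⟨met_132 h, x, z, y, hx, hz, hy, ?_, ?_⟩ <;> rw [add_right_comm] <;> assumption
  · intro a b c d hab hbc hcd
    refine ⟨?_, 1, -1, 1, one_ne_zero, by simp, one_ne_zero, ?_, ?_⟩
    · have := hw a b c d hab hbc hcd
      simp only [expWeight_add]
      rwa [expWeight_ee w hab.ne, expWeight_ee w hcd.ne, expWeight_ee w (hab.trans hbc).ne,
        expWeight_ee w (hbc.trans hcd).ne, expWeight_ee w (hab.trans (hbc.trans hcd)).ne,
        expWeight_ee w hbc.ne]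
    · rw [← quadric_eq k a b c d hab hbc hcd]; exact quadric_mem ..
    · rw [← quadric_eq k a b c d hab hbc hcd]; exact hJ ..

lemma binom_part (k : Type) [Field k] {n : ℕ} (w : {s : Finset (Fin n) // s.card = 2} → ℝ)
    (hw : StrictFourPoint w) (i j l m : Fin n) (hij : i < j) (hjl : j < l) (hlm : l < m) :
    IsBinomial (initForm w (pluckerQuadric k i j l m hij hjl hlm)) := by
  have := (QQ_all k w hw ⊤ (fun _ _ _ _ _ _ _ => Submodule.mem_top) i j l m hij.ne
    (hij.trans hjl).ne (hij.trans (hjl.trans hlm)).ne hjl.ne (hjl.trans hlm).ne hlm.ne).1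
  have q := quadric_eq k i j l m hij hjl hlm
  have hil := (hij.trans hjl).ne
  have him := (hij.trans (hjl.trans hlm)).ne
  have hjm := (hjl.trans hlm).ne
  have n1 : ee i j + ee l m ≠ ee i l + ee j m := ee_ne hij.ne hil him hjl.ne hjm hlm.ne
  have n2 : ee i j + ee l m ≠ ee i m + ee j l := by
    rw [ee_comm l m]; exact ee_ne hij.ne him hil hjm hjl.ne hlm.ne.symm
  have n3 : ee i l + ee j m ≠ ee i m + ee j l := by
    rw [ee_comm j m, ee_comm j l]; exact ee_ne hil him hij.ne hlm.ne hjl.ne.symm hjm.symm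
  have hm : (-1 : k) ≠ 0 := by simp
  rcases this with h | h | h
  · exact ⟨_, _, _, _, n1, one_ne_zero, hm,
      initForm_three w _ _ _ 1 (-1) 1 n1 one_ne_zero h.1 h.2 _ q⟩
  · exact ⟨_, _, _, _, n2, one_ne_zero, one_ne_zero,
      initForm_three w _ _ _ 1 1 (-1) n2 one_ne_zero h.1 h.2 _ (by rw [q]; ring)⟩
  · exact ⟨_, _, _, _, n3, hm, one_ne_zero,
      initForm_three w _ _ _ (-1) 1 1 n3 hm h.1 h.2 _ (by rw [q]; ring)⟩

lemma red_step (k : Type) [Field k] {n : ℕ} (w : {s : Finset (Fin n) // s.card = 2} → ℝ)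
    (J : Ideal (MvPolynomial {s : Finset (Fin n) // s.card = 2} k)) (α β γ : _ →₀ ℕ) (x y z : k)
    (hne : α ≠ β) (hx : x ≠ 0)
    (h1 : expWeight w α = expWeight w β) (h2 : expWeight w α < expWeight w γ)
    (q : MvPolynomial {s : Finset (Fin n) // s.card = 2} k)
    (hq : q = monomial α x + monomial β y + monomial γ z)
    (hI : q ∈ pluckerIdeal k 2 n) (hJ : initForm w q ∈ J) :
    ∃ u v : k, monomial α 1 - monomial β u ∈ J ∧
      monomial α 1 - monomial β u - monomial γ v ∈ pluckerIdeal k 2 n := by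
  rw [initForm_three w α β γ x y z hne hx h1 h2 q hq] at hJ
  refine ⟨-(x⁻¹ * y), -(x⁻¹ * z), ?_, ?_⟩
  · have := Ideal.mul_mem_left J (C x⁻¹) hJ
    rwa [mul_add, C_mul_monomial, C_mul_monomial, inv_mul_cancel₀ hx, ← sub_neg_eq_add,
      ← map_neg] at this
  · have := Ideal.mul_mem_left _ (C x⁻¹) hI
    rwa [hq, mul_add, mul_add, C_mul_monomial, C_mul_monomial, C_mul_monomial, inv_mul_cancel₀ hx,
      ← sub_neg_eq_add, ← sub_neg_eq_add, ← map_neg, ← map_neg] at this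

theorem initIdeal_pluckerIdeal_two_eq_span_binomials (k : Type) [Field k] (n : ℕ) (hn : 4 ≤ n)
    (w : {s : Finset (Fin n) // s.card = 2} → ℝ) (hw : StrictFourPoint w) :
    (∀ (i j l m : Fin n) (hij : i < j) (hjl : j < l) (hlm : l < m),
        IsBinomial (initForm w (pluckerQuadric k i j l m hij hjl hlm)))
    ∧ initIdeal w (pluckerIdeal k 2 n) =
        Ideal.span { g | ∃ (i j l m : Fin n) (hij : i < j) (hjl : j < l) (hlm : l < m),
          g = initForm w (pluckerQuadric k i j l m hij hjl hlm) } := by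
  refine ⟨binom_part k w hw, ?_⟩
  apply le_antisymm
  swap
  · apply Ideal.span_mono
    rintro g ⟨i, j, l, m, hij, hjl, hlm, rfl⟩
    exact ⟨_, quadric_mem k i j l m hij hjl hlm, rfl⟩
  unfold initIdeal
  rw [Ideal.span_le]
  rintro _ ⟨f, hf, rfl⟩
  generalize hJdef : Ideal.span { g | ∃ (i j l m : Fin n) (hij : i < j) (hjl : j < l) (hlm : l < m),
          g = initForm w (pluckerQuadric k i j l m hij hjl hlm) } = J
  have hJ : ∀ (i j l m : Fin n) (hij : i < j) (hjl : j < l) (hlm : l < m),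
      initForm w (pluckerQuadric k i j l m hij hjl hlm) ∈ J := by
    intro i j l m hij hjl hlm
    rw [← hJdef]
    exact Ideal.subset_span ⟨i, j, l, m, hij, hjl, hlm, rfl⟩
  have hQ := QQ_all k w hw J hJ
  obtain ⟨ρ, hρ, hcr⟩ := exists_rank4 (⟨0, by omega⟩ : Fin n) (fun i j => expWeight w (ee i j))
    (fun i j => by rw [ee_comm]) (by
      intro i j l m h1 h2 h3 h4 h5 h6
      have := (hQ i j l m h1 h2 h3 h4 h5 h6).1
      simpa only [expWeight_add] using this)
  have hex : ∀ S : {s : Finset (Fin n) // s.card = 2}, ∃ u v : Fin n, ρ u < ρ v ∧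
      ∃ h : u ≠ v, S = pr u v h := by
    rintro ⟨S, hS⟩
    obtain ⟨u, v, huv, rfl⟩ := Finset.card_eq_two.1 hS
    rcases lt_or_gt_of_ne (fun h => huv (hρ h) : ρ u ≠ ρ v) with h | h
    · exact ⟨u, v, h, huv, rfl⟩
    · exact ⟨v, u, h, huv.symm, pr_comm u v huv⟩
  choose lo hi hlt hne hpr using hex
  have hlohi : ∀ u v (h : u ≠ v), ρ u < ρ v → lo (pr u v h) = u ∧ hi (pr u v h) = v := by
    intro u v h huv
    have h1 := hpr (pr u v h)
    have h2 := hlt (pr u v h)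
    rw [pr_eq_iff] at h1
    rcases h1 with h1 | h1
    · exact ⟨h1.1.symm, h1.2.symm⟩
    · rw [← h1.1, ← h1.2] at h2; omega
  obtain ⟨N, hN⟩ : ∃ N, ∀ i, ρ i < N :=
    ⟨Finset.univ.sup ρ + 1, fun i => Nat.lt_succ_of_le (Finset.le_sup (Finset.mem_univ i))⟩
  let M : ({s : Finset (Fin n) // s.card = 2} →₀ ℕ) →+ ℕ :=
    Finsupp.weight (fun S => (ρ (hi S) - ρ (lo S)) * (N - (ρ (hi S) - ρ (lo S))))
  have hM : ∀ u v, ρ u < ρ v → M (ee u v) = (ρ v - ρ u) * (N - (ρ v - ρ u)) := by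
    intro u v h
    have huv : u ≠ v := by rintro rfl; exact lt_irrefl _ h
    obtain ⟨e1, e2⟩ := hlohi u v huv h
    rw [ee_of_ne huv]
    simp only [M, Finsupp.weight_single, e1, e2, one_smul]
  have hφ : ∀ S, ∃ c : k, c ≠ 0 ∧ pluckerMap k 2 n (X S) =
      C c * (X (0, lo S) * X (1, hi S) - X (0, hi S) * X (1, lo S)) := by
    intro S
    obtain ⟨c, hc, h⟩ := pluckerMap_pr' k (lo S) (hi S) (hne S)
    rw [← hpr S] at h
    exact ⟨c, hc, h⟩
  have hinj : ∀ S T, lo S = lo T → hi S = hi T → S = T := by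
    intro S T h1 h2
    rw [hpr S, hpr T, pr_eq_iff]; exact Or.inl ⟨h1, h2⟩
  refine abstract_main {b | NonCross lo hi ρ b} w (pluckerIdeal k 2 n) J ?_ ?_ f hf
  · intro a
    refine reduction lo hi ρ w M (pluckerIdeal k 2 n) J ?_ (M a) a rfl
    intro S T h1 h2 h3
    have eS : Finsupp.single S 1 = ee (lo S) (hi S) := by rw [ee_of_ne (hne S), ← hpr S]
    have eT : Finsupp.single T 1 = ee (lo T) (hi T) := by rw [ee_of_ne (hne T), ← hpr T]
    rw [eS, eT]
    generalize lo S = a at *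
    generalize lo T = b at *
    generalize hi S = c at *
    generalize hi T = d at *
    have hc := hcr a b c d h1 h2 h3
    have nn : ∀ {u v : Fin n}, ρ u < ρ v → u ≠ v := by
      rintro u v h rfl; exact lt_irrefl _ h
    have hab := nn h1
    have hbc := nn h2
    have hcd := nn h3
    have hac := nn (h1.trans h2)
    have hbd := nn (h2.trans h3)
    have had := nn (h1.trans (h2.trans h3))
    obtain ⟨hmin, x, y, z, hx, hy, hz, hI, hJ'⟩ := hQ a b c d hab hac had hbc hbd hcd
    simp only [← expWeight_add] at hc
    have m12 : M (ee a b + ee c d) < M (ee a c + ee b d) ∧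
        M (ee a d + ee b c) < M (ee a c + ee b d) := by
      simp only [map_add]
      rw [hM a b h1, hM c d h3, hM a c (h1.trans h2), hM b d (h2.trans h3),
        hM a d (h1.trans (h2.trans h3)), hM b c h2]
      obtain ⟨p, hp⟩ := Nat.exists_eq_add_of_lt h1
      obtain ⟨q, hq⟩ := Nat.exists_eq_add_of_lt h2
      obtain ⟨r, hr⟩ := Nat.exists_eq_add_of_lt h3
      have hd := hN d
      obtain ⟨t, ht⟩ : ∃ t, N = (p + 1) + (q + 1) + (r + 1) + (t + 1) :=
        ⟨N - ((p + 1) + (q + 1) + (r + 1) + 1), by omega⟩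
      rw [show ρ b - ρ a = p + 1 by omega, show ρ d - ρ c = r + 1 by omega,
        show ρ c - ρ a = p + 1 + (q + 1) by omega, show ρ d - ρ b = q + 1 + (r + 1) by omega,
        show ρ d - ρ a = p + 1 + (q + 1) + (r + 1) by omega, show ρ c - ρ b = q + 1 by omega,
        show N - (p + 1) = (q + 1) + (r + 1) + (t + 1) by omega,
        show N - (r + 1) = (p + 1) + (q + 1) + (t + 1) by omega,
        show N - (p + 1 + (q + 1)) = (r + 1) + (t + 1) by omega,
        show N - (q + 1 + (r + 1)) = (p + 1) + (t + 1) by omega,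
        show N - (p + 1 + (q + 1) + (r + 1)) = t + 1 by omega,
        show N - (q + 1) = (p + 1) + (r + 1) + (t + 1) by omega]
      constructor <;> nlinarith [Nat.zero_le (q * t), Nat.zero_le (p * r)]
    have n1 : ee a c + ee b d ≠ ee a b + ee c d := (ee_ne hab hac had hbc hbd hcd).symm
    have n3 : ee a c + ee b d ≠ ee a d + ee b c := by
      rw [ee_comm b d, ee_comm b c]; exact ee_ne hac had hab hcd hbc.symm hbd.symm
    rcases hmin with h | h | h
    · obtain ⟨u, v, hu, hv⟩ := red_step k w J (ee a c + ee b d) (ee a b + ee c d) (ee a d + ee b c)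
        y x z n1 hy h.1.symm (h.1 ▸ h.2) _ (by ring) hI hJ'
      exact ⟨_, _, u, v, m12.1, m12.2, h.1, h.1 ▸ h.2, hu, hv⟩
    · exfalso; linarith [h.2, hc.1]
    · obtain ⟨u, v, hu, hv⟩ := red_step k w J (ee a c + ee b d) (ee a d + ee b c) (ee a b + ee c d)
        y z x n3 hy h.1 h.2 _ (by ring) hI hJ'
      exact ⟨_, _, u, v, m12.2, m12.1, h.1.symm, h.2, hu, hv⟩
  · intro g hg hgI
    exact indep lo hi ρ hρ hlt hinj (pluckerMap k 2 n) hφ g hg (RingHom.mem_ker.1 hgI)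
end

section
/- Let k be any field, let n ≥ 4, and let w ∈ ℝ^{C(n,2)} be such that for every 1 ≤ i < j < k < l ≤ n the minimum of the three numbers w_{ij} + w_{kl}, w_{ik} + w_{jl}, w_{il} + w_{jk} is attained exactly twice (so that in_w(I_{2,n}) is a binomial ideal). Then the initial ideal in_w(I_{2,n}) is a prime ideal of k[p_{ij} : 1 ≤ i < j ≤ n]. In other words, every initial binomial ideal of the Plücker ideal I_{2,n} is prime. -/
open scoped Classical

open MvPolynomial

namespace PluckerAux

/-- strict ultrametric -/
def SUM {n : ℕ} (u : Fin n → Fin n → ℝ) : Prop :=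
  ∀ i j k, i ≠ j → i ≠ k → j ≠ k → minExactlyTwice (u i j) (u i k) (u j k)

noncomputable def ball {n : ℕ} (u : Fin n → Fin n → ℝ) (i j : Fin n) : Finset (Fin n) :=
  Finset.univ.filter (fun k => k = i ∨ u i j ≤ u i k)

theorem mem_ball {n : ℕ} (u : Fin n → Fin n → ℝ) (i j k : Fin n) :
    k ∈ ball u i j ↔ (k = i ∨ u i j ≤ u i k) := by simp [ball]

theorem ball_congr {n : ℕ} {u : Fin n → Fin n → ℝ} (hs : ∀ i j, u i j = u j i) (hu : SUM u)
    {m i j : Fin n} (hmi : m ≠ i) (hmj : m ≠ j) (hij : i ≠ j) (h : u m i < u m j) :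
    ball u m i = ball u j i := by
  ext k
  rw [mem_ball, mem_ball]
  have h1 := hu m i j hmi hmj hij
  by_cases hkm : k = m
  · subst hkm
    have := hs k j
    have := hs i j
    unfold minExactlyTwice at h1
    grind
  by_cases hkj : k = j
  · subst hkj
    grind
  have h2 := hu m j k hmj (Ne.symm hkm) (Ne.symm hkj)
  have := hs i j
  unfold minExactlyTwice at h1 h2
  have := hs j m
  grind

theorem ball_symm {n : ℕ} {u : Fin n → Fin n → ℝ} (hs : ∀ i j, u i j = u j i) (hu : SUM u)
    {i j : Fin n} (hij : i ≠ j) : ball u i j = ball u j i := by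
  ext k
  rw [mem_ball, mem_ball]
  have := hs i j
  by_cases hki : k = i
  · subst hki; grind
  by_cases hkj : k = j
  · subst hkj; grind
  have h2 := hu i j k hij (Ne.symm hki) (Ne.symm hkj)
  unfold minExactlyTwice at h2
  grind

theorem ball_eq_of {n : ℕ} {u : Fin n → Fin n → ℝ} {i j k : Fin n} (h : u i j = u i k) :
    ball u i j = ball u i k := by
  unfold ball; rw [h]

theorem le_of_mem_ball {n : ℕ} {u : Fin n → Fin n → ℝ} (hs : ∀ i j, u i j = u j i) (hu : SUM u)
    {i j k l : Fin n} (hkl : k ≠ l) (hk : k ∈ ball u i j) (hl : l ∈ ball u i j) :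
    u i j ≤ u k l := by
  rw [mem_ball] at hk hl
  by_cases hki : k = i
  · subst hki; grind
  by_cases hli : l = i
  · subst hli; have := hs k l; grind
  have h2 := hu i k l (Ne.symm hki) (Ne.symm hli) hkl
  unfold minExactlyTwice at h2
  grind

theorem ball_inj {n : ℕ} {u : Fin n → Fin n → ℝ} (hs : ∀ i j, u i j = u j i) (hu : SUM u)
    {i j k l : Fin n} (hij : i ≠ j) (hkl : k ≠ l) (h : ball u i j = ball u k l) :
    u k l = u i j ∧ (((k = i ∨ u i j < u i k) ∧ (l = j ∨ u i j < u j l)) ∨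
      ((l = i ∨ u i j < u i l) ∧ (k = j ∨ u i j < u j k))) := by
  have m1 : ∀ a b : Fin n, a ∈ ball u a b := by intro a b; rw [mem_ball]; simp
  have m2 : ∀ a b : Fin n, b ∈ ball u a b := by intro a b; rw [mem_ball]; simp
  have hi : i ∈ ball u k l := h ▸ m1 i j
  have hj : j ∈ ball u k l := h ▸ m2 i j
  have hk : k ∈ ball u i j := h ▸ m1 k l
  have hl : l ∈ ball u i j := h ▸ m2 k l
  have e : u k l = u i j := le_antisymm (le_of_mem_ball hs hu hij hi hj)
    (le_of_mem_ball hs hu hkl hk hl)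
  refine ⟨e, ?_⟩
  have L : ∀ a b : Fin n, a ∈ ball u i j → b ∈ ball u i j → a ≠ b → u i j ≤ u a b :=
    fun a b ha hb hab => le_of_mem_ball hs hu hab ha hb
  have Lik := L i k (m1 _ _) hk
  have Lil := L i l (m1 _ _) hl
  have Ljk := L j k (m2 _ _) hk
  have Ljl := L j l (m2 _ _) hl
  have T1 := hu i j k hij
  have T2 := hu i j l hij
  have T3 := fun a b => hu i k l a b hkl
  have T4 := fun a b => hu j k l a b hkl
  have := hs i j
  have := hs k l
  unfold minExactlyTwice at T1 T2 T3 T4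
  by_cases a1 : k = i
  · subst a1
    by_cases a4 : l = j
    · exact Or.inl ⟨Or.inl rfl, Or.inl a4⟩
    · left; refine ⟨Or.inl rfl, Or.inr ?_⟩; grind
  by_cases a2 : l = i
  · subst a2
    by_cases a4 : k = j
    · exact Or.inr ⟨Or.inl rfl, Or.inl a4⟩
    · right; refine ⟨Or.inl rfl, Or.inr ?_⟩; grind
  by_cases a3 : k = j
  · subst a3
    right; refine ⟨Or.inr ?_, Or.inl rfl⟩; grind
  by_cases a4 : l = j
  · subst a4
    left; refine ⟨Or.inr ?_, Or.inl rfl⟩; grind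
  have T1 := T1 (Ne.symm a1) (Ne.symm a3)
  have T2 := T2 (Ne.symm a2) (Ne.symm a4)
  have T3 := T3 (Ne.symm a1) (Ne.symm a2)
  have T4 := T4 (Ne.symm a3) (Ne.symm a4)
  grind

end PluckerAux

namespace PluckerAux

def Lead {R : Type*} [CommRing R] (x : HahnSeries ℝ R) (r : ℝ) (c : R) : Prop :=
  (∀ r' < r, x.coeff r' = 0) ∧ x.coeff r = c

theorem Lead.mul {R : Type*} [CommRing R] {x y : HahnSeries ℝ R} {r s : ℝ} {c d : R}
    (hx : Lead x r c) (hy : Lead y s d) : Lead (x * y) (r + s) (c * d) := by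
  have lx : ∀ a, x.coeff a ≠ 0 → r ≤ a := fun a ha => by
    by_contra hh; exact ha (hx.1 a (not_le.mp hh))
  have ly : ∀ a, y.coeff a ≠ 0 → s ≤ a := fun a ha => by
    by_contra hh; exact ha (hy.1 a (not_le.mp hh))
  constructor
  · intro r' hr'
    rw [HahnSeries.coeff_mul]
    apply Finset.sum_eq_zero
    rintro ⟨a, b⟩ hab
    simp only [Finset.mem_antidiagonal, HahnSeries.mem_support] at hab
    have := lx a hab.1
    have := ly b hab.2.1
    have := hab.2.2
    linarith
  · rw [HahnSeries.coeff_mul, Finset.sum_eq_single (r, s)]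
    · rw [hx.2, hy.2]
    · rintro ⟨a, b⟩ hab hne
      simp only [Finset.mem_antidiagonal, HahnSeries.mem_support] at hab
      have h1 := lx a hab.1
      have h2 := ly b hab.2.1
      have h3 := hab.2.2
      exfalso; apply hne
      ext <;> simp <;> linarith
    · intro h
      simp only [Finset.mem_antidiagonal, HahnSeries.mem_support, not_and] at h
      by_cases h1 : x.coeff r = 0
      · simp [h1]
      · by_cases h2 : y.coeff s = 0
        · simp [h2]
        · exact absurd trivial (h h1 h2)

theorem Lead.neg {R : Type*} [CommRing R] {x : HahnSeries ℝ R} {r : ℝ} {c : R}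
    (hx : Lead x r c) : Lead (-x) r (-c) := by
  refine ⟨fun r' h => ?_, ?_⟩
  · rw [HahnSeries.coeff_neg, hx.1 r' h, neg_zero]
  · rw [HahnSeries.coeff_neg, hx.2]

theorem lead_single {R : Type*} [CommRing R] (r : ℝ) (c : R) :
    Lead (HahnSeries.single r c) r c := by
  refine ⟨fun r' h => ?_, ?_⟩
  · rw [HahnSeries.coeff_single_of_ne h.ne]
  · rw [HahnSeries.coeff_single_same]

theorem Lead.add_left {R : Type*} [CommRing R] {x y : HahnSeries ℝ R} {r s : ℝ} {c d : R}
    (hx : Lead x r c) (hy : Lead y s d) (h : r < s) : Lead (x + y) r c := by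
  refine ⟨fun r' h' => ?_, ?_⟩
  · rw [HahnSeries.coeff_add, hx.1 r' h', hy.1 r' (h'.trans h), add_zero]
  · rw [HahnSeries.coeff_add, hx.2, hy.1 r h, add_zero]

theorem lead_pow {R : Type*} [CommRing R] {x : HahnSeries ℝ R} {r : ℝ} {c : R}
    (hx : Lead x r c) (m : ℕ) : Lead (x ^ m) (m * r) (c ^ m) := by
  induction m with
  | zero => simpa using lead_single (0 : ℝ) (1 : R)
  | succ m ih =>
    rw [pow_succ, pow_succ]
    have := ih.mul hx
    convert this using 1
    push_cast; ring

theorem lead_prod {R ι : Type*} [CommRing R] (s : Finset ι) {x : ι → HahnSeries ℝ R} {r : ι → ℝ}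
    {c : ι → R} (hx : ∀ i, Lead (x i) (r i) (c i)) :
    Lead (∏ i ∈ s, x i) (∑ i ∈ s, r i) (∏ i ∈ s, c i) := by
  induction s using Finset.induction_on with
  | empty => simpa using lead_single (0 : ℝ) (1 : R)
  | insert a s ha ih =>
    rw [Finset.prod_insert ha, Finset.prod_insert ha, Finset.sum_insert ha]
    exact (hx a).mul ih

theorem lead_monomial {σ k R : Type*} [CommRing k] [CommRing R] [Algebra k R]
    (Φ : MvPolynomial σ k →+* HahnSeries ℝ R)
    (hC : ∀ c, Φ (C c) = HahnSeries.C (algebraMap k R c)) (ψ : MvPolynomial σ k →ₐ[k] R) (w : σ → ℝ)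
    (h : ∀ S, Lead (Φ (X S)) (w S) (ψ (X S))) (a : σ →₀ ℕ) (c : k) :
    Lead (Φ (monomial a c)) (expWeight w a) (ψ (monomial a c)) := by
  rw [monomial_eq, map_mul, map_mul]
  have hc : Lead (Φ (C c)) 0 (ψ (C c)) := by
    have e1 : Φ (C c) = HahnSeries.single 0 (algebraMap k R c) := hC c
    have e2 : ψ (C c) = algebraMap k R c := ψ.commutes c
    rw [e1, e2]
    exact lead_single _ _
  have hp : Lead (Φ (a.prod fun n e => X n ^ e)) (expWeight w a)
      (ψ (a.prod fun n e => X n ^ e)) := by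
    unfold Finsupp.prod expWeight Finsupp.sum
    rw [map_prod, map_prod]
    apply lead_prod
    intro i
    rw [map_pow, map_pow]
    exact lead_pow (h i) _
  simpa using hc.mul hp

theorem initForm_mem_ker {σ k R : Type*} [CommRing k] [CommRing R] [Algebra k R]
    (Φ : MvPolynomial σ k →+* HahnSeries ℝ R)
    (hC : ∀ c, Φ (C c) = HahnSeries.C (algebraMap k R c)) (ψ : MvPolynomial σ k →ₐ[k] R) (w : σ → ℝ)
    (h : ∀ S, Lead (Φ (X S)) (w S) (ψ (X S))) (f : MvPolynomial σ k) (hf : Φ f = 0) :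
    ψ (initForm w f) = 0 := by
  by_cases h0 : f.support.Nonempty
  swap
  · rw [Finset.not_nonempty_iff_eq_empty] at h0
    simp [initForm, h0]
  obtain ⟨a0, ha0, hmin⟩ := Finset.exists_min_image f.support (expWeight w) h0
  have key : (Φ f).coeff (expWeight w a0) = ψ (initForm w f) := by
    conv_lhs => rw [f.as_sum]
    rw [map_sum, HahnSeries.coeff_sum, initForm, map_sum, Finset.sum_filter]
    apply Finset.sum_congr rfl
    intro a ha
    have L := lead_monomial Φ hC ψ w h a (coeff a f)
    split_ifs with hc
    · have e : expWeight w a0 = expWeight w a := le_antisymm (hmin a ha) (hc a0 ha0)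
      rw [e, L.2]
    · apply L.1
      by_contra hh
      exact hc fun b hb => (not_lt.mp hh).trans (hmin b hb)
  rw [← key, hf, HahnSeries.coeff_zero]

def PM {n : ℕ} {R : Type*} [CommRing R] (u : Fin n → Fin n → ℝ) (z : Finset (Fin n) → R)
    (y : Fin n → HahnSeries ℝ R) (i j : Fin n) : Prop :=
  ∃ ε : ℤˣ, Lead (y j - y i) (u i j) ((ε : ℤ) * z (ball u i j))

theorem PM.symm {n : ℕ} {R : Type*} [CommRing R] {u : Fin n → Fin n → ℝ}
    (hs : ∀ i j, u i j = u j i) (hu : SUM u) {z : Finset (Fin n) → R}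
    {y : Fin n → HahnSeries ℝ R} {i j : Fin n} (hij : i ≠ j) (h : PM u z y i j) :
    PM u z y j i := by
  obtain ⟨ε, h⟩ := h
  refine ⟨-ε, ?_⟩
  have := h.neg
  rw [neg_sub] at this
  rw [hs j i, ← ball_symm hs hu hij]
  simpa using this

theorem exists_real {n : ℕ} {R : Type*} [CommRing R] {u : Fin n → Fin n → ℝ}
    (hs : ∀ i j, u i j = u j i) (hu : SUM u) (z : Finset (Fin n) → R) (T : Finset (Fin n)) :
    ∃ y : Fin n → HahnSeries ℝ R, ∀ i ∈ T, ∀ j ∈ T, i ≠ j → PM u z y i j := by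
  induction T using Finset.induction_on with
  | empty => exact ⟨0, by simp⟩
  | insert m T hm ih =>
    obtain ⟨y, hy⟩ := ih
    by_cases hT : T.Nonempty
    swap
    · rw [Finset.not_nonempty_iff_eq_empty] at hT
      subst hT
      refine ⟨0, ?_⟩
      intro i hi j hj hij
      simp at hi hj
      exact absurd (hi.trans hj.symm) hij
    obtain ⟨j0, hj0, hmax⟩ := Finset.exists_max_image T (u m) hT
    have hmj0 : m ≠ j0 := fun e => hm (e ▸ hj0)
    set y' := Function.update y m (y j0 + HahnSeries.single (u m j0) (z (ball u m j0))) with hy'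
    have ym : y' m = y j0 + HahnSeries.single (u m j0) (z (ball u m j0)) := by simp [hy']
    have yT : ∀ i ∈ T, y' i = y i := by
      intro i hi
      have : i ≠ m := fun e => hm (e ▸ hi)
      simp [hy', this]
    have main : ∀ i ∈ T, PM u z y' i m := by
      intro i hi
      have hmi : m ≠ i := fun e => hm (e ▸ hi)
      have L0 := lead_single (u m j0) (z (ball u m j0))
      by_cases hij : i = j0
      · subst hij
        refine ⟨1, ?_⟩
        rw [ym, yT i hi, add_sub_cancel_left, hs i m, ball_symm hs hu hmi.symm]
        simpa using L0
      obtain ⟨ε, hε⟩ := hy i hi j0 hj0 hij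
      have e : y' m - y' i = (y j0 - y i) + HahnSeries.single (u m j0) (z (ball u m j0)) := by
        rw [ym, yT i hi]; ring
      have tri := hu m i j0 hmi hmj0 hij
      have hle := hmax i hi
      unfold minExactlyTwice at tri
      unfold PM
      rw [e]
      rcases lt_or_eq_of_le hle with hlt | heq
      · have e1 : u i j0 = u i m := by have := hs m i; grind
        have e2 : ball u i j0 = ball u i m := ball_eq_of e1
        refine ⟨ε, ?_⟩
        rw [e1, e2] at hε
        apply hε.add_left L0
        rw [hs i m]; exact hlt
      · refine ⟨1, ?_⟩
        have e3 : ball u m j0 = ball u i m := by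
          rw [ball_symm hs hu hmi.symm]; exact ball_eq_of heq.symm
        have : u m j0 < u i j0 := by grind
        rw [add_comm]
        have := L0.add_left hε this
        rw [hs i m, heq, ← e3]
        simpa using this
    refine ⟨y', ?_⟩
    intro i hi j hj hij
    rw [Finset.mem_insert] at hi hj
    rcases hi with rfl | hi <;> rcases hj with rfl | hj
    · exact absurd rfl hij
    · exact (main j hj).symm hs hu hij.symm
    · exact main i hi
    · have := hy i hi j hj hij
      unfold PM at this ⊢
      rwa [yT i hi, yT j hj]

end PluckerAux

namespace PluckerAux

theorem coeff_initForm {σ k : Type*} [CommRing k] (w : σ → ℝ) (f : MvPolynomial σ k)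
    (b : σ →₀ ℕ) : coeff b (initForm w f) =
      if (∀ c ∈ f.support, expWeight w b ≤ expWeight w c) then coeff b f else 0 := by
  rw [initForm, coeff_sum]
  simp only [coeff_monomial]
  rw [Finset.sum_ite_eq']
  simp only [Finset.mem_filter, mem_support_iff]
  by_cases h : coeff b f = 0
  · simp [h]
  · simp [h]

theorem mem_initIdeal_of {σ k : Type*} [CommRing k] (w : σ → ℝ) (I : Ideal (MvPolynomial σ k))
    (g h : MvPolynomial σ k) (m : ℝ) (hg : ∀ a ∈ g.support, expWeight w a = m)
    (hh : ∀ a ∈ h.support, m < expWeight w a) (hI : g + h ∈ I) : g ∈ initIdeal w I := by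
  by_cases g0 : g = 0
  · rw [g0]; exact Ideal.zero_mem _
  apply Ideal.subset_span
  refine ⟨g + h, hI, ?_⟩
  have disj : ∀ a, coeff a g ≠ 0 → coeff a h = 0 := by
    intro a ha
    by_contra hb
    have := hg a (mem_support_iff.mpr ha)
    have := hh a (mem_support_iff.mpr hb)
    linarith
  obtain ⟨a0, ha0⟩ := ne_zero_iff.mp g0
  have ha0' : a0 ∈ (g + h).support := by
    rw [mem_support_iff, coeff_add, disj a0 ha0, add_zero]; exact ha0
  ext b
  rw [coeff_initForm, coeff_add]
  by_cases hb : coeff b g = 0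
  · rw [hb, zero_add]
    split_ifs with hc
    · by_contra hne
      have h1 := hh b (mem_support_iff.mpr (fun e => hne e.symm))
      have h2 := hc a0 ha0'
      have h3 := hg a0 (mem_support_iff.mpr ha0)
      linarith
    · rfl
  · rw [disj b hb, add_zero, if_pos]
    intro c hc
    rw [hg b (mem_support_iff.mpr hb)]
    rw [mem_support_iff, coeff_add] at hc
    by_cases h1 : coeff c g = 0
    · rw [h1, zero_add] at hc
      exact (hh c (mem_support_iff.mpr hc)).le
    · exact (hg c (mem_support_iff.mpr h1)).ge

/-- index type of the variables -/
abbrev Pt (n : ℕ) := {s : Finset (Fin n) // s.card = 2}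

def lo {n : ℕ} (S : Pt n) : Fin n := (S.1.orderIsoOfFin S.2 0 : S.1)
def hi {n : ℕ} (S : Pt n) : Fin n := (S.1.orderIsoOfFin S.2 1 : S.1)

theorem lo_lt_hi {n : ℕ} (S : Pt n) : lo S < hi S := by
  have : (S.1.orderIsoOfFin S.2 0) < (S.1.orderIsoOfFin S.2 1) := by simp
  exact this

theorem pr_lo_hi {n : ℕ} (S : Pt n) : pr (lo S) (hi S) (lo_lt_hi S).ne = S := by
  apply Subtype.ext
  apply Finset.eq_of_subset_of_card_le
  · intro x hx
    simp only [pr, Finset.mem_insert, Finset.mem_singleton] at hx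
    rcases hx with rfl | rfl
    · exact (S.1.orderIsoOfFin S.2 0).2
    · exact (S.1.orderIsoOfFin S.2 1).2
  · rw [S.2, (pr _ _ _).2]

theorem pr_symm {n : ℕ} {i j : Fin n} (h : i ≠ j) : pr i j h = pr j i h.symm := by
  apply Subtype.ext
  exact Finset.pair_comm i j

theorem lo_hi_pr {n : ℕ} {i j : Fin n} (h : i ≠ j) :
    (lo (pr i j h) = i ∧ hi (pr i j h) = j) ∨ (lo (pr i j h) = j ∧ hi (pr i j h) = i) := by
  have h1 := congrArg Subtype.val (pr_lo_hi (pr i j h))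
  have h2 := (lo_lt_hi (pr i j h)).ne
  change ({lo (pr i j h), hi (pr i j h)} : Finset (Fin n)) = {i, j} at h1
  generalize lo (pr i j h) = a at *
  generalize hi (pr i j h) = b at *
  have ha : a ∈ ({i, j} : Finset (Fin n)) := by rw [← h1]; simp
  have hb : b ∈ ({i, j} : Finset (Fin n)) := by rw [← h1]; simp
  simp at ha hb
  grind

theorem pluckerMap_X {k : Type*} [CommRing k] {n : ℕ} (S : Pt n) :
    pluckerMap k 2 n (X S) =
      X (0, lo S) * X (1, hi S) - X (0, hi S) * X (1, lo S) := by
  rw [pluckerMap, aeval_X, Matrix.det_fin_two]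
  rfl

theorem pluckerMap_pr {k : Type*} [CommRing k] {n : ℕ} {i j : Fin n} (h : i ≠ j) :
    ∃ ε : ℤˣ, pluckerMap k 2 n (X (pr i j h)) =
      ((ε : ℤ) : MvPolynomial (Fin 2 × Fin n) k) *
        (X (0, i) * X (1, j) - X (0, j) * X (1, i)) := by
  rw [pluckerMap_X]
  rcases lo_hi_pr h with ⟨h1, h2⟩ | ⟨h1, h2⟩ <;> rw [h1, h2]
  · exact ⟨1, by simp⟩
  · exact ⟨-1, by simp⟩

def Rel {σ k : Type*} [CommRing k] (Q : Ideal (MvPolynomial σ k)) (a b : σ →₀ ℕ) : Prop :=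
  ∃ ε : ℤˣ, monomial a (1 : k) - ((ε : ℤ) : MvPolynomial σ k) * monomial b 1 ∈ Q

theorem unit_sq {R : Type*} [CommRing R] (ε : ℤˣ) : ((ε : ℤ) : R) * ((ε : ℤ) : R) = 1 := by
  rcases Int.units_eq_one_or ε with rfl | rfl <;> simp

theorem Rel.refl {σ k : Type*} [CommRing k] (Q : Ideal (MvPolynomial σ k)) (a : σ →₀ ℕ) :
    Rel Q a a := ⟨1, by simp⟩

theorem Rel.symm {σ k : Type*} [CommRing k] {Q : Ideal (MvPolynomial σ k)} {a b : σ →₀ ℕ}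
    (h : Rel Q a b) : Rel Q b a := by
  obtain ⟨ε, h⟩ := h
  refine ⟨ε, ?_⟩
  have := Q.mul_mem_left (-((ε : ℤ) : MvPolynomial σ k)) h
  convert this using 1
  linear_combination (-monomial b (1 : k)) * unit_sq (R := MvPolynomial σ k) ε

theorem Rel.trans {σ k : Type*} [CommRing k] {Q : Ideal (MvPolynomial σ k)} {a b c : σ →₀ ℕ}
    (h : Rel Q a b) (h' : Rel Q b c) : Rel Q a c := by
  obtain ⟨ε, h⟩ := h
  obtain ⟨δ, h'⟩ := h'
  refine ⟨ε * δ, ?_⟩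
  have := Q.add_mem h (Q.mul_mem_left ((ε : ℤ) : MvPolynomial σ k) h')
  convert this using 1
  push_cast
  ring

theorem Rel.add {σ k : Type*} [CommRing k] {Q : Ideal (MvPolynomial σ k)} {a b : σ →₀ ℕ}
    (h : Rel Q a b) (c : σ →₀ ℕ) : Rel Q (c + a) (c + b) := by
  obtain ⟨ε, h⟩ := h
  refine ⟨ε, ?_⟩
  have := Q.mul_mem_left (monomial c (1 : k)) h
  convert this using 1
  have e : ∀ d : σ →₀ ℕ, (monomial (c + d) (1 : k)) = monomial c 1 * monomial d 1 := by
    intro d; rw [monomial_mul, one_mul]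
  rw [e, e]; ring

noncomputable def two {σ : Type*} (S T : σ) : σ →₀ ℕ := Finsupp.single S 1 + Finsupp.single T 1

theorem monomial_two {σ k : Type*} [CommRing k] (S T : σ) :
    monomial (two S T) (1 : k) = X S * X T := by
  rw [two, ← one_mul (1 : k), ← monomial_mul]; simp [X]

theorem expWeight_two {σ : Type*} (w : σ → ℝ) (S T : σ) :
    expWeight w (two S T) = w S + w T := by
  unfold expWeight two
  rw [Finsupp.sum_add_index']
  · simp
  · simp
  · intros; push_cast; ring

theorem support_unit_mul {σ k : Type*} [CommRing k] (c : ℤ) (a : σ →₀ ℕ) (b : σ →₀ ℕ)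
    (h : b ∈ (((c : ℤ) : MvPolynomial σ k) * monomial a 1).support) : b = a := by
  have e : (((c : ℤ) : MvPolynomial σ k) * monomial a 1) = monomial a (c : k) := by
    have : ((c : ℤ) : MvPolynomial σ k) = C (c : k) := by simp
    rw [this, C_mul_monomial, mul_one]
  rw [e] at h
  have := support_monomial_subset h
  simpa using this

theorem move {k : Type*} [CommRing k] {n : ℕ} (w : Pt n → ℝ) {i j l m : Fin n}
    (hij : i ≠ j) (hil : i ≠ l) (him : i ≠ m) (hjl : j ≠ l) (hjm : j ≠ m) (hlm : l ≠ m)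
    (h1 : w (pr i l hil) + w (pr j m hjm) = w (pr i m him) + w (pr j l hjl))
    (h2 : w (pr i l hil) + w (pr j m hjm) < w (pr i j hij) + w (pr l m hlm)) :
    Rel (initIdeal w (pluckerIdeal k 2 n)) (two (pr i l hil) (pr j m hjm))
      (two (pr i m him) (pr j l hjl)) := by
  obtain ⟨a1, e1⟩ := pluckerMap_pr (k := k) hil
  obtain ⟨a2, e2⟩ := pluckerMap_pr (k := k) hjm
  obtain ⟨b1, f1⟩ := pluckerMap_pr (k := k) him
  obtain ⟨b2, f2⟩ := pluckerMap_pr (k := k) hjl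
  obtain ⟨c1, g1⟩ := pluckerMap_pr (k := k) hij
  obtain ⟨c2, g2⟩ := pluckerMap_pr (k := k) hlm
  refine ⟨a1 * a2 * b1 * b2, ?_⟩
  set A := two (pr i l hil) (pr j m hjm) with hA
  set B := two (pr i m him) (pr j l hjl) with hB
  set D := two (pr i j hij) (pr l m hlm) with hD
  apply mem_initIdeal_of w _ _
    ((((-(a1 * a2 * c1 * c2) : ℤˣ) : ℤ) : MvPolynomial (Pt n) k) * monomial D (1 : k)) (w (pr i l hil) + w (pr j m hjm))
  · intro a ha
    have := support_sub _ _ _ ha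
    rw [Finset.mem_union] at this
    rcases this with h | h
    · have := support_monomial_subset h
      simp only [Finset.mem_singleton] at this
      rw [this, hA, expWeight_two]
    · rw [support_unit_mul _ _ _ h, hB, expWeight_two, h1]
  · intro a ha
    rw [support_unit_mul _ _ _ ha, hD, expWeight_two]
    exact h2
  · rw [pluckerIdeal, RingHom.mem_ker, hA, hB, hD, monomial_two, monomial_two, monomial_two]
    simp only [map_add, map_sub, map_mul, map_neg, map_intCast, e1, e2, f1, f2, g1, g2, Units.val_mul,
      Units.val_neg, Int.cast_mul, Int.cast_neg]
    have ub1 := unit_sq (R := MvPolynomial (Fin 2 × Fin n) k) b1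
    have ub2 := unit_sq (R := MvPolynomial (Fin 2 × Fin n) k) b2
    have uc1 := unit_sq (R := MvPolynomial (Fin 2 × Fin n) k) c1
    have uc2 := unit_sq (R := MvPolynomial (Fin 2 × Fin n) k) c2
    generalize (((b1 : ℤˣ) : ℤ) : MvPolynomial (Fin 2 × Fin n) k) = b1 at *
    generalize (((b2 : ℤˣ) : ℤ) : MvPolynomial (Fin 2 × Fin n) k) = b2 at *
    generalize (((c1 : ℤˣ) : ℤ) : MvPolynomial (Fin 2 × Fin n) k) = c1 at *
    generalize (((c2 : ℤˣ) : ℤ) : MvPolynomial (Fin 2 × Fin n) k) = c2 at *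
    generalize (((a1 : ℤˣ) : ℤ) : MvPolynomial (Fin 2 × Fin n) k) = a1 at *
    generalize (((a2 : ℤˣ) : ℤ) : MvPolynomial (Fin 2 × Fin n) k) = a2 at *
    have hb : b1 * b1 * (b2 * b2) = 1 := by rw [ub1, ub2, one_mul]
    have hc : c1 * c1 * (c2 * c2) = 1 := by rw [uc1, uc2, one_mul]
    linear_combination
      (-(a1 * a2) * (X (0, i) * X (1, m) - X (0, m) * X (1, i)) *
        (X (0, j) * X (1, l) - X (0, l) * X (1, j))) * hb -
      (a1 * a2) * (X (0, i) * X (1, j) - X (0, j) * X (1, i)) *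
        (X (0, l) * X (1, m) - X (0, m) * X (1, l)) * hc

end PluckerAux

namespace PluckerAux

noncomputable def ev {n : ℕ} (u : Fin n → Fin n → ℝ) (S : Pt n) : Fin n ⊕ Finset (Fin n) →₀ ℕ :=
  Finsupp.single (Sum.inl (lo S)) 1 + Finsupp.single (Sum.inl (hi S)) 1 +
    Finsupp.single (Sum.inr (ball u (lo S) (hi S))) 1

theorem ev_inl {n : ℕ} (u : Fin n → Fin n → ℝ) (S : Pt n) (i : Fin n) :
    ev u S (Sum.inl i) ≠ 0 ↔ (lo S = i ∨ hi S = i) := by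
  simp only [ev, Finsupp.add_apply, Finsupp.single_apply, Sum.inl.injEq, reduceCtorEq, if_false]
  split_ifs <;> simp_all

theorem ev_inr {n : ℕ} (u : Fin n → Fin n → ℝ) (S : Pt n) (B : Finset (Fin n)) :
    ev u S (Sum.inr B) ≠ 0 ↔ ball u (lo S) (hi S) = B := by
  simp only [ev, Finsupp.add_apply, Finsupp.single_apply, Sum.inr.injEq, reduceCtorEq, if_false]
  split_ifs <;> simp_all

noncomputable def EE {n : ℕ} (u : Fin n → Fin n → ℝ) :
    (Pt n →₀ ℕ) →ₗ[ℕ] (Fin n ⊕ Finset (Fin n) →₀ ℕ) :=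
  Finsupp.linearCombination ℕ (ev u)

theorem EE_single {n : ℕ} (u : Fin n → Fin n → ℝ) (S : Pt n) :
    EE u (Finsupp.single S 1) = ev u S := by
  simp [EE]

theorem EE_ne {n : ℕ} (u : Fin n → Fin n → ℝ) (a : Pt n →₀ ℕ) (x : Fin n ⊕ Finset (Fin n)) :
    EE u a x ≠ 0 ↔ ∃ S ∈ a.support, ev u S x ≠ 0 := by
  rw [EE, Finsupp.linearCombination_apply, Finsupp.sum, Finsupp.finsetSum_apply, Ne,
    Finset.sum_eq_zero_iff]
  push Not
  constructor
  · rintro ⟨S, hS, h⟩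
    refine ⟨S, hS, fun h0 => h ?_⟩
    simp [h0]
  · rintro ⟨S, hS, h⟩
    refine ⟨S, hS, ?_⟩
    rw [Finsupp.smul_apply, smul_eq_mul]
    exact mul_ne_zero (Finsupp.mem_support_iff.mp hS) h

theorem exists_edge {n : ℕ} {u : Fin n → Fin n → ℝ} {a b : Pt n →₀ ℕ} (hab : EE u a = EE u b)
    {i j : Fin n} (hij : i ≠ j) (h : pr i j hij ∈ a.support) :
    ∃ (x : Fin n) (hx : i ≠ x), pr i x hx ∈ b.support := by
  have h1 : EE u a (Sum.inl i) ≠ 0 := by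
    rw [EE_ne]
    refine ⟨_, h, ?_⟩
    rw [ev_inl]
    rcases lo_hi_pr hij with h | h <;> simp [h]
  rw [hab, EE_ne] at h1
  obtain ⟨S, hS, h2⟩ := h1
  rw [ev_inl] at h2
  have h3 := pr_lo_hi S
  rcases h2 with h2 | h2
  · refine ⟨hi S, by rw [← h2]; exact (lo_lt_hi S).ne, ?_⟩
    simp only [← h2]; rw [h3]; exact hS
  · refine ⟨lo S, by rw [← h2]; exact (lo_lt_hi S).ne', ?_⟩
    simp only [← h2]; rw [pr_symm, h3]; exact hS

theorem ball_pr {n : ℕ} {u : Fin n → Fin n → ℝ} (hs : ∀ i j, u i j = u j i) (hu : SUM u)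
    {i j : Fin n} (hij : i ≠ j) :
    ball u (lo (pr i j hij)) (hi (pr i j hij)) = ball u i j := by
  rcases lo_hi_pr hij with h | h
  · rw [h.1, h.2]
  · rw [h.1, h.2, ball_symm hs hu hij]

theorem exists_ball {n : ℕ} {u : Fin n → Fin n → ℝ} (hs : ∀ i j, u i j = u j i) (hu : SUM u)
    {a b : Pt n →₀ ℕ} (hab : EE u a = EE u b)
    {i j : Fin n} (hij : i ≠ j) (h : pr i j hij ∈ a.support) :
    ∃ (x y : Fin n) (hx : x ≠ y), pr x y hx ∈ b.support ∧ ball u i j = ball u x y := by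
  have h1 : EE u a (Sum.inr (ball u i j)) ≠ 0 := by
    rw [EE_ne]
    refine ⟨_, h, ?_⟩
    rw [ev_inr, ball_pr hs hu]
  rw [hab, EE_ne] at h1
  obtain ⟨S, hS, h2⟩ := h1
  rw [ev_inr] at h2
  exact ⟨lo S, hi S, (lo_lt_hi S).ne, by rw [pr_lo_hi]; exact hS, h2.symm⟩

theorem swap_in {σ k : Type*} [CommRing k] {Q : Ideal (MvPolynomial σ k)} {b : σ →₀ ℕ}
    {S T S' T' : σ} (hS : S ∈ b.support) (hT : T ∈ b.support) (hne : S ≠ T)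
    (h : Rel Q (two S T) (two S' T')) : ∃ b', Rel Q b b' ∧ S' ∈ b'.support := by
  have hle : two S T ≤ b := by
    intro x
    simp only [two, Finsupp.add_apply, Finsupp.single_apply]
    rw [Finsupp.mem_support_iff] at hS hT
    by_cases h1 : S = x
    · subst h1
      rw [if_pos rfl, if_neg hne.symm]; omega
    · by_cases h2 : T = x
      · subst h2
        rw [if_neg hne, if_pos rfl]; omega
      · simp [h1, h2]
  obtain ⟨c, rfl⟩ := exists_add_of_le hle
  refine ⟨c + two S' T', ?_, ?_⟩
  · rw [add_comm]; exact h.add c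
  · rw [Finsupp.mem_support_iff]
    simp [two]

/-- hypothesis bundle: exchange moves hold in `Q` -/
def Moves {n : ℕ} {k : Type*} [CommRing k] (u : Fin n → Fin n → ℝ)
    (Q : Ideal (MvPolynomial (Pt n) k)) : Prop :=
  ∀ (i j l m : Fin n) (hij : i ≠ j) (hil : i ≠ l) (him : i ≠ m) (hjl : j ≠ l) (hjm : j ≠ m)
    (hlm : l ≠ m), u i l + u j m = u i m + u j l → u i l + u j m < u i j + u l m →
    Rel Q (two (pr i l hil) (pr j m hjm)) (two (pr i m him) (pr j l hjl))

theorem ne_pr_of {n : ℕ} {i x k l : Fin n} (hix : i ≠ x) (hkl : k ≠ l) (h1 : i ≠ k) (h2 : i ≠ l) :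
    pr i x hix ≠ pr k l hkl := by
  intro h
  have := congrArg Subtype.val h
  simp only [pr] at this
  have : i ∈ ({k, l} : Finset (Fin n)) := by rw [← this]; simp
  simp at this
  tauto

theorem stepA {n : ℕ} {k : Type*} [CommRing k] {u : Fin n → Fin n → ℝ}
    (hs : ∀ i j, u i j = u j i) (hu : SUM u) {Q : Ideal (MvPolynomial (Pt n) k)}
    (hm : Moves u Q) {a b : Pt n →₀ ℕ} (hab : EE u a = EE u b) {i j : Fin n} (hij : i ≠ j)
    (h : pr i j hij ∈ a.support)
    (hmax : ∀ x y (hxy : x ≠ y), pr x y hxy ∈ b.support → u x y ≤ u i j)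
    {p l : Fin n} (hpl : p ≠ l) (hb : pr p l hpl ∈ b.support) (e : u p l = u i j)
    (hp : p = i ∨ u i j < u i p) (hl : l = j ∨ u i j < u j l) :
    ∃ b', Rel Q b b' ∧ ∃ (l : Fin n) (hil : i ≠ l), pr i l hil ∈ b'.support ∧ u i l = u i j ∧
      (l = j ∨ u i j < u j l) := by
  by_cases hpi : p = i
  · subst hpi
    exact ⟨b, Rel.refl _ _, l, hpl, hb, e, hl⟩
  have hp : u i j < u i p := by tauto
  obtain ⟨x, hix, hx⟩ := exists_edge hab hij h
  have hxle := hmax _ _ hix hx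
  have T : ∀ y, i ≠ y → j ≠ y → minExactlyTwice (u i j) (u i y) (u j y) :=
    fun y h1 h2 => hu i j y hij h1 h2
  by_cases hxB : x = j ∨ u i j < u j x
  · refine ⟨b, Rel.refl _ _, x, hix, hx, ?_, hxB⟩
    by_cases hxj : x = j
    · rw [hxj]
    · have := T x hix (Ne.symm hxj)
      unfold minExactlyTwice at this
      grind
  have hxj : x ≠ j := by tauto
  have hjx : u j x ≤ u i j := by
    by_contra hh; exact hxB (Or.inr (not_le.mp hh))
  have hxp : p ≠ x := by rintro rfl; linarith
  have hxl : l ≠ x := by rintro rfl; rcases hl with hl | hl; exact hxj hl; linarith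
  have hil : i ≠ l := by
    rintro rfl
    rcases hl with hl | hl
    · exact hij hl
    · rw [hs j i] at hl; exact lt_irrefl _ hl
  have t1 := hu i j x hij hix hxj.symm
  have t2 := hu i p x (Ne.symm hpi) hix hxp
  have t3 := hu i p l (Ne.symm hpi) hil hpl
  unfold minExactlyTwice at t1 t2 t3
  have q1 : u i x = u j x ∧ u i x < u i j := by grind
  have q2 : u p x = u i x := by grind
  have q3 : u i l = u i j := by grind
  have q4 : u l x = u i x := by
    by_cases hlj : l = j
    · rw [hlj]; exact q1.1.symm
    · have hl : u i j < u j l := by tauto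
      have t4 := hu j l x (Ne.symm hlj) hxj.symm hxl
      unfold minExactlyTwice at t4
      grind
  have mv := hm i p x l (Ne.symm hpi) hix hil hxp hpl hxl.symm (by rw [q2, q3, e]; ring)
    (by rw [hs x l, q4, e]; linarith)
  obtain ⟨b', hb', hmem⟩ := swap_in hx hb (ne_pr_of hix hpl (Ne.symm hpi) hil) mv
  exact ⟨b', hb', l, hil, hmem, q3, hl⟩

theorem stepB {n : ℕ} {k : Type*} [CommRing k] {u : Fin n → Fin n → ℝ}
    (hs : ∀ i j, u i j = u j i) (hu : SUM u) {Q : Ideal (MvPolynomial (Pt n) k)}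
    (hm : Moves u Q) {a b : Pt n →₀ ℕ} (hab : EE u a = EE u b) {i j : Fin n} (hij : i ≠ j)
    (h : pr i j hij ∈ a.support)
    (hmax : ∀ x y (hxy : x ≠ y), pr x y hxy ∈ b.support → u x y ≤ u i j)
    {l : Fin n} (hil : i ≠ l) (hb : pr i l hil ∈ b.support) (e : u i l = u i j)
    (hl : l = j ∨ u i j < u j l) :
    ∃ b', Rel Q b b' ∧ pr i j hij ∈ b'.support := by
  by_cases hlj : l = j
  · subst hlj; exact ⟨b, Rel.refl _ _, hb⟩
  have hl : u i j < u j l := by tauto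
  rw [pr_symm] at h
  obtain ⟨y, hjy, hy⟩ := exists_edge hab hij.symm h
  by_cases hyi : y = i
  · subst hyi
    rw [pr_symm] at hy
    exact ⟨b, Rel.refl _ _, hy⟩
  have hyle := hmax _ _ hjy hy
  have hly : l ≠ y := by rintro rfl; linarith
  have t1 := hu j l y (Ne.symm hlj) hjy hly
  have t2 := hu i j y hij (Ne.symm hyi) hjy
  unfold minExactlyTwice at t1 t2
  have q1 : u l y = u j y := by grind
  have q2 : u j y ≤ u i y := by grind
  have mv := hm l j i y hlj hil.symm hly hij.symm hjy (Ne.symm hyi)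
    (by rw [hs l i, e, q1, hs j i]; ring) (by rw [hs l i, e, hs l j]; linarith)
  have mv' : Rel Q (two (pr i l hil) (pr j y hjy)) (two (pr i j hij) (pr l y hly)) := by
    unfold two at mv ⊢
    rw [pr_symm hil, pr_symm hij, add_comm (Finsupp.single (pr j i hij.symm) 1)]
    exact mv
  refine swap_in hb hy ?_ mv'
  exact ne_pr_of hil hjy hij (Ne.symm hyi)

theorem connect {n : ℕ} {k : Type*} [CommRing k] {u : Fin n → Fin n → ℝ}
    (hs : ∀ i j, u i j = u j i) (hu : SUM u) {Q : Ideal (MvPolynomial (Pt n) k)}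
    (hm : Moves u Q) (hQ : ∀ a b, Rel Q a b → EE u a = EE u b) (N : ℕ) :
    ∀ a b : Pt n →₀ ℕ, a.degree = N → EE u a = EE u b → Rel Q a b := by
  induction N with
  | zero =>
    intro a b ha hab
    rw [Finsupp.degree_eq_zero_iff] at ha
    subst ha
    have : b = 0 := by
      by_contra hb
      obtain ⟨S, hS⟩ := Finsupp.support_nonempty_iff.mpr hb
      have : EE u b (Sum.inl (lo S)) ≠ 0 := by
        rw [EE_ne]; exact ⟨S, hS, by rw [ev_inl]; simp⟩
      rw [← hab] at this
      simp at this
    rw [this]; exact Rel.refl _ _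
  | succ N ih =>
    intro a b ha hab
    have hne : a.support.Nonempty := by
      rw [Finsupp.support_nonempty_iff]; rintro rfl; simp at ha
    obtain ⟨S, hS, hSmax⟩ := Finset.exists_max_image a.support (fun S => u (lo S) (hi S)) hne
    have hij := (lo_lt_hi S).ne
    have hSp := pr_lo_hi S
    have hS' : pr (lo S) (hi S) hij ∈ a.support := by rw [hSp]; exact hS
    have hmax : ∀ b, EE u a = EE u b → ∀ x y (hxy : x ≠ y), pr x y hxy ∈ b.support →
        u x y ≤ u (lo S) (hi S) := by
      intro b hab x y hxy hb
      obtain ⟨x', y', hxy', hmem, hball⟩ := exists_ball hs hu hab.symm hxy hb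
      have := (ball_inj hs hu hxy hxy' hball).1
      rw [← this]
      have h2 := hSmax _ hmem
      rcases lo_hi_pr hxy' with h3 | h3
      · simpa [h3] using h2
      · rw [hs x' y']; simpa [h3] using h2
    obtain ⟨p, l, hpl, hmem, hball⟩ := exists_ball hs hu hab hij hS'
    obtain ⟨e, hc⟩ := ball_inj hs hu hij hpl hball
    have A : ∃ b', Rel Q b b' ∧ ∃ (l : Fin n) (hil : lo S ≠ l), pr (lo S) l hil ∈ b'.support ∧
        u (lo S) l = u (lo S) (hi S) ∧ (l = hi S ∨ u (lo S) (hi S) < u (hi S) l) := by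
      rcases hc with ⟨h1, h2⟩ | ⟨h1, h2⟩
      · exact stepA hs hu hm hab hij hS' (hmax b hab) hpl hmem e h1 h2
      · exact stepA hs hu hm hab hij hS' (hmax b hab) hpl.symm (by rw [pr_symm]; exact hmem)
          (by rw [hs l p]; exact e) h1 h2
    obtain ⟨b1, r1, l', hil, hmem1, e1, hl1⟩ := A
    have hab1 := hab.trans (hQ _ _ r1)
    obtain ⟨b2, r2, hmem2⟩ := stepB hs hu hm hab1 hij hS' (hmax b1 hab1) hil hmem1 e1 hl1
    have hab2 := hab1.trans (hQ _ _ r2)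
    rw [hSp] at hmem2
    have le : ∀ c : Pt n →₀ ℕ, S ∈ c.support → Finsupp.single S 1 ≤ c := by
      intro c hc
      rw [Finsupp.single_le_iff]
      exact Nat.one_le_iff_ne_zero.mpr (Finsupp.mem_support_iff.mp hc)
    obtain ⟨a', rfl⟩ := exists_add_of_le (le a hS)
    obtain ⟨b', rfl⟩ := exists_add_of_le (le b2 hmem2)
    have hd : a'.degree = N := by
      rw [map_add, Finsupp.degree_single] at ha; omega
    have hE : EE u a' = EE u b' := by
      rw [map_add, map_add] at hab2
      exact add_left_cancel hab2
    exact ((ih a' b' hd hE).add _).trans (r1.trans r2).symm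

end PluckerAux

namespace PluckerAux

noncomputable def WW {n : ℕ} (w : Pt n → ℝ) (i j : Fin n) : ℝ :=
  if h : i ≠ j then w (pr i j h) else 0

theorem WW_symm {n : ℕ} (w : Pt n → ℝ) (i j : Fin n) : WW w i j = WW w j i := by
  unfold WW
  by_cases h : i = j
  · subst h; rfl
  · have h' : j ≠ i := Ne.symm h
    rw [dif_pos h, dif_pos h', pr_symm]

theorem WW_pr {n : ℕ} (w : Pt n → ℝ) {i j : Fin n} (h : i ≠ j) : w (pr i j h) = WW w i j := by
  unfold WW; rw [dif_pos h]

theorem exists_u {n : ℕ} (hn : 4 ≤ n) (w : Pt n → ℝ) (hw : StrictFourPoint w) :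
    ∃ (u : Fin n → Fin n → ℝ) (c : Fin n → ℝ), (∀ i j, u i j = u j i) ∧ SUM u ∧
      ∀ i j (h : i ≠ j), w (pr i j h) = u i j + c i + c j := by
  obtain ⟨r, hr⟩ : ∃ r : Fin n, ∀ i, i ≠ r → i < r := by
    refine ⟨⟨n - 1, by omega⟩, fun i hi => ?_⟩
    rw [Ne, Fin.ext_iff] at hi
    rw [Fin.lt_def]
    have := i.2
    simp at hi ⊢
    omega
  obtain ⟨C, hC⟩ : ∃ C : ℝ, ∀ i j, WW w i r + WW w j r - WW w i j < C := by
    obtain ⟨C, hC⟩ := (Set.finite_range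
      (fun p : Fin n × Fin n => WW w p.1 r + WW w p.2 r - WW w p.1 p.2)).bddAbove
    refine ⟨C + 1, fun i j => ?_⟩
    have := hC ⟨(i, j), rfl⟩
    simp only at this
    linarith
  have S := WW_symm w
  have F0 : ∀ i j k, i < j → j < k → k < r → minExactlyTwice (WW w i j + WW w k r)
      (WW w i k + WW w j r) (WW w i r + WW w j k) := by
    intro i j k hij hjk hkr
    have := hw i j k r hij hjk hkr
    simpa only [WW_pr] using this
  have F : ∀ i j k, i ≠ j → i ≠ k → j ≠ k → i ≠ r → j ≠ r → k ≠ r →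
      minExactlyTwice (WW w i j + WW w k r) (WW w i k + WW w j r) (WW w i r + WW w j k) := by
    intro i j k hij hik hjk hi hj hk
    have hi := hr i hi
    have hj := hr j hj
    have hk := hr k hk
    have s1 := S i j
    have s2 := S i k
    have s3 := S j k
    unfold minExactlyTwice at F0 ⊢
    rcases lt_or_gt_of_ne hij with a | a <;> rcases lt_or_gt_of_ne hik with b | b <;>
      rcases lt_or_gt_of_ne hjk with d | d
    · have := F0 i j k a d hk; grind
    · have := F0 i k j b d hj; grind
    · exact absurd (a.trans (d.trans b)) (lt_irrefl _)
    · have := F0 k i j b a hj; grind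
    · have := F0 j i k a b hk; grind
    · exact absurd (a.trans (b.trans d)) (lt_irrefl _)
    · have := F0 j k i d b hi; grind
    · have := F0 k j i d a hi; grind
  refine ⟨fun i j => if i = r ∨ j = r then 0 else WW w i j - WW w i r - WW w j r + C,
    fun i => if i = r then C / 2 else WW w i r - C / 2, ?_, ?_, ?_⟩
  · intro i j
    have := S i j
    by_cases hi : i = r <;> by_cases hj : j = r <;> simp [hi, hj]
    rw [S i j]; ring
  · intro i j k hij hik hjk
    have c1 := hC i j
    have c2 := hC i k
    have c3 := hC j k
    have f := F i j k hij hik hjk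
    unfold minExactlyTwice at f ⊢
    by_cases hi : i = r
    · subst hi
      simp only [true_or, if_true, hij.symm, hik.symm, or_self, if_false]
      left; exact ⟨trivial, by linarith⟩
    by_cases hj : j = r
    · subst hj
      simp only [or_true, true_or, if_true, hij, hjk.symm, or_self, if_false]
      right; left; exact ⟨trivial, by linarith⟩
    by_cases hk : k = r
    · subst hk
      simp only [or_true, if_true, hik, hjk, or_self, if_false]
      right; right; exact ⟨trivial, by linarith⟩
    have f := f hi hj hk
    simp only [hi, hj, hk, or_self, if_false]
    rcases f with f | f | f
    · left; constructor <;> linarith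
    · right; left; constructor <;> linarith
    · right; right; constructor <;> linarith
  · intro i j h
    rw [WW_pr w h]
    by_cases hi : i = r
    · subst hi
      simp only [true_or, if_true, h.symm, if_false]
      rw [S]; ring
    by_cases hj : j = r
    · subst hj
      simp only [or_true, if_true, h, if_false]
      ring
    simp only [hi, hj, or_self, if_false]
    ring

theorem psi_monomial {k : Type*} [CommRing k] {n : ℕ} (u : Fin n → Fin n → ℝ)
    (ψ : MvPolynomial (Pt n) k →ₐ[k] MvPolynomial (Fin n ⊕ Finset (Fin n)) k) (ε : Pt n → ℤˣ)
    (hψ : ∀ S, ψ (X S) = (((ε S : ℤˣ) : ℤ) : MvPolynomial _ k) * monomial (ev u S) 1)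
    (a : Pt n →₀ ℕ) :
    ∃ δ : ℤˣ, ψ (monomial a 1) = ((δ : ℤ) : MvPolynomial _ k) * monomial (EE u a) 1 := by
  induction a using Finsupp.induction_linear with
  | zero => exact ⟨1, by simp⟩
  | add a b ha hb =>
    obtain ⟨d, hd⟩ := ha
    obtain ⟨d', hd'⟩ := hb
    refine ⟨d * d', ?_⟩
    rw [← one_mul (1 : k), ← monomial_mul, map_mul, hd, hd', map_add, ← monomial_mul]
    push_cast; ring
  | single S m =>
    refine ⟨ε S ^ m, ?_⟩
    have e : EE u (Finsupp.single S m) = m • ev u S := by simp [EE]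
    rw [← X_pow_eq_monomial, map_pow, hψ, mul_pow, monomial_pow, e, one_pow]
    push_cast; rfl

theorem ker_le {k : Type*} [Field k] {n : ℕ} (u : Fin n → Fin n → ℝ)
    (ψ : MvPolynomial (Pt n) k →ₐ[k] MvPolynomial (Fin n ⊕ Finset (Fin n)) k)
    (hψ : ∀ a, ∃ δ : ℤˣ, ψ (monomial a 1) = ((δ : ℤ) : MvPolynomial _ k) * monomial (EE u a) 1)
    (Q : Ideal (MvPolynomial (Pt n) k)) (hQ : ∀ f ∈ Q, ψ f = 0)
    (hrel : ∀ a b, EE u a = EE u b → Rel Q a b) (N : ℕ) :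
    ∀ f : MvPolynomial (Pt n) k, f.support.card ≤ N → ψ f = 0 → f ∈ Q := by
  have hc : ∀ (δ : ℤˣ), ((δ : ℤ) : k) ≠ 0 := fun δ h => by
    have := unit_sq (R := k) δ
    rw [h, zero_mul] at this
    exact zero_ne_one this
  have hψ' : ∀ (a : Pt n →₀ ℕ) (c : k), ∃ δ : ℤˣ,
      ψ (monomial a c) = monomial (EE u a) (((δ : ℤ) : k) * c) := by
    intro a c
    obtain ⟨δ, h⟩ := hψ a
    refine ⟨δ, ?_⟩
    have e : monomial a c = C c * monomial a 1 := by rw [C_mul_monomial, mul_one]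
    have e2 : ((δ : ℤ) : MvPolynomial (Fin n ⊕ Finset (Fin n)) k) = C ((δ : ℤ) : k) := by simp
    have e3 : ψ (C c) = C c := ψ.commutes c
    rw [e, map_mul, h, e2, e3, C_mul_monomial, C_mul_monomial, mul_one, mul_comm]
  induction N with
  | zero =>
    intro f hf _
    have : f = 0 := by
      rw [← support_eq_empty, ← Finset.card_eq_zero]; omega
    rw [this]; exact Q.zero_mem
  | succ N ih =>
    intro f hf hf0
    by_cases hz : f = 0
    · rw [hz]; exact Q.zero_mem
    obtain ⟨a, ha⟩ := Finset.nonempty_iff_ne_empty.mpr (fun h => hz (support_eq_empty.mp h))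
    obtain ⟨b, hb, hba, hE⟩ : ∃ b ∈ f.support, b ≠ a ∧ EE u b = EE u a := by
      by_contra hno
      push Not at hno
      have h1 : coeff (EE u a) (ψ f) = 0 := by rw [hf0, coeff_zero]
      obtain ⟨δ, hδ⟩ := hψ' a (coeff a f)
      conv at h1 => lhs; rw [f.as_sum]
      rw [map_sum, coeff_sum, Finset.sum_eq_single a, hδ, coeff_monomial, if_pos rfl] at h1
      · exact mul_ne_zero (hc δ) (mem_support_iff.mp ha) h1
      · intro b hb hne
        obtain ⟨δ', hδ'⟩ := hψ' b (coeff b f)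
        rw [hδ', coeff_monomial, if_neg (hno b hb hne)]
      · intro h; exact absurd ha h
    obtain ⟨δ, hr⟩ := hrel a b hE.symm
    have hg : C (coeff a f) * (monomial a (1 : k) - ((δ : ℤ) : MvPolynomial (Pt n) k) *
      monomial b 1) ∈ Q := Q.mul_mem_left _ hr
    set t := C (coeff a f) * (monomial a (1 : k) - ((δ : ℤ) : MvPolynomial (Pt n) k) *
      monomial b 1) with ht
    have ht' : t = monomial a (coeff a f) - monomial b (coeff a f * ((δ : ℤ) : k)) := by
      have e2 : ((δ : ℤ) : MvPolynomial (Pt n) k) = C ((δ : ℤ) : k) := by simp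
      rw [ht, e2, mul_sub, C_mul_monomial, C_mul_monomial, C_mul_monomial, mul_one, mul_one]
    have hs : (f - t).support ⊆ f.support.erase a := by
      intro x hx
      rw [mem_support_iff, coeff_sub, ht', coeff_sub, coeff_monomial, coeff_monomial] at hx
      rw [Finset.mem_erase, mem_support_iff]
      constructor
      · rintro rfl
        rw [if_pos rfl, if_neg hba] at hx
        simp at hx
      · intro h0
        by_cases hxa : a = x
        · subst hxa; exact mem_support_iff.mp ha h0
        by_cases hxb : b = x
        · subst hxb; exact mem_support_iff.mp hb h0
        rw [if_neg hxa, if_neg hxb, h0] at hx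
        simp at hx
    have hcard : (f - t).support.card ≤ N := by
      have := Finset.card_le_card hs
      rw [Finset.card_erase_of_mem ha] at this
      omega
    have h2 : f - t ∈ Q := ih _ hcard (by rw [map_sub, hf0, hQ t hg, sub_zero])
    have := Q.add_mem h2 hg
    rwa [sub_add_cancel] at this

theorem rel_EE {k : Type*} [Field k] {n : ℕ} (u : Fin n → Fin n → ℝ)
    (ψ : MvPolynomial (Pt n) k →ₐ[k] MvPolynomial (Fin n ⊕ Finset (Fin n)) k)
    (hψ : ∀ a, ∃ δ : ℤˣ, ψ (monomial a 1) = ((δ : ℤ) : MvPolynomial _ k) * monomial (EE u a) 1)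
    (Q : Ideal (MvPolynomial (Pt n) k)) (hQ : ∀ f ∈ Q, ψ f = 0) (a b : Pt n →₀ ℕ)
    (h : Rel Q a b) : EE u a = EE u b := by
  obtain ⟨ε, h⟩ := h
  have h1 := hQ _ h
  obtain ⟨δ, hδ⟩ := hψ a
  obtain ⟨δ', hδ'⟩ := hψ b
  rw [map_sub, map_mul, map_intCast, hδ, hδ'] at h1
  by_contra hne
  have e : ∀ c : ℤ, (c : MvPolynomial (Fin n ⊕ Finset (Fin n)) k) = C (c : k) := by simp
  have h2 := congrArg (coeff (EE u a)) h1
  rw [e, e, e, coeff_sub, coeff_C_mul, coeff_C_mul, coeff_C_mul, coeff_monomial, coeff_monomial,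
    if_pos rfl, if_neg (Ne.symm hne), coeff_zero] at h2
  have := unit_sq (R := k) δ
  simp only [mul_one, mul_zero, sub_zero] at h2
  rw [h2, zero_mul] at this
  exact zero_ne_one this

theorem exists_psi {k : Type*} [Field k] {n : ℕ} (w : Pt n → ℝ) (u : Fin n → Fin n → ℝ)
    (c : Fin n → ℝ) (hs : ∀ i j, u i j = u j i) (hu : SUM u)
    (hc : ∀ i j (h : i ≠ j), w (pr i j h) = u i j + c i + c j) :
    ∃ (ψ : MvPolynomial (Pt n) k →ₐ[k] MvPolynomial (Fin n ⊕ Finset (Fin n)) k) (ε : Pt n → ℤˣ),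
    (∀ S, ψ (X S) = (((ε S : ℤˣ) : ℤ) : MvPolynomial _ k) * monomial (ev u S) 1) ∧
    ∀ f ∈ pluckerIdeal k 2 n, ψ (initForm w f) = 0 := by
  obtain ⟨y, hy⟩ := exists_real (R := MvPolynomial (Fin n ⊕ Finset (Fin n)) k) hs hu
    (fun B => X (Sum.inr B)) Finset.univ
  have hy' : ∀ S : Pt n, PM u (fun B => X (Sum.inr B)) y (lo S) (hi S) := fun S =>
    hy _ (Finset.mem_univ _) _ (Finset.mem_univ _) (lo_lt_hi S).ne
  unfold PM at hy'
  choose ε hε using hy'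
  let ψ : MvPolynomial (Pt n) k →ₐ[k] MvPolynomial (Fin n ⊕ Finset (Fin n)) k :=
    aeval fun S => (((ε S : ℤˣ) : ℤ) : MvPolynomial _ k) * monomial (ev u S) 1
  have hψ : ∀ S, ψ (X S) = (((ε S : ℤˣ) : ℤ) : MvPolynomial _ k) * monomial (ev u S) 1 :=
    fun S => aeval_X _ _
  refine ⟨ψ, ε, hψ, ?_⟩
  let x0 : Fin n → HahnSeries ℝ (MvPolynomial (Fin n ⊕ Finset (Fin n)) k) :=
    fun i => HahnSeries.single (c i) (X (Sum.inl i))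
  let M : Fin 2 × Fin n → HahnSeries ℝ (MvPolynomial (Fin n ⊕ Finset (Fin n)) k) :=
    fun p => if p.1 = 0 then x0 p.2 else x0 p.2 * y p.2
  let Θ : MvPolynomial (Fin 2 × Fin n) k →+*
      HahnSeries ℝ (MvPolynomial (Fin n ⊕ Finset (Fin n)) k) :=
    eval₂Hom (HahnSeries.C.comp (algebraMap k (MvPolynomial (Fin n ⊕ Finset (Fin n)) k))) M
  let Φ : MvPolynomial (Pt n) k →+* HahnSeries ℝ (MvPolynomial (Fin n ⊕ Finset (Fin n)) k) :=
    Θ.comp (pluckerMap k 2 n).toRingHom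
  have hΦ : ∀ g, Φ g = Θ (pluckerMap k 2 n g) := fun g => rfl
  have hC : ∀ a, Φ (C a) = HahnSeries.C (algebraMap k _ a) := by
    intro a
    have e : pluckerMap k 2 n (C a) = C a := (pluckerMap k 2 n).commutes a
    rw [hΦ, e]
    exact eval₂Hom_C _ _ _
  have h0 : ∀ i, Θ (X (0, i)) = x0 i := by
    intro i
    have : Θ (X (0, i)) = M (0, i) := eval₂Hom_X' _ _ _
    rw [this]; simp [M]
  have h1 : ∀ i, Θ (X (1, i)) = x0 i * y i := by
    intro i
    have : Θ (X (1, i)) = M (1, i) := eval₂Hom_X' _ _ _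
    rw [this]; simp [M]
  have hL : ∀ S, Lead (Φ (X S)) (w S) (ψ (X S)) := by
    intro S
    have e1 : Φ (X S) = x0 (lo S) * x0 (hi S) * (y (hi S) - y (lo S)) := by
      rw [hΦ, pluckerMap_X, map_sub, map_mul, map_mul, h0, h0, h1, h1]; ring
    have e2 : w S = c (lo S) + c (hi S) + u (lo S) (hi S) := by
      conv_lhs => rw [← pr_lo_hi S]
      rw [hc]; ring
    have e3 : ψ (X S) = X (Sum.inl (lo S)) * X (Sum.inl (hi S)) *
        ((((ε S : ℤˣ) : ℤ) : MvPolynomial _ k) * X (Sum.inr (ball u (lo S) (hi S)))) := by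
      have : (monomial (ev u S) (1 : k)) = X (Sum.inl (lo S)) * X (Sum.inl (hi S)) *
          X (Sum.inr (ball u (lo S) (hi S))) := by
        simp [ev, X, monomial_mul]
      rw [hψ, this]; ring
    rw [e1, e2, e3]
    exact ((lead_single _ _).mul (lead_single _ _)).mul (hε S)
  intro f hf
  apply initForm_mem_ker Φ hC ψ w hL
  rw [hΦ]
  have : pluckerMap k 2 n f = 0 := hf
  rw [this, map_zero]

end PluckerAux

/-- if the minimum in the four-point condition is attained exactly twice for
every quadruple (so that `in_w(I_{2,n})` is a binomial ideal), then the initial ideal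
`in_w(I_{2,n})` of the Plücker ideal is prime. -/
theorem initIdeal_pluckerIdeal_two_isPrime (k : Type) [Field k] (n : ℕ) (hn : 4 ≤ n)
    (w : {s : Finset (Fin n) // s.card = 2} → ℝ) (hw : StrictFourPoint w) :
    (initIdeal w (pluckerIdeal k 2 n)).IsPrime := by
  obtain ⟨u, c, hs, hu, hc⟩ := PluckerAux.exists_u hn w hw
  obtain ⟨ψ, ε, hX, hker⟩ := PluckerAux.exists_psi (k := k) w u c hs hu hc
  have hψ := PluckerAux.psi_monomial u ψ ε hX
  have hQ : ∀ f ∈ initIdeal w (pluckerIdeal k 2 n), ψ f = 0 := by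
    have : initIdeal w (pluckerIdeal k 2 n) ≤ RingHom.ker ψ := by
      unfold initIdeal
      rw [Ideal.span_le]
      rintro g ⟨f, hf, rfl⟩
      exact hker f hf
    exact fun f hf => this hf
  have hmoves : PluckerAux.Moves u (initIdeal w (pluckerIdeal k 2 n)) := by
    intro i j l m hij hil him hjl hjm hlm h1 h2
    apply PluckerAux.move w hij hil him hjl hjm hlm
    · rw [hc, hc, hc, hc]; linarith
    · rw [hc, hc, hc, hc]; linarith
  have hrel := PluckerAux.rel_EE u ψ hψ _ hQ
  have hconn : ∀ a b, PluckerAux.EE u a = PluckerAux.EE u b →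
      PluckerAux.Rel (initIdeal w (pluckerIdeal k 2 n)) a b :=
    fun a b h => PluckerAux.connect hs hu hmoves hrel _ a b rfl h
  have heq : initIdeal w (pluckerIdeal k 2 n) = RingHom.ker ψ := by
    apply le_antisymm
    · exact fun f hf => hQ f hf
    · exact fun f hf => PluckerAux.ker_le u ψ hψ _ hQ hconn _ f le_rfl hf
  rw [heq]
  exact RingHom.ker_isPrime ψ
end

section
/- Let k be any field, let n ≥ 4, and let w ∈ ℝ^{C(n,2)} be such that the initial ideal in_w(I_{2,n}) of the Plücker ideal I_{2,n} contains no monomial. Then in_w(I_{2,n}) is generated by homogeneous polynomials of degree two; indeed it is generated by the initial forms in_w(p_{ij}p_{kl} − p_{ik}p_{jl} + p_{il}p_{jk}) of the quadratic Plücker relations, 1 ≤ i < j < k < l ≤ n. -/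
open scoped Classical

open MvPolynomial

namespace PL

noncomputable def W {n : ℕ} (w : {s : Finset (Fin n) // s.card = 2} → ℝ) (i j : Fin n) : ℝ :=
  if h : i ≠ j then w (pr i j h) else 0

theorem pr_comm {n : ℕ} (i j : Fin n) (h : i ≠ j) : pr i j h = pr j i h.symm := by
  simp [pr, Finset.pair_comm]

theorem W_comm {n : ℕ} (w : {s : Finset (Fin n) // s.card = 2} → ℝ) (i j : Fin n) :
    W w i j = W w j i := by
  unfold W
  by_cases h : i = j
  · subst h; rfl
  · simp [h, Ne.symm h, pr_comm i j h]

/-- signed variable -/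
noncomputable def P (k : Type) [Field k] {n : ℕ} (i j : Fin n) :
    MvPolynomial {s : Finset (Fin n) // s.card = 2} k :=
  if h : i < j then X (pr i j h.ne) else if h : j < i then - X (pr i j h.ne') else 0

theorem P_anti (k : Type) [Field k] {n : ℕ} (i j : Fin n) : P k i j = - P k j i := by
  unfold P
  rcases lt_trichotomy i j with h | h | h
  · simp [h, h.not_gt, pr_comm j i h.ne']
  · subst h; simp
  · simp [h, h.not_gt, pr_comm i j h.ne']

theorem P_sign (k : Type) [Field k] {n : ℕ} (i j : Fin n) (h : i ≠ j) :
    ∃ e : k, (e = 1 ∨ e = -1) ∧ P k i j = C e * X (pr i j h) := by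
  unfold P
  rcases lt_trichotomy i j with h' | h' | h'
  · exact ⟨1, Or.inl rfl, by simp [h']⟩
  · exact absurd h' h
  · exact ⟨-1, Or.inr rfl, by simp [h', h'.not_gt]⟩

theorem map_X (k : Type) [Field k] {n : ℕ} (i j : Fin n) (h : i < j) :
    pluckerMap k 2 n (X (pr i j h.ne)) =
      X (0, i) * X (1, j) - X (0, j) * X (1, i) := by
  have h0 : ((pr i j h.ne).1.orderEmbOfFin (pr i j h.ne).2 0) = i := by
    have := Finset.orderEmbOfFin_zero (s := (pr i j h.ne).1) (pr i j h.ne).2 (by norm_num)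
    refine this.trans ?_
    simp [pr, Finset.min'_insert, h.le]
  have h1 : ((pr i j h.ne).1.orderEmbOfFin (pr i j h.ne).2 1) = j := by
    have := Finset.orderEmbOfFin_last (s := (pr i j h.ne).1) (pr i j h.ne).2 (by norm_num)
    refine this.trans ?_
    simp [pr, Finset.max'_insert, h.le]
  simp only [pluckerMap, aeval_X, Matrix.det_fin_two, Matrix.of_apply,
    Finset.coe_orderIsoOfFin_apply, h0, h1]

theorem map_P (k : Type) [Field k] {n : ℕ} (i j : Fin n) :
    pluckerMap k 2 n (P k i j) = X (0, i) * X (1, j) - X (0, j) * X (1, i) := by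
  unfold P
  rcases lt_trichotomy i j with h | h | h
  · simp [h, map_X k i j h]
  · subst h; simp
  · simp only [h, h.not_gt, dif_pos, dif_neg, not_false_iff, map_neg]
    rw [pr_comm, map_X k j i h]; ring

noncomputable def R (k : Type) [Field k] {n : ℕ} (a b c d : Fin n) :
    MvPolynomial {s : Finset (Fin n) // s.card = 2} k :=
  P k a c * P k b d - P k a b * P k c d - P k a d * P k b c

theorem R_mem (k : Type) [Field k] {n : ℕ} (a b c d : Fin n) :
    R k a b c d ∈ pluckerIdeal k 2 n := by
  rw [pluckerIdeal, RingHom.mem_ker]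
  simp only [R, map_sub, map_mul, map_P]
  ring

theorem R_sorted (k : Type) [Field k] {n : ℕ} (i j l m : Fin n)
    (hij : i < j) (hjl : j < l) (hlm : l < m) :
    R k i j l m = - pluckerQuadric k i j l m hij hjl hlm := by
  simp only [R, P, pluckerQuadric, hij, hjl, hlm, hij.trans hjl, hjl.trans hlm,
    hij.trans (hjl.trans hlm), dif_pos]
  ring

def Z (k : Type) [Field k] {n : ℕ} (a b c d : Fin n) : Prop :=
  ∃ (i j l m : Fin n) (hij : i < j) (hjl : j < l) (hlm : l < m),
    R k a b c d = pluckerQuadric k i j l m hij hjl hlm ∨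
    R k a b c d = - pluckerQuadric k i j l m hij hjl hlm

theorem Z_neg (k : Type) [Field k] {n : ℕ} {a b c d a' b' c' d' : Fin n}
    (h : R k a b c d = - R k a' b' c' d') (hz : Z k a' b' c' d') : Z k a b c d := by
  obtain ⟨i, j, l, m, h1, h2, h3, h4⟩ := hz
  refine ⟨i, j, l, m, h1, h2, h3, ?_⟩
  rcases h4 with h4 | h4
  · right; rw [h, h4]
  · left; rw [h, h4, neg_neg]

theorem R1 (k : Type) [Field k] {n : ℕ} (a b c d : Fin n) : R k a b c d = - R k b a c d := by
  simp only [R]; rw [P_anti k b a]; ring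
theorem R2 (k : Type) [Field k] {n : ℕ} (a b c d : Fin n) : R k a b c d = - R k a c b d := by
  simp only [R]; rw [P_anti k c b]; ring
theorem R3 (k : Type) [Field k] {n : ℕ} (a b c d : Fin n) : R k a b c d = - R k a b d c := by
  simp only [R]; rw [P_anti k d c]; ring

theorem Z_all (k : Type) [Field k] {n : ℕ} (a b c d : Fin n) (hab : a ≠ b) (hac : a ≠ c)
    (had : a ≠ d) (hbc : b ≠ c) (hbd : b ≠ d) (hcd : c ≠ d) : Z k a b c d := by
  have s0 : ∀ a b c d : Fin n, a < b → b < c → c < d → Z k a b c d := fun a b c d h1 h2 h3 =>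
    ⟨a, b, c, d, h1, h2, h3, Or.inr (R_sorted k a b c d h1 h2 h3)⟩
  -- insert d
  have s1 : ∀ a b c d : Fin n, a < b → b < c → a ≠ d → b ≠ d → c ≠ d → Z k a b c d := by
    intro a b c d h1 h2 h3 h4 h5
    rcases lt_or_gt_of_ne h5 with h | h
    · exact s0 _ _ _ _ h1 h2 h
    refine Z_neg k (R3 k a b c d) ?_
    rcases lt_or_gt_of_ne h4 with h' | h'
    · exact s0 _ _ _ _ h1 h' h
    refine Z_neg k (R2 k a b d c) ?_
    rcases lt_or_gt_of_ne h3 with h'' | h''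
    · exact s0 _ _ _ _ h'' h' h2
    refine Z_neg k (R1 k a d b c) ?_
    exact s0 _ _ _ _ h'' h1 h2
  have s2 : ∀ a b c d : Fin n, a < b → a ≠ c → b ≠ c → a ≠ d → b ≠ d → c ≠ d → Z k a b c d := by
    intro a b c d h1 hac hbc h3 h4 h5
    rcases lt_or_gt_of_ne hbc with h | h
    · exact s1 _ _ _ _ h1 h h3 h4 h5
    refine Z_neg k (R2 k a b c d) ?_
    rcases lt_or_gt_of_ne hac with h' | h'
    · exact s1 _ _ _ _ h' h h3 h5 h4
    refine Z_neg k (R1 k a c b d) ?_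
    exact s1 _ _ _ _ h' h1 h5 h3 h4
  rcases lt_or_gt_of_ne hab with h | h
  · exact s2 _ _ _ _ h hac hbc had hbd hcd
  · exact Z_neg k (R1 k a b c d) (s2 _ _ _ _ h hbc hac hbd had hcd)

theorem quadric_mem (k : Type) [Field k] {n : ℕ} (i j l m : Fin n)
    (hij : i < j) (hjl : j < l) (hlm : l < m) :
    pluckerQuadric k i j l m hij hjl hlm ∈ pluckerIdeal k 2 n := by
  have := R_mem k i j l m
  rw [R_sorted k i j l m hij hjl hlm] at this
  exact neg_mem_iff.mp this

end PL
namespace PL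

theorem ultra_order {α : Type*} (δ : α → α → ℝ) (hs : ∀ i j, δ i j = δ j i)
    (S : Finset α)
    (hu : ∀ i ∈ S, ∀ j ∈ S, ∀ l ∈ S, i ≠ j → i ≠ l → j ≠ l → δ i j ≤ max (δ i l) (δ l j)) :
    ∃ pos : α → ℕ, Set.InjOn pos S ∧
      ∀ i ∈ S, ∀ j ∈ S, ∀ l ∈ S, pos i < pos j → pos j < pos l →
        δ i j ≤ δ i l ∧ δ j l ≤ δ i l := by
  induction S using Finset.induction_on with
  | empty => exact ⟨fun _ => 0, by simp, by simp⟩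
  | insert x S hx ih =>
    obtain ⟨pos, hinj, hpos⟩ := ih (fun i hi j hj l hl => hu i (Finset.mem_insert_of_mem hi) j
      (Finset.mem_insert_of_mem hj) l (Finset.mem_insert_of_mem hl))
    rcases S.eq_empty_or_nonempty with rfl | hne
    · refine ⟨fun _ => 0, by simp, by simp⟩
    obtain ⟨y0, hy0, hmin0⟩ := S.exists_min_image (fun y => δ x y) hne
    obtain ⟨y, hy, hymax⟩ := (S.filter (fun z => δ x z = δ x y0)).exists_max_image pos
      ⟨y0, by simp [hy0]⟩
    rw [Finset.mem_filter] at hy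
    obtain ⟨hyS, hyy⟩ := hy
    have hmin : ∀ z ∈ S, δ x y ≤ δ x z := fun z hz => hyy ▸ hmin0 z hz
    have hgt : ∀ z ∈ S, pos y < pos z → δ x y < δ x z := by
      intro z hz hlt
      refine lt_of_le_of_ne (hmin z hz) fun h => ?_
      have := hymax z (by rw [Finset.mem_filter]; exact ⟨hz, by rw [← h, hyy]⟩)
      omega
    have hne' : ∀ z ∈ S, z ≠ x := fun z hz h => hx (h ▸ hz)
    have hmax : ∀ z ∈ S, z ≠ y → δ x z = max (δ x y) (δ y z) := by
      intro z hz hzy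
      have h1 := hu x (Finset.mem_insert_self _ _) z (Finset.mem_insert_of_mem hz) y
        (Finset.mem_insert_of_mem hyS) (hne' z hz).symm (hne' y hyS).symm hzy
      have h2 := hu y (Finset.mem_insert_of_mem hyS) z (Finset.mem_insert_of_mem hz) x
        (Finset.mem_insert_self _ _) hzy.symm (hne' y hyS) (hne' z hz)
      rw [hs y x, max_eq_right (hmin z hz)] at h2
      exact le_antisymm h1 (max_le (hmin z hz) h2)
    have hposne : ∀ z ∈ S, z ≠ y → pos z ≠ pos y := fun z hz h h' => h (hinj hz hyS h')
    refine ⟨fun z => if z = x then 2 * pos y + 1 else 2 * pos z, ?_, ?_⟩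
    · intro a ha b hb hab
      simp only [Finset.coe_insert, Set.mem_insert_iff, Finset.mem_coe] at ha hb
      rcases ha with rfl | ha <;> rcases hb with rfl | hb
      · rfl
      · simp [hne' b hb] at hab; omega
      · simp [hne' a ha] at hab; omega
      · simp [hne' a ha, hne' b hb] at hab
        exact hinj ha hb hab
    · intro i hi j hj l hl hij hjl
      rw [Finset.mem_insert] at hi hj hl
      rcases hi with rfl | hi <;> rcases hj with rfl | hj <;> rcases hl with rfl | hl
      · simp at hij
      · simp at hij
      · simp at hij hjl; omega
      · simp [hne' j hj, hne' l hl] at hij hjl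
        have hj' : pos y < pos j := by omega
        have e1 := hmax j hj (by rintro rfl; omega)
        have e2 := hmax l hl (by rintro rfl; omega)
        have g1 := hgt j hj hj'
        have g2 := hgt l hl (by omega)
        have := hpos y hyS j hj l hl hj' hjl
        constructor
        · rw [e1, e2]; exact max_le_max le_rfl this.1
        · rw [e2]; exact this.2.trans (le_max_right _ _)
      · simp at hjl
      · simp [hne' i hi, hne' l hl] at hij hjl
        have hl' : pos y < pos l := by omega
        have g2 := hgt l hl (by omega)
        have e2 := hmax l hl (by rintro rfl; omega)
        have e3 : δ i l ≥ δ y l := by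
          by_cases h : i = y
          · rw [h]
          · have := hposne i hi h
            exact (hpos i hi y hyS l hl (by omega) hl').2
        have e4 : δ j l = δ y l := by
          rw [e2] at g2 ⊢
          rcases lt_max_iff.mp g2 with h | h
          · exact absurd h (lt_irrefl _)
          · exact max_eq_right h.le
        constructor
        · by_cases h : i = y
          · subst h; rw [hs i j]; linarith
          · have := hposne i hi h
            have t := (hpos i hi y hyS l hl (by omega) hl').1
            rw [hs i j, hmax i hi h, hs y i]
            exact max_le (by linarith) t
        · linarith
      · simp [hne' i hi, hne' j hj] at hij hjl
        have hiy : i ≠ y := by rintro rfl; omega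
        rw [hs i l, hs j l, hmax i hi hiy]
        by_cases h : j = y
        · subst h
          exact ⟨by rw [hs i j]; exact le_max_right _ _, le_max_left _ _⟩
        · have := hposne j hj h
          have t := hpos i hi j hj y hyS hij (by omega)
          rw [hmax j hj h, hs y i, hs y j]
          exact ⟨t.1.trans (le_max_right _ _), max_le_max le_rfl t.2⟩
      · simp [hne' i hi, hne' j hj, hne' l hl] at hij hjl
        exact hpos i hi j hj l hl hij hjl

/-- planar order from the four-point condition -/
theorem planar {α : Type*} [Fintype α] [Nonempty α] (W : α → α → ℝ) (hs : ∀ i j, W i j = W j i)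
    (h4 : ∀ i j l m : α, i ≠ j → i ≠ l → i ≠ m → j ≠ l → j ≠ m → l ≠ m →
      min (W i l + W j m) (W i m + W j l) ≤ W i j + W l m) :
    ∃ pos : α → ℕ, Function.Injective pos ∧ ∀ a b c d, pos a < pos b → pos b < pos c →
      pos c < pos d → W a c + W b d ≤ W a b + W c d ∧ W a c + W b d ≤ W a d + W b c := by
  obtain ⟨r⟩ := ‹Nonempty α›
  let δ : α → α → ℝ := fun i j => W r i + W r j - W i j
  obtain ⟨pos, hinj, hpos⟩ := ultra_order δ (fun i j => by simp only [δ, hs i j]; ring)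
    (Finset.univ.erase r) (by
      intro i hi j hj l hl hij hil hjl
      simp only [Finset.mem_erase, Finset.mem_univ, and_true] at hi hj hl
      have := h4 r l i j hl.symm hi.symm hj.symm hil.symm hjl.symm hij
      simp only [δ]
      rw [hs l i, hs l j] at *
      rcases min_le_iff.mp this with h | h
      · exact le_max_of_le_right (by linarith)
      · exact le_max_of_le_left (by linarith))
  refine ⟨fun z => if z = r then 0 else pos z + 1, ?_, ?_⟩
  · intro a b hab
    by_cases ha : a = r <;> by_cases hb : b = r
    · rw [ha, hb]
    · simp [ha, hb] at hab
    · simp [ha, hb] at hab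
    · simp [ha, hb] at hab
      exact hinj (by simp [ha]) (by simp [hb]) hab
  · intro a b c d hab hbc hcd
    have hb : b ≠ r := by rintro rfl; simp at hab
    have hc : c ≠ r := by rintro rfl; simp at hbc
    have hd : d ≠ r := by rintro rfl; simp at hcd
    simp only [hb, hc, hd, if_false, add_lt_add_iff_right] at hab hbc hcd
    have mem : ∀ z, z ≠ r → z ∈ Finset.univ.erase r := by simp
    have t1 := hpos b (mem b hb) c (mem c hc) d (mem d hd) hbc hcd
    simp only [δ] at t1
    by_cases ha : a = r
    · subst ha
      constructor <;> linarith [t1.1, t1.2]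
    · simp only [ha, if_false, add_lt_add_iff_right] at hab
      have t2 := hpos a (mem a ha) b (mem b hb) c (mem c hc) hab hbc
      have t3 := hpos a (mem a ha) b (mem b hb) d (mem d hd) hab (by omega)
      have t4 := hpos a (mem a ha) c (mem c hc) d (mem d hd) (by omega) (by omega)
      have u := h4 a d b c
      have u1 : δ a d ≤ max (δ a c) (δ b d) := by
        by_contra hlt
        rw [not_le, max_lt_iff] at hlt
        simp only [δ] at hlt
        have hab' : a ≠ b := by rintro rfl; omega
        have hbd' : b ≠ d := by rintro rfl; omega
        have had' : a ≠ d := by rintro rfl; omega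
        have := h4 r b a d hb.symm (Ne.symm ha) (Ne.symm hd) hab'.symm hbd' had'
        rw [hs b a] at this
        rcases min_le_iff.mp this with h | h <;> linarith [t2.1, t2.2]
      simp only [δ] at t2 t3 t4 u1
      constructor
      · linarith [t2.1, t1.2]
      · rcases le_max_iff.mp u1 with h | h <;> linarith [t2.2, t1.1]

end PL
namespace PL

/-- lo/hi structure on pairs with respect to a position function -/
structure LH {n : ℕ} (pos : Fin n → ℕ) where
  lo : {s : Finset (Fin n) // s.card = 2} → Fin n
  hi : {s : Finset (Fin n) // s.card = 2} → Fin n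
  lt : ∀ s, pos (lo s) < pos (hi s)
  ne : ∀ s, lo s ≠ hi s
  eq : ∀ s, s = pr (lo s) (hi s) (ne s)

theorem exists_LH {n : ℕ} (pos : Fin n → ℕ) (hinj : Function.Injective pos) :
    Nonempty (LH pos) := by
  have : ∀ s : {s : Finset (Fin n) // s.card = 2}, ∃ a b : Fin n, pos a < pos b ∧ ∃ h : a ≠ b,
      s = pr a b h := by
    intro s
    obtain ⟨a, b, hab, he⟩ := Finset.card_eq_two.mp s.2
    rcases lt_or_gt_of_ne (fun h => hab (hinj h)) with h | h
    · exact ⟨a, b, h, hab, Subtype.ext he⟩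
    · exact ⟨b, a, h, hab.symm, Subtype.ext (by rw [he, pr, Finset.pair_comm])⟩
  choose lo hi h1 h2 h3 using this
  exact ⟨⟨lo, hi, h1, h2, h3⟩⟩

variable {n : ℕ} {pos : Fin n → ℕ}

theorem LH.ext' (L : LH pos) {s t} (h1 : L.lo s = L.lo t) (h2 : L.hi s = L.hi t) : s = t := by
  rw [L.eq s, L.eq t]; simp only [h1, h2]

theorem LH.pr_lo_hi (L : LH pos) (a b : Fin n) (h : pos a < pos b) (hne : a ≠ b) :
    L.lo (pr a b hne) = a ∧ L.hi (pr a b hne) = b := by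
  have h1 := congrArg Subtype.val (L.eq (pr a b hne))
  have h2 := L.lt (pr a b hne)
  simp only [pr] at h1
  have ha : a ∈ ({L.lo (pr a b hne), L.hi (pr a b hne)} : Finset (Fin n)) := by
    rw [show ({L.lo (pr a b hne), L.hi (pr a b hne)} : Finset (Fin n)) = {a, b} from h1.symm]; simp
  have hb : b ∈ ({L.lo (pr a b hne), L.hi (pr a b hne)} : Finset (Fin n)) := by
    rw [show ({L.lo (pr a b hne), L.hi (pr a b hne)} : Finset (Fin n)) = {a, b} from h1.symm]; simp
  simp only [Finset.mem_insert, Finset.mem_singleton] at ha hb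
  rcases ha with ha | ha <;> rcases hb with hb | hb
  · exact absurd (ha.trans hb.symm) hne
  · exact ⟨ha.symm, hb.symm⟩
  · rw [← ha, ← hb] at h2; omega
  · exact absurd (ha.trans hb.symm) hne

def NC (L : LH pos) (a : {s : Finset (Fin n) // s.card = 2} →₀ ℕ) : Prop :=
  ∀ s t, a s ≠ 0 → a t ≠ 0 → ¬ (pos (L.lo s) < pos (L.lo t) ∧ pos (L.lo t) < pos (L.hi s) ∧
    pos (L.hi s) < pos (L.hi t))

noncomputable def E (L : LH pos) (s : {s : Finset (Fin n) // s.card = 2}) : Fin 2 × Fin n →₀ ℕ :=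
  Finsupp.single (0, L.lo s) 1 + Finsupp.single (1, L.hi s) 1

noncomputable def Ld (L : LH pos) (a : {s : Finset (Fin n) // s.card = 2} →₀ ℕ) :
    Fin 2 × Fin n →₀ ℕ := Finsupp.linearCombination ℕ (E L) a

theorem Ld_apply (L : LH pos) (a : {s : Finset (Fin n) // s.card = 2} →₀ ℕ) (x) :
    Ld L a x = ∑ s, a s * E L s x := by
  rw [Ld, Finsupp.linearCombination_apply, Finsupp.sum_fintype _ _ (by simp)]
  simp [Finsupp.finsetSum_apply]

theorem Ld_lo (L : LH pos) (a : {s : Finset (Fin n) // s.card = 2} →₀ ℕ) (i) :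
    Ld L a (0, i) ≠ 0 ↔ ∃ s, a s ≠ 0 ∧ L.lo s = i := by
  rw [Ld_apply, Ne, Finset.sum_eq_zero_iff]
  simp [E, Finsupp.single_apply, and_comm]

theorem Ld_hi (L : LH pos) (a : {s : Finset (Fin n) // s.card = 2} →₀ ℕ) (i) :
    Ld L a (1, i) ≠ 0 ↔ ∃ s, a s ≠ 0 ∧ L.hi s = i := by
  rw [Ld_apply, Ne, Finset.sum_eq_zero_iff]
  simp [E, Finsupp.single_apply, and_comm]

theorem common (hinj : Function.Injective pos) (L : LH pos)
    (a b : {s : Finset (Fin n) // s.card = 2} →₀ ℕ)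
    (ha : NC L a) (hb : NC L b) (h : Ld L a = Ld L b) (hne : a ≠ 0) :
    ∃ s, a s ≠ 0 ∧ b s ≠ 0 := by
  obtain ⟨s, hs, hmin⟩ := a.support.exists_min_image (fun s => pos (L.hi s) - pos (L.lo s))
    (Finsupp.support_nonempty_iff.mpr hne)
  rw [Finsupp.mem_support_iff] at hs
  have hmin' : ∀ t, a t ≠ 0 → pos (L.hi s) - pos (L.lo s) ≤ pos (L.hi t) - pos (L.lo t) :=
    fun t ht => hmin t (Finsupp.mem_support_iff.mpr ht)
  obtain ⟨t, ht, hts⟩ := (Ld_lo L b (L.lo s)).mp (h ▸ (Ld_lo L a _).mpr ⟨s, hs, rfl⟩)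
  obtain ⟨u, hu, hus⟩ := (Ld_hi L b (L.hi s)).mp (h ▸ (Ld_hi L a _).mpr ⟨s, hs, rfl⟩)
  have ls := L.lt s
  have lt := L.lt t
  have lu := L.lt u
  have c1 : pos (L.hi s) ≤ pos (L.hi t) := by
    by_contra hc
    obtain ⟨v, hv, hvt⟩ := (Ld_hi L a (L.hi t)).mp (h ▸ (Ld_hi L b _).mpr ⟨t, ht, rfl⟩)
    have k1 := ha v s hv hs
    have k2 := hmin' v hv
    have lv := L.lt v
    rw [hts] at lt
    rw [hvt] at k1 k2 lv
    omega
  have c2 : pos (L.lo u) ≤ pos (L.lo s) := by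
    by_contra hc
    obtain ⟨v, hv, hvt⟩ := (Ld_lo L a (L.lo u)).mp (h ▸ (Ld_lo L b _).mpr ⟨u, hu, rfl⟩)
    have k1 := ha s v hs hv
    have k2 := hmin' v hv
    have lv := L.lt v
    rw [hus] at lu
    rw [hvt] at k1 k2 lv
    omega
  rcases c1.eq_or_lt with c1 | c1
  · have : t = s := L.ext' hts (hinj c1.symm)
    exact ⟨s, hs, this ▸ ht⟩
  rcases c2.eq_or_lt with c2 | c2
  · have : u = s := L.ext' (hinj c2) hus
    exact ⟨s, hs, this ▸ hu⟩
  exfalso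
  refine hb u t hu ht ⟨by rw [hts]; exact c2, by rw [hts, hus]; exact ls, by rw [hus]; exact c1⟩

theorem NC_mono (L : LH pos) {a b : {s : Finset (Fin n) // s.card = 2} →₀ ℕ} (h : NC L (a + b)) :
    NC L a := by
  intro s t hs ht
  exact h s t (by simp [hs]) (by simp [ht])

theorem split (a : {s : Finset (Fin n) // s.card = 2} →₀ ℕ) (s) (h : a s ≠ 0) :
    ∃ a', a = a' + Finsupp.single s 1 := by
  refine ⟨a - Finsupp.single s 1, (tsub_add_cancel_of_le ?_).symm⟩
  rw [Finsupp.single_le_iff]; omega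

theorem Ld_inj (hinj : Function.Injective pos) (L : LH pos) :
    ∀ (N : ℕ) (a b : {s : Finset (Fin n) // s.card = 2} →₀ ℕ), a.degree = N →
    NC L a → NC L b → Ld L a = Ld L b → a = b := by
  intro N
  induction N with
  | zero =>
    intro a b hN ha hb h
    by_contra hne
    have h0 : a = 0 := (Finsupp.degree_eq_zero_iff a).mp hN
    obtain ⟨s, h1, h2⟩ := common hinj L b a hb ha h.symm (fun h => hne (h0.trans h.symm))
    rw [h0] at h2; exact h2 rfl
  | succ N ih =>
    intro a b hN ha hb h
    have hne : a ≠ 0 := by rintro rfl; simp at hN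
    obtain ⟨s, h1, h2⟩ := common hinj L a b ha hb h hne
    obtain ⟨a', rfl⟩ := split a s h1
    obtain ⟨b', rfl⟩ := split b s h2
    congr 1
    refine ih a' b' ?_ (NC_mono L ha) (NC_mono L hb) ?_
    · simpa using hN
    · simpa [Ld] using h

noncomputable def phi (k : Type) [Field k] (pos : Fin n → ℕ) :
    MvPolynomial (Fin 2 × Fin n) k →ₐ[k] Polynomial (MvPolynomial (Fin 2 × Fin n) k) :=
  aeval fun x => if x.1 = 0 then Polynomial.C (X x) else Polynomial.C (X x) * Polynomial.X ^ pos x.2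

noncomputable def psi (k : Type) [Field k] (pos : Fin n → ℕ) :
    MvPolynomial {s : Finset (Fin n) // s.card = 2} k →ₐ[k]
      Polynomial (MvPolynomial (Fin 2 × Fin n) k) := (phi k pos).comp (pluckerMap k 2 n)

theorem psi_P (k : Type) [Field k] (i j : Fin n) : psi k pos (P k i j) =
    Polynomial.C (X (0,i) * X (1,j)) * Polynomial.X ^ pos j
     - Polynomial.C (X (0,j) * X (1,i)) * Polynomial.X ^ pos i := by
  simp only [psi, AlgHom.comp_apply, map_P, map_sub, map_mul, phi, aeval_X]
  simp
  ring

theorem psi_X (k : Type) [Field k] (L : LH pos) (s) :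
    (psi k pos (X s)).natDegree = pos (L.hi s) ∧
    ∃ e : k, e ≠ 0 ∧ (psi k pos (X s)).leadingCoeff = monomial (E L s) e := by
  obtain ⟨e, he, hP⟩ := P_sign k (L.lo s) (L.hi s) (L.ne s)
  rw [← L.eq s] at hP
  have hee : e * e = 1 := by rcases he with rfl | rfl <;> ring
  have he0 : e ≠ 0 := by rintro rfl; simp at hee
  have hX : (X s : MvPolynomial _ k) = C e * P k (L.lo s) (L.hi s) := by
    rw [hP, ← mul_assoc, ← C_mul, hee, C_1, one_mul]
  have hE : (C e * (X (0, L.lo s) * X (1, L.hi s)) : MvPolynomial (Fin 2 × Fin n) k)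
      = monomial (E L s) e := by
    rw [X, X, monomial_mul, C_mul_monomial]; simp [E]
  have hpsi : psi k pos (X s) = Polynomial.C (monomial (E L s) e) * Polynomial.X ^ pos (L.hi s) -
      Polynomial.C (C e * (X (0,L.hi s) * X (1,L.lo s))) * Polynomial.X ^ pos (L.lo s) := by
    rw [hX, map_mul, psi_P, ← hE]
    have : psi k pos (C e) = Polynomial.C (C e) := by
      rw [← MvPolynomial.algebraMap_eq, AlgHom.commutes]; rfl
    rw [this]; simp only [map_mul]; ring
  have hne : monomial (E L s) e ≠ 0 := by simpa using he0
  have hd : (Polynomial.C (C e * (X (0,L.hi s) * X (1,L.lo s))) * Polynomial.X ^ pos (L.lo s) :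
      Polynomial (MvPolynomial (Fin 2 × Fin n) k)).degree <
      (Polynomial.C (monomial (E L s) e) * Polynomial.X ^ pos (L.hi s) :
      Polynomial (MvPolynomial (Fin 2 × Fin n) k)).degree := by
    rw [Polynomial.degree_C_mul_X_pow _ hne]
    refine (Polynomial.degree_C_mul_X_pow_le _ _).trans_lt ?_
    exact_mod_cast L.lt s
  refine ⟨?_, e, he0, ?_⟩
  · rw [hpsi, Polynomial.natDegree_sub_eq_left_of_natDegree_lt, Polynomial.natDegree_C_mul_X_pow _ _ hne]
    rw [Polynomial.natDegree_C_mul_X_pow _ _ hne]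
    exact (Polynomial.natDegree_C_mul_X_pow_le _ _).trans_lt (L.lt s)
  · rw [hpsi, Polynomial.leadingCoeff_sub_of_degree_lt hd, Polynomial.leadingCoeff_C_mul_X_pow]

theorem psi_monomial (k : Type) [Field k] (L : LH pos)
    (a : {s : Finset (Fin n) // s.card = 2} →₀ ℕ) :
    ∃ e : k, e ≠ 0 ∧ (psi k pos (monomial a 1)).leadingCoeff = monomial (Ld L a) e := by
  induction a using Finsupp.induction_linear with
  | zero => exact ⟨1, one_ne_zero, by
      rw [show (monomial 0 (1:k) : MvPolynomial {s : Finset (Fin n) // s.card = 2} k) = 1 from rfl]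
      simp [Ld]⟩
  | add a b iha ihb =>
    obtain ⟨e, he, h1⟩ := iha
    obtain ⟨f, hf, h2⟩ := ihb
    refine ⟨e * f, mul_ne_zero he hf, ?_⟩
    rw [← one_mul (1 : k), ← monomial_mul, map_mul, Polynomial.leadingCoeff_mul, h1, h2,
      monomial_mul]
    simp [Ld]
  | single s m =>
    obtain ⟨_, e, he, h⟩ := psi_X k L s
    refine ⟨e ^ m, pow_ne_zero _ he, ?_⟩
    rw [← one_pow (M := k) m, show (monomial (Finsupp.single s m) ((1:k)^m)) = X s ^ m by
      rw [X_pow_eq_monomial, one_pow], map_pow, Polynomial.leadingCoeff_pow, h, monomial_pow]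
    simp [Ld]

theorem indep (k : Type) [Field k] (hinj : Function.Injective pos) (L : LH pos)
    (h : MvPolynomial {s : Finset (Fin n) // s.card = 2} k)
    (hI : h ∈ pluckerIdeal k 2 n) (hnc : ∀ a ∈ h.support, NC L a) : h = 0 := by
  by_contra hne
  obtain ⟨a, ha, hmax⟩ := h.support.exists_max_image
    (fun a => (psi k pos (monomial a 1)).natDegree) (MvPolynomial.support_nonempty.mpr hne)
  have h0 : psi k pos h = 0 := by
    rw [psi, AlgHom.comp_apply, (RingHom.mem_ker.mp hI : pluckerMap k 2 n h = 0), map_zero]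
  have hsum : psi k pos h = ∑ b ∈ h.support, coeff b h • psi k pos (monomial b 1) := by
    conv_lhs => rw [h.as_sum]
    rw [map_sum]
    refine Finset.sum_congr rfl fun b _ => ?_
    rw [← map_smul, smul_monomial, smul_eq_mul, mul_one]
  have h1 := congrArg (fun p => coeff (Ld L a) (Polynomial.coeff p
    (psi k pos (monomial a 1)).natDegree)) (hsum.symm.trans h0)
  simp only [Polynomial.finsetSum_coeff, Polynomial.coeff_smul, coeff_sum, coeff_smul,
    Polynomial.coeff_zero, coeff_zero] at h1
  rw [Finset.sum_eq_single a] at h1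
  · obtain ⟨e, he, hl⟩ := psi_monomial k L a
    rw [Polynomial.coeff_natDegree, hl, coeff_monomial, if_pos rfl, smul_eq_mul] at h1
    exact mul_ne_zero (mem_support_iff.mp ha) he h1
  · intro b hb hba
    rcases (hmax b hb).eq_or_lt with hd | hd
    · obtain ⟨e, he, hl⟩ := psi_monomial k L b
      rw [← hd, Polynomial.coeff_natDegree, hl, coeff_monomial, if_neg, smul_zero]
      intro heq
      exact hba (Ld_inj hinj L _ b a rfl (hnc b hb) (hnc a ha) heq)
    · rw [Polynomial.coeff_eq_zero_of_natDegree_lt hd]; simp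
  · intro h; exact absurd ha h

end PL
namespace PL

theorem expWeight_eq {σ : Type*} (w : σ → ℝ) (a : σ →₀ ℕ) :
    expWeight w a = Finsupp.weight w a := by
  simp [expWeight, Finsupp.weight_apply]

theorem T_mono {σ : Type*} {k : Type*} [Field k] (w : σ → ℝ) (m : ℝ) (a : σ →₀ ℕ) (c : k) :
    weightedHomogeneousComponent w m (monomial a c) =
      if Finsupp.weight w a = m then monomial a c else 0 := by
  ext b
  rw [coeff_weightedHomogeneousComponent]
  by_cases h : a = b
  · subst h
    split_ifs <;> simp
  · split_ifs <;> simp [coeff_monomial, h]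

theorem initForm_eq {σ : Type*} {k : Type*} [Field k] (w : σ → ℝ) (f : MvPolynomial σ k)
    (a : σ →₀ ℕ) (ha : a ∈ f.support)
    (h : ∀ b ∈ f.support, Finsupp.weight w a ≤ Finsupp.weight w b) :
    initForm w f = weightedHomogeneousComponent w (Finsupp.weight w a) f := by
  rw [initForm, weightedHomogeneousComponent_apply]
  refine Finset.sum_congr (Finset.filter_congr fun b hb => ?_) fun _ _ => rfl
  simp only [expWeight_eq]
  constructor
  · intro h'; exact le_antisymm (h' a ha) (h b hb)
  · intro h' c hc; rw [h']; exact h c hc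

theorem initForm_neg {σ : Type*} {k : Type*} [Field k] (w : σ → ℝ) (f : MvPolynomial σ k) :
    initForm w (-f) = - initForm w f := by
  simp [initForm, Finset.sum_neg_distrib]

noncomputable def M {σ : Type*} (s t : σ) : σ →₀ ℕ := Finsupp.single s 1 + Finsupp.single t 1

theorem weight_M {σ : Type*} (w : σ → ℝ) (s t : σ) : Finsupp.weight w (M s t) = w s + w t := by
  simp [M, Finsupp.weight_apply, Finsupp.sum_add_index, add_mul]

theorem M_ne {σ : Type*} {s t u v : σ} (h1 : s ≠ u) (h2 : s ≠ v) : M s t ≠ M u v := by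
  intro h
  have := DFunLike.congr_fun h s
  simp [M, Finsupp.single_apply, h1.symm, h2.symm] at this

theorem pr_ne {n : ℕ} {a b c d : Fin n} (h : a ≠ b) (h' : c ≠ d) (h1 : a ≠ c) (h2 : a ≠ d) :
    pr a b h ≠ pr c d h' := by
  intro he
  have := congrArg Subtype.val he
  simp only [pr] at this
  have ha : a ∈ ({c, d} : Finset (Fin n)) := by rw [← this]; simp
  simp [h1, h2] at ha

variable {n : ℕ}

theorem R_form (k : Type) [Field k] (a b c d : Fin n) (hab : a ≠ b) (hac : a ≠ c)
    (had : a ≠ d) (hbc : b ≠ c) (hbd : b ≠ d) (hcd : c ≠ d) :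
    ∃ e0 e1 e2 : k, e0 ≠ 0 ∧ R k a b c d = monomial (M (pr a c hac) (pr b d hbd)) e0
      - monomial (M (pr a b hab) (pr c d hcd)) e1 - monomial (M (pr a d had) (pr b c hbc)) e2 := by
  obtain ⟨e1, h1, p1⟩ := P_sign k a c hac
  obtain ⟨e2, h2, p2⟩ := P_sign k b d hbd
  obtain ⟨e3, h3, p3⟩ := P_sign k a b hab
  obtain ⟨e4, h4, p4⟩ := P_sign k c d hcd
  obtain ⟨e5, h5, p5⟩ := P_sign k a d had
  obtain ⟨e6, h6, p6⟩ := P_sign k b c hbc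
  have hm : ∀ (s t : {s : Finset (Fin n) // s.card = 2}) (x y : k),
      (C x * X s) * (C y * X t) = monomial (M s t) (x * y) := by
    intro s t x y
    rw [C_mul_X_eq_monomial, C_mul_X_eq_monomial, monomial_mul, M]
  refine ⟨e1 * e2, e3 * e4, e5 * e6, ?_, ?_⟩
  · rcases h1 with rfl | rfl <;> rcases h2 with rfl | rfl <;> simp
  · rw [R, p1, p2, p3, p4, p5, p6, hm, hm, hm]

theorem R_init (k : Type) [Field k] (w : {s : Finset (Fin n) // s.card = 2} → ℝ)
    (a b c d : Fin n) (hab : a ≠ b) (hac : a ≠ c)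
    (had : a ≠ d) (hbc : b ≠ c) (hbd : b ≠ d) (hcd : c ≠ d)
    (hy : w (pr a c hac) + w (pr b d hbd) ≤ w (pr a b hab) + w (pr c d hcd))
    (hz : w (pr a c hac) + w (pr b d hbd) ≤ w (pr a d had) + w (pr b c hbc)) :
    initForm w (R k a b c d) =
      weightedHomogeneousComponent w (w (pr a c hac) + w (pr b d hbd)) (R k a b c d) := by
  obtain ⟨e0, e1, e2, he0, hR⟩ := R_form k a b c d hab hac had hbc hbd hcd
  rw [← weight_M]
  have n1 : M (pr a c hac) (pr b d hbd) ≠ M (pr a b hab) (pr c d hcd) := by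
    refine M_ne ?_ (pr_ne hac hcd hac had)
    rw [pr_comm a c]; exact pr_ne _ _ hac.symm hbc.symm
  have n2 : M (pr a c hac) (pr b d hbd) ≠ M (pr a d had) (pr b c hbc) := by
    refine M_ne ?_ (pr_ne hac hbc hab hac)
    rw [pr_comm a c]; exact pr_ne _ _ hac.symm hcd
  apply initForm_eq
  · rw [mem_support_iff, hR]
    simp [coeff_monomial, n1.symm, n2.symm, he0]
  · intro x hx
    rw [mem_support_iff, hR] at hx
    simp only [coeff_sub, coeff_monomial] at hx
    rw [weight_M]
    by_cases x1 : M (pr a c hac) (pr b d hbd) = x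
    · rw [← x1, weight_M]
    by_cases x2 : M (pr a b hab) (pr c d hcd) = x
    · rw [← x2, weight_M]; exact hy
    by_cases x3 : M (pr a d had) (pr b c hbc) = x
    · rw [← x3, weight_M]; exact hz
    simp [x1, x2, x3] at hx

theorem R_T (k : Type) [Field k] (w : {s : Finset (Fin n) // s.card = 2} → ℝ)
    (a b c d : Fin n) (hab : a ≠ b) (hac : a ≠ c)
    (had : a ≠ d) (hbc : b ≠ c) (hbd : b ≠ d) (hcd : c ≠ d)
    (hy : w (pr a c hac) + w (pr b d hbd) ≤ w (pr a b hab) + w (pr c d hcd))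
    (hz : w (pr a c hac) + w (pr b d hbd) ≤ w (pr a d had) + w (pr b c hbc)) :
    weightedHomogeneousComponent w (w (pr a c hac) + w (pr b d hbd)) (R k a b c d) ∈
      Ideal.span { g | ∃ (i j l m : Fin n) (hij : i < j) (hjl : j < l) (hlm : l < m),
          g = initForm w (pluckerQuadric k i j l m hij hjl hlm) } := by
  rw [← R_init k w a b c d hab hac had hbc hbd hcd hy hz]
  obtain ⟨i, j, l, m, h1, h2, h3, h4⟩ := Z_all k a b c d hab hac had hbc hbd hcd
  rcases h4 with h4 | h4
  · rw [h4]; exact Ideal.subset_span ⟨i, j, l, m, h1, h2, h3, rfl⟩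
  · rw [h4, initForm_neg]; exact neg_mem (Ideal.subset_span ⟨i, j, l, m, h1, h2, h3, rfl⟩)

theorem four_point (k : Type) [Field k] (w : {s : Finset (Fin n) // s.card = 2} → ℝ)
    (hw : MonomialFree (initIdeal w (pluckerIdeal k 2 n)))
    (a b c d : Fin n) (hab : a ≠ b) (hac : a ≠ c)
    (had : a ≠ d) (hbc : b ≠ c) (hbd : b ≠ d) (hcd : c ≠ d) :
    w (pr a b hab) + w (pr c d hcd) ≤ w (pr a c hac) + w (pr b d hbd) ∨
    w (pr a d had) + w (pr b c hbc) ≤ w (pr a c hac) + w (pr b d hbd) := by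
  by_contra hcon
  push Not at hcon
  obtain ⟨hy, hz⟩ := hcon
  have hi := R_init k w a b c d hab hac had hbc hbd hcd hy.le hz.le
  obtain ⟨e0, e1, e2, he0, hR⟩ := R_form k a b c d hab hac had hbc hbd hcd
  refine hw (initForm w (R k a b c d)) (Ideal.subset_span ⟨_, R_mem k a b c d, rfl⟩)
    ⟨M (pr a c hac) (pr b d hbd), e0, he0, ?_⟩
  rw [hi, hR]
  simp only [map_sub, T_mono, weight_M]
  simp [hy.ne', hz.ne']

variable {pos : Fin n → ℕ}

noncomputable def gg (L : LH pos) (N : ℕ) (s : {s : Finset (Fin n) // s.card = 2}) : ℕ :=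
  (pos (L.hi s) - pos (L.lo s)) * (N - (pos (L.hi s) - pos (L.lo s)))

noncomputable def mu (L : LH pos) (N : ℕ) (a : {s : Finset (Fin n) // s.card = 2} →₀ ℕ) : ℕ :=
  Finsupp.linearCombination ℕ (gg L N) a

theorem mu_M (L : LH pos) (N : ℕ) (a : {s : Finset (Fin n) // s.card = 2} →₀ ℕ) (s t) :
    mu L N (a + M s t) = mu L N a + (gg L N s + gg L N t) := by
  simp [mu, M]

theorem g_ineq (A B Cc D N : ℕ) (h1 : A < B) (h2 : B < Cc) (h3 : Cc < D) (h4 : D < N) :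
    (B - A) * (N - (B - A)) + (D - Cc) * (N - (D - Cc)) <
      (Cc - A) * (N - (Cc - A)) + (D - B) * (N - (D - B)) ∧
    (D - A) * (N - (D - A)) + (Cc - B) * (N - (Cc - B)) <
      (Cc - A) * (N - (Cc - A)) + (D - B) * (N - (D - B)) := by
  obtain ⟨x, rfl⟩ := Nat.exists_eq_add_of_lt h1
  obtain ⟨y, rfl⟩ := Nat.exists_eq_add_of_lt h2
  obtain ⟨z, rfl⟩ := Nat.exists_eq_add_of_lt h3
  obtain ⟨u, rfl⟩ := Nat.exists_eq_add_of_lt h4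
  zify
  repeat rw [Nat.cast_sub (by omega)]
  push_cast
  have hx : (0:ℤ) ≤ x := by positivity
  have hy : (0:ℤ) ≤ y := by positivity
  have hz : (0:ℤ) ≤ z := by positivity
  have hu : (0:ℤ) ≤ u := by positivity
  have hA : (0:ℤ) ≤ A := by positivity
  constructor
  · have : (0:ℤ) < 2 * (y + 1) * (u + 1 + A) := by positivity
    nlinarith
  · have : (0:ℤ) < 2 * (x + 1) * (z + 1) := by positivity
    nlinarith

theorem straighten (k : Type) [Field k] (w : {s : Finset (Fin n) // s.card = 2} → ℝ)
    (L : LH pos) (N : ℕ) (hN : ∀ i, pos i < N)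
    (hW : ∀ a b c d, pos a < pos b → pos b < pos c →
      pos c < pos d → W w a c + W w b d ≤ W w a b + W w c d ∧
        W w a c + W w b d ≤ W w a d + W w b c)
    (J : Ideal (MvPolynomial {s : Finset (Fin n) // s.card = 2} k))
    (hJ : J = Ideal.span { g | ∃ (i j l m : Fin n) (hij : i < j) (hjl : j < l) (hlm : l < m),
          g = initForm w (pluckerQuadric k i j l m hij hjl hlm) }) :
    ∀ (K : ℕ) (a : {s : Finset (Fin n) // s.card = 2} →₀ ℕ), mu L N a = K →
    ∃ h : MvPolynomial {s : Finset (Fin n) // s.card = 2} k,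
      (∀ b ∈ h.support, NC L b) ∧
      (∀ b ∈ h.support, Finsupp.weight w a ≤ Finsupp.weight w b) ∧
      monomial a 1 - h ∈ pluckerIdeal k 2 n ∧
      monomial a 1 - weightedHomogeneousComponent w (Finsupp.weight w a) h ∈ J := by
  intro K
  induction K using Nat.strong_induction_on with
  | _ K ih =>
  intro a hK
  by_cases hnc : NC L a
  · refine ⟨monomial a 1, ?_, ?_, ?_, ?_⟩
    · intro b hb
      have : b = a := by simpa [support_monomial] using hb
      exact this ▸ hnc
    · intro b hb
      have : b = a := by simpa [support_monomial] using hb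
      rw [this]
    · simp
    · rw [T_mono]; simp
  · simp only [NC] at hnc
    push Not at hnc
    obtain ⟨s, t, hs, ht, l1, l2, l3⟩ := hnc
    obtain ⟨a1, rfl⟩ := split a s hs
    have hst : s ≠ t := by rintro rfl; omega
    obtain ⟨a', rfl⟩ := split a1 t (by simpa [Finsupp.single_apply, hst] using ht)
    rw [show a' + Finsupp.single t 1 + Finsupp.single s 1 = a' + M s t by
      rw [M, add_assoc, add_comm (Finsupp.single t 1)]] at *
    obtain ⟨A, hA⟩ : ∃ A, A = L.lo s := ⟨_, rfl⟩
    obtain ⟨B, hB⟩ : ∃ B, B = L.lo t := ⟨_, rfl⟩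
    obtain ⟨Cc, hC⟩ : ∃ B, B = L.hi s := ⟨_, rfl⟩
    obtain ⟨D, hD⟩ : ∃ B, B = L.hi t := ⟨_, rfl⟩
    rw [← hA, ← hB] at l1
    rw [← hB, ← hC] at l2
    rw [← hC, ← hD] at l3
    have hab : A ≠ B := by rintro h; rw [h] at l1; omega
    have hac : A ≠ Cc := by rintro h; rw [h] at l1; omega
    have had : A ≠ D := by rintro h; rw [h] at l1; omega
    have hbc : B ≠ Cc := by rintro h; rw [h] at l2; omega
    have hbd : B ≠ D := by rintro h; rw [h] at l2; omega
    have hcd : Cc ≠ D := by rintro h; rw [h] at l3; omega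
    have es : s = pr A Cc hac := by rw [L.eq s]; simp only [← hA, ← hC]
    have et : t = pr B D hbd := by rw [L.eq t]; simp only [← hB, ← hD]
    clear hA hB hC hD
    subst es et
    have gi := g_ineq (pos A) (pos B) (pos Cc) (pos D) N l1 l2 l3 (hN D)
    obtain ⟨v1, v2⟩ := hW A B Cc D l1 l2 l3
    simp only [W, hab, hac, had, hbc, hbd, hcd, ne_eq, not_false_iff, dif_pos] at v1 v2
    have hT := R_T k w A B Cc D hab hac had hbc hbd hcd v1 v2
    rw [← hJ] at hT
    have hI := R_mem k A B Cc D
    obtain ⟨e0, e1, e2, he0, hR⟩ := R_form k A B Cc D hab hac had hbc hbd hcd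
    have gval : ∀ (x y : Fin n) (h : x ≠ y), pos x < pos y →
        gg L N (pr x y h) = (pos y - pos x) * (N - (pos y - pos x)) := by
      intro x y h hlt
      rw [gg, (L.pr_lo_hi x y hlt h).1, (L.pr_lo_hi x y hlt h).2]
    rw [mu_M, gval _ _ _ (by omega), gval _ _ _ (by omega)] at hK
    obtain ⟨h1, n1, w1, i1, j1⟩ := ih (mu L N (a' + M (pr A B hab) (pr Cc D hcd)))
      (by rw [mu_M, gval _ _ _ (by omega), gval _ _ _ (by omega)]; omega) _ rfl
    obtain ⟨h2, n2, w2, i2, j2⟩ := ih (mu L N (a' + M (pr A D had) (pr B Cc hbc)))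
      (by rw [mu_M, gval _ _ _ (by omega), gval _ _ _ (by omega)]; omega) _ rfl
    have hsup : ∀ b ∈ (C (e0⁻¹ * e1) * h1 + C (e0⁻¹ * e2) * h2).support,
        b ∈ h1.support ∨ b ∈ h2.support := by
      intro b hb
      by_contra hcon
      push Not at hcon
      rw [notMem_support_iff, notMem_support_iff] at hcon
      rw [mem_support_iff] at hb
      rw [coeff_add, coeff_C_mul, coeff_C_mul, hcon.1, hcon.2] at hb
      simp at hb
    simp only [map_add, weight_M] at w1 w2 j1 j2 ⊢
    have key1 : ∀ (h : MvPolynomial {s : Finset (Fin n) // s.card = 2} k)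
        (m m' : ℝ) (q : MvPolynomial {s : Finset (Fin n) // s.card = 2} k), m ≤ m' →
        (∀ b ∈ h.support, m' ≤ Finsupp.weight w b) →
        q - weightedHomogeneousComponent w m' h ∈ J →
        (if m' = m then q else 0) - weightedHomogeneousComponent w m h ∈ J := by
      intro h m m' q hm hb hq
      split_ifs with hmm
      · rw [← hmm]; exact hq
      · rw [weightedHomogeneousComponent_eq_zero']
        · simp
        · intro d hd he
          have := hb d hd
          rw [he] at this
          exact hmm (le_antisymm this hm)
    have kk1 := key1 h1 (Finsupp.weight w a' + (w (pr A Cc hac) + w (pr B D hbd))) _ _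
      (by linarith) w1 j1
    have kk2 := key1 h2 (Finsupp.weight w a' + (w (pr A Cc hac) + w (pr B D hbd))) _ _
      (by linarith) w2 j2
    refine ⟨C (e0⁻¹ * e1) * h1 + C (e0⁻¹ * e2) * h2, ?_, ?_, ?_, ?_⟩
    · intro b hb
      rcases hsup b hb with h | h
      · exact n1 b h
      · exact n2 b h
    · intro b hb
      rcases hsup b hb with h | h
      · linarith [w1 b h]
      · linarith [w2 b h]
    · have : monomial (a' + M (pr A Cc hac) (pr B D hbd)) 1 -
          (C (e0⁻¹ * e1) * h1 + C (e0⁻¹ * e2) * h2) =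
        monomial a' e0⁻¹ * R k A B Cc D
        + C (e0⁻¹ * e1) * (monomial (a' + M (pr A B hab) (pr Cc D hcd)) 1 - h1)
        + C (e0⁻¹ * e2) * (monomial (a' + M (pr A D had) (pr B Cc hbc)) 1 - h2) := by
        rw [hR]
        simp only [mul_sub, monomial_mul, C_mul_monomial, inv_mul_cancel₀ he0, mul_one]
        ring
      rw [this]
      exact add_mem (add_mem (Ideal.mul_mem_left _ _ hI) (Ideal.mul_mem_left _ _ i1))
        (Ideal.mul_mem_left _ _ i2)
    · rw [hR] at hT
      simp only [map_sub, T_mono, weight_M] at hT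
      simp only [add_right_inj] at kk1 kk2
      rw [map_add, weightedHomogeneousComponent_C_mul, weightedHomogeneousComponent_C_mul]
      have := add_mem (add_mem (Ideal.mul_mem_left J (monomial a' e0⁻¹) hT)
        (Ideal.mul_mem_left _ (C (e0⁻¹ * e1)) kk1)) (Ideal.mul_mem_left _ (C (e0⁻¹ * e2)) kk2)
      convert this using 1
      simp only [mul_sub, mul_ite, mul_zero, monomial_mul, C_mul_monomial, inv_mul_cancel₀ he0,
        mul_one, if_true]
      ring

theorem init_mem (k : Type) [Field k] (w : {s : Finset (Fin n) // s.card = 2} → ℝ)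
    (hn : 0 < n) (hw : MonomialFree (initIdeal w (pluckerIdeal k 2 n)))
    (J : Ideal (MvPolynomial {s : Finset (Fin n) // s.card = 2} k))
    (hJ : J = Ideal.span { g | ∃ (i j l m : Fin n) (hij : i < j) (hjl : j < l) (hlm : l < m),
          g = initForm w (pluckerQuadric k i j l m hij hjl hlm) })
    (f : MvPolynomial {s : Finset (Fin n) // s.card = 2} k) (hf : f ∈ pluckerIdeal k 2 n) :
    initForm w f ∈ J := by
  have : Nonempty (Fin n) := ⟨⟨0, hn⟩⟩
  obtain ⟨pos, hinj, hW⟩ := planar (W w) (W_comm w) (by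
    intro i j l m hij hil him hjl hjm hlm
    have := four_point k w hw i l j m hil hij him hjl.symm hlm hjm
    simp only [W, hij, hil, him, hjl, hjm, hlm, ne_eq, not_false_iff, dif_pos]
    rw [pr_comm l j] at this
    rcases this with h | h
    · exact min_le_iff.mpr (Or.inl h)
    · exact min_le_iff.mpr (Or.inr h))
  obtain ⟨L⟩ := exists_LH pos hinj
  obtain ⟨N, hN⟩ : ∃ N, ∀ i, pos i < N :=
    ⟨(Finset.univ.sup pos) + 1, fun i => Nat.lt_succ_of_le (Finset.le_sup (Finset.mem_univ i))⟩
  have hS := fun a => straighten k w L N hN hW J hJ _ a rfl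
  choose h h1 h2 h3 h4 using hS
  by_cases hf0 : f = 0
  · subst hf0; simp [initForm]
  obtain ⟨a, ha, hmin⟩ := f.support.exists_min_image (fun a => Finsupp.weight w a)
    (support_nonempty.mpr hf0)
  rw [initForm_eq w f a ha hmin]
  set m := Finsupp.weight w a
  have e1 : f = ∑ b ∈ f.support, C (coeff b f) * monomial b 1 := by
    conv_lhs => rw [f.as_sum]
    simp [C_mul_monomial]
  set H := ∑ b ∈ f.support, C (coeff b f) * h b with hH
  have hHI : H ∈ pluckerIdeal k 2 n := by
    have hd : (∑ b ∈ f.support, C (coeff b f) * monomial b 1) - H ∈ pluckerIdeal k 2 n := by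
      rw [hH, ← Finset.sum_sub_distrib]
      refine sum_mem fun b _ => ?_
      rw [← mul_sub]
      exact Ideal.mul_mem_left _ _ (h3 b)
    rw [← e1] at hd
    have := sub_mem hf hd
    simpa using this
  have hH0 : H = 0 := by
    refine indep k hinj L H hHI fun x hx => ?_
    rw [mem_support_iff, hH, coeff_sum] at hx
    obtain ⟨b, _, hb⟩ := Finset.exists_ne_zero_of_sum_ne_zero hx
    rw [coeff_C_mul] at hb
    exact h1 b x (mem_support_iff.mpr (right_ne_zero_of_mul hb))
  have : weightedHomogeneousComponent w m (∑ b ∈ f.support, C (coeff b f) * monomial b 1)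
      - weightedHomogeneousComponent w m H ∈ J := by
    rw [hH, map_sum, map_sum, ← Finset.sum_sub_distrib]
    refine sum_mem fun b hb => ?_
    rw [weightedHomogeneousComponent_C_mul, weightedHomogeneousComponent_C_mul, ← mul_sub]
    refine Ideal.mul_mem_left _ _ ?_
    rw [T_mono]
    split_ifs with hbm
    · rw [← hbm]; exact h4 b
    · rw [weightedHomogeneousComponent_eq_zero']
      · simp
      · intro d hd he
        have q1 := h2 b d hd
        have q2 := hmin b hb
        rw [he] at q1
        exact hbm (le_antisymm q1 q2)
  rw [hH0, ← e1] at this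
  simpa using this

theorem quadric_hom (k : Type) [Field k] (w : {s : Finset (Fin n) // s.card = 2} → ℝ)
    (i j l m : Fin n) (hij : i < j) (hjl : j < l) (hlm : l < m) :
    IsHomogeneous (initForm w (pluckerQuadric k i j l m hij hjl hlm)) 2 := by
  have hq : IsHomogeneous (pluckerQuadric k i j l m hij hjl hlm) 2 := by
    unfold pluckerQuadric
    have : ∀ s t : {s : Finset (Fin n) // s.card = 2},
      IsHomogeneous (X s * X t : MvPolynomial _ k) 2 := fun s t =>
        (isHomogeneous_X k s).mul (isHomogeneous_X k t)
    exact ((this _ _).sub (this _ _)).add (this _ _)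
  unfold initForm
  refine IsHomogeneous.sum _ _ _ fun a ha => ?_
  rw [Finset.mem_filter, mem_support_iff] at ha
  refine isHomogeneous_monomial _ ?_
  have := hq ha.1
  rwa [Finsupp.degree_eq_weight_one]

end PL

/-- if the initial ideal `in_w(I_{2,n})` of the Plücker ideal contains no
monomial, then it is generated by homogeneous polynomials of degree two; indeed it is
generated by the initial forms of the quadratic Plücker relations. -/
theorem initIdeal_pluckerIdeal_two_generated_by_quadrics (k : Type) [Field k] (n : ℕ)
    (hn : 4 ≤ n) (w : {s : Finset (Fin n) // s.card = 2} → ℝ)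
    (hw : MonomialFree (initIdeal w (pluckerIdeal k 2 n))) :
    (∃ G : Set (MvPolynomial {s : Finset (Fin n) // s.card = 2} k),
        (∀ g ∈ G, MvPolynomial.IsHomogeneous g 2) ∧
        initIdeal w (pluckerIdeal k 2 n) = Ideal.span G)
    ∧ initIdeal w (pluckerIdeal k 2 n) =
        Ideal.span { g | ∃ (i j l m : Fin n) (hij : i < j) (hjl : j < l) (hlm : l < m),
          g = initForm w (pluckerQuadric k i j l m hij hjl hlm) } := by
  have hEq : initIdeal w (pluckerIdeal k 2 n) =
        Ideal.span { g | ∃ (i j l m : Fin n) (hij : i < j) (hjl : j < l) (hlm : l < m),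
          g = initForm w (pluckerQuadric k i j l m hij hjl hlm) } := by
    apply le_antisymm
    · refine Ideal.span_le.mpr ?_
      rintro g ⟨f, hf, rfl⟩
      exact PL.init_mem k w (by omega) hw _ rfl f hf
    · refine Ideal.span_mono ?_
      rintro g ⟨i, j, l, m, h1, h2, h3, rfl⟩
      exact ⟨_, PL.quadric_mem k i j l m h1 h2 h3, rfl⟩
  refine ⟨⟨_, ?_, hEq⟩, hEq⟩
  rintro g ⟨i, j, l, m, h1, h2, h3, rfl⟩
  exact PL.quadric_hom k w i j l m h1 h2 h3
end
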